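/- arXiv:1008.1744 — 3 statements merged into one kernel-verified Lean document; each statement's English description precedes it below -/
import Mathlib

section
/- Let μ be a Borel probability measure on ℝ, absolutely continuous with respect to Lebesgue measure λ, with density f. Let g be a probability density on ℝ with compressor G, and assume the support of μ is contained in a compact interval I such that ess inf_I g > 0 and g = 0 λ-a.e. on ℝ ∖ I. Then for every r ≥ 1, lim_{N→∞} N^r·D_μ(Q_{g,N}) = C(r)·∫_I f/g^r dλ. -/
open MeasureTheory Filter Set
open scoped ENNReal Topology Classical

noncomputable section

/-- A scalar quantizer: a Borel measurable map `ℝ → ℝ` with countable range. -/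
def IsQuantizer (q : ℝ → ℝ) : Prop :=
  Measurable q ∧ (Set.range q).Countable

/-- The Rényi entropy of order `α ∈ [-∞,∞]` of the quantizer `q` with respect to `μ`. -/
def renyiEntropy (α : EReal) (μ : Measure ℝ) (q : ℝ → ℝ) : EReal :=
  if α = ⊤ then
    - ENNReal.log (⨆ a : ℝ, μ (q ⁻¹' {a}))
  else if α = ⊥ then
    - ENNReal.log (⨅ a ∈ {a : ℝ | 0 < μ (q ⁻¹' {a})}, μ (q ⁻¹' {a}))
  else if α = 1 then
    ((∑' a : ℝ, ENNReal.ofReal (-((μ (q ⁻¹' {a})).toReal * Real.log (μ (q ⁻¹' {a})).toReal)) : ℝ≥0∞) : EReal)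
  else
    (((1 - α.toReal)⁻¹ : ℝ) : EReal) *
      ENNReal.log (∑' a : ℝ, if 0 < μ (q ⁻¹' {a}) then μ (q ⁻¹' {a}) ^ α.toReal else 0)

/-- The `r`-th power distortion of the quantizer `q` with respect to `μ`. -/
def distortion (r : ℝ) (μ : Measure ℝ) (q : ℝ → ℝ) : ℝ≥0∞ :=
  ∫⁻ x, ENNReal.ofReal (|x - q x| ^ r) ∂μ

/-- The optimal quantization error under Rényi entropy constraint `R` of order `α`. -/
def optErr (r : ℝ) (α : EReal) (μ : Measure ℝ) (R : ℝ) : ℝ≥0∞ :=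
  ⨅ (q : ℝ → ℝ) (_ : IsQuantizer q ∧ renyiEntropy α μ q ≤ (R : EReal)), distortion r μ q

/-- The (topological) support of a measure on `ℝ`. -/
def msupport (μ : Measure ℝ) : Set ℝ :=
  {x : ℝ | ∀ ε > 0, 0 < μ (Set.Ioo (x - ε) (x + ε))}

/-- The constant `C(r) = 1/((1+r)2^r)`. -/
def Cr (r : ℝ) : ℝ := 1 / ((1 + r) * 2 ^ r)

/-- `a₁ = (1-α+αr)/(1-α+r)`. -/
def a1 (α r : ℝ) : ℝ := (1 - α + α * r) / (1 - α + r)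

/-- `a₂ = (1-α+r)/(1-α)`. -/
def a2 (α r : ℝ) : ℝ := (1 - α + r) / (1 - α)

/-- The class `Q^c`: quantizers with finitely many codecells, each an interval,
with each codepoint in the closure of its codecell. -/
def Qc (q : ℝ → ℝ) : Prop :=
  Measurable q ∧ (Set.range q).Finite ∧
    ∀ a ∈ Set.range q, (q ⁻¹' {a}).OrdConnected ∧ a ∈ closure (q ⁻¹' {a})

/-- The compressor associated with a point density `g`. -/
def compressor (g : ℝ → ℝ) (x : ℝ) : ℝ := ∫ y in Set.Iic x, g y

/-- The generalized inverse of the compressor of `g`, extended to `[0,1]` by the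
endpoints of the support of `g·λ`. -/
def geninv (g : ℝ → ℝ) (y : ℝ) : ℝ :=
  if y ≤ 0 then sInf (msupport (volume.withDensity fun x => ENNReal.ofReal (g x)))
  else if 1 ≤ y then sSup (msupport (volume.withDensity fun x => ENNReal.ofReal (g x)))
  else sSup {x : ℝ | compressor g x ≤ y}

/-- The `N`-level uniform quantizer on `[0,1]`: each cell `((i-1)/N, i/N]`
(the first cell being `[0,1/N]`) is mapped to its midpoint `(2i-1)/(2N)`. -/
def uniformQ (N : ℕ) (x : ℝ) : ℝ :=
  ((2 * max 1 ⌈x * (N : ℝ)⌉ - 1 : ℤ) : ℝ) / (2 * (N : ℝ))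

/-- The `N`-level companding quantizer with point density `g`. -/
def compand (g : ℝ → ℝ) (N : ℕ) (x : ℝ) : ℝ :=
  geninv g (uniformQ N (compressor g x))

/-- The infinite-level uniform quantizer with step `Δ`, mapping `(iΔ,(i+1)Δ]` to `(i+1/2)Δ`. -/
def unifQ (Δ : ℝ) (x : ℝ) : ℝ := (((⌈x / Δ⌉ : ℤ) : ℝ) - 1 / 2) * Δ

/-- The quantizer obtained from `unifQ Δ` by keeping only codecells entirely inside `M`. -/
def unifQres (Δ : ℝ) (M : Set ℝ) (x : ℝ) : ℝ :=
  if unifQ Δ ⁻¹' {unifQ Δ x} ⊆ M then unifQ Δ x else 0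

/-- The Rényi differential entropy of order `α ∈ ℝ` of `μ` with density `f`. -/
def diffEntropyR (α : ℝ) (μ : Measure ℝ) (f : ℝ → ℝ) : ℝ :=
  if α = 1 then -∫ x, f x * Real.log (f x)
  else (1 - α)⁻¹ * Real.log (∫ x in msupport μ, f x ^ α)

/-- The Rényi relative entropy of order `α ∈ [-∞,∞)` between `μ = f·λ` and `ν = g·λ`. -/
def relEntropyR (α : EReal) (μ : Measure ℝ) (f g : ℝ → ℝ) : ℝ :=
  if α = ⊥ then
    Real.log (essInf (fun x => f x / g x)
      (volume.restrict (Set.Ioo (sInf (msupport μ)) (sSup (msupport μ)))))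
  else if α = 1 then ∫ x in {x : ℝ | 0 < f x}, f x * Real.log (f x / g x)
  else (α.toReal - 1)⁻¹ *
    Real.log (∫ x in {x : ℝ | 0 < f x}, f x ^ α.toReal * g x ^ (1 - α.toReal))

/-- Rescaled characters of the circle average out against absolutely continuous finite measures. -/
theorem tendsto_integral_fourier_natCast_mul (ρ : Measure ℝ) [IsFiniteMeasure ρ]
    (hρ : ρ ≪ volume) {n : ℤ} (hn : n ≠ 0) :
    Tendsto (fun N : ℕ => ∫ y, fourier n (((N : ℝ) * y : ℝ) : UnitAddCircle) ∂ρ)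
      atTop (𝓝 0) := by
  have h := Real.tendsto_integral_exp_smul_cocompact
    (fun y => (((ρ.rnDeriv volume y).toReal : ℝ) : ℂ))
  have h2 : Tendsto (fun N : ℕ => -((n : ℝ) * N)) atTop (cocompact ℝ) := by
    have h3 : Tendsto (fun N : ℕ => |(n : ℝ)| * (N : ℝ)) atTop atTop :=
      tendsto_natCast_atTop_atTop.const_mul_atTop (by positivity)
    rw [← Metric.cobounded_eq_cocompact, ← tendsto_norm_atTop_iff_cobounded]
    refine h3.congr fun N => ?_
    simp
  refine (h.comp h2).congr fun N => ?_
  rw [← integral_rnDeriv_smul hρ]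
  refine integral_congr_ae (Eventually.of_forall fun y => ?_)
  simp only [fourier_coe_apply, Circle.smul_def, Real.fourierChar_apply, smul_eq_mul,
    Complex.real_smul]
  rw [mul_comm]
  congr 2
  push_cast
  ring

/-- **Fejér's lemma** for finite absolutely continuous measures on the line: rapidly oscillating
continuous periodic functions converge weakly to their mean. -/
theorem tendsto_integral_continuousMap_natCast_mul (ρ : Measure ℝ) [IsFiniteMeasure ρ]
    (hρ : ρ ≪ volume) (F : C(UnitAddCircle, ℂ)) :
    Tendsto (fun N : ℕ => ∫ y, F (((N : ℝ) * y : ℝ) : UnitAddCircle) ∂ρ) atTop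
      (𝓝 ((ρ.real univ : ℂ) * ∫ z, F z)) := by
  have hint (F : C(UnitAddCircle, ℂ)) (N : ℕ) :
      Integrable (fun y : ℝ => F (((N : ℝ) * y : ℝ) : UnitAddCircle)) ρ := by
    refine Integrable.of_bound (C := ‖F‖) ?_ (Eventually.of_forall fun y => F.norm_coe_le_norm _)
    refine (F.continuous.comp ?_).aestronglyMeasurable
    exact (AddCircle.continuous_mk' 1).comp (continuous_const.mul continuous_id)
  have hint' (F : C(UnitAddCircle, ℂ)) : Integrable F (volume : Measure UnitAddCircle) :=
    Integrable.of_bound (C := ‖F‖) F.continuous.aestronglyMeasurable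
      (Eventually.of_forall fun y => F.norm_coe_le_norm _)
  have hspan : ∀ P ∈ Submodule.span ℂ (range (@fourier 1)),
      Tendsto (fun N : ℕ => ∫ y, P (((N : ℝ) * y : ℝ) : UnitAddCircle) ∂ρ) atTop
        (𝓝 ((ρ.real univ : ℂ) * ∫ z, P z)) := by
    intro P hP
    induction hP using Submodule.span_induction with
    | mem P hP =>
      obtain ⟨n, rfl⟩ := hP
      have hcoef := congrFun (fourierCoeff_fourier (T := 1) n) 0
      simp only [fourierCoeff, neg_zero, fourier_zero, one_smul,
        AddCircle.integral_haarAddCircle, inv_one] at hcoef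
      rw [hcoef]
      rcases eq_or_ne n 0 with rfl | hn
      · simp
      · simpa [Pi.single_apply, hn.symm] using tendsto_integral_fourier_natCast_mul ρ hρ hn
    | zero => simp
    | add P Q _ _ hP hQ =>
      simp only [ContinuousMap.add_apply]
      rw [integral_add (hint' P) (hint' Q), mul_add]
      refine (hP.add hQ).congr fun N => ?_
      rw [integral_add (hint P N) (hint Q N)]
    | smul a P _ hP =>
      simp only [ContinuousMap.smul_apply, smul_eq_mul, integral_const_mul]
      rw [mul_left_comm]
      exact hP.const_mul a
  have hF : F ∈ (Submodule.span ℂ (range (@fourier 1))).topologicalClosure := by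
    rw [span_fourier_closure_eq_top]; trivial
  have hF' : F ∈ closure (Submodule.span ℂ (range (@fourier 1)) : Set C(UnitAddCircle, ℂ)) := hF
  rw [Metric.tendsto_atTop]
  intro ε hε
  set m := ρ.real univ with hm
  have hm0 : 0 ≤ m := measureReal_nonneg
  obtain ⟨P, hP, hPF⟩ := Metric.mem_closure_iff.1 hF' (ε / (3 * (m + 1))) (by positivity)
  obtain ⟨N₀, hN₀⟩ := Metric.tendsto_atTop.1 (hspan P hP) (ε / 3) (by positivity)
  refine ⟨N₀, fun N hN => ?_⟩
  have hdiff (z : UnitAddCircle) : ‖F z - P z‖ ≤ ε / (3 * (m + 1)) := by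
    rw [← dist_eq_norm]
    exact (ContinuousMap.dist_apply_le_dist z).trans hPF.le
  have hbound : m * (ε / (3 * (m + 1))) < ε / 3 := by
    rw [mul_div_assoc', div_lt_div_iff₀ (by positivity) (by positivity)]
    nlinarith
  have h1 : dist (∫ y, F (((N : ℝ) * y : ℝ) : UnitAddCircle) ∂ρ)
      (∫ y, P (((N : ℝ) * y : ℝ) : UnitAddCircle) ∂ρ) < ε / 3 := by
    rw [dist_eq_norm, ← integral_sub (hint F N) (hint P N)]
    refine lt_of_le_of_lt (norm_integral_le_of_norm_le_const
      (Eventually.of_forall fun y => hdiff _)) ?_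
    rwa [mul_comm]
  have h2 : dist ((m : ℂ) * ∫ z, P z) ((m : ℂ) * ∫ z, F z) < ε / 3 := by
    rw [dist_comm, dist_eq_norm, ← mul_sub, ← integral_sub (hint' F) (hint' P), norm_mul,
      Complex.norm_real, Real.norm_of_nonneg hm0]
    refine lt_of_le_of_lt (mul_le_mul_of_nonneg_left (norm_integral_le_of_norm_le_const
      (Eventually.of_forall fun y => hdiff _)) hm0) ?_
    simpa [measureReal_def, UnitAddCircle.measure_univ] using hbound
  have h3 := hN₀ N hN
  calc _ ≤ _ + _ + _ := dist_triangle4 _ _ _ _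
    _ < ε / 3 + ε / 3 + ε / 3 := by gcongr
    _ = ε := by ring

/-- The distance from `t` to the midpoint `⌈t⌉ - 1/2` of its cell, as a norm on the circle. -/
theorem norm_coe_add_half (t : ℝ) :
    ‖((t + 1 / 2 : ℝ) : UnitAddCircle)‖ = |t - ⌈t⌉ + 1 / 2| := by
  have h : ((t + 1 / 2 : ℝ) : UnitAddCircle) = ((t - ⌈t⌉ + 1 / 2 : ℝ) : UnitAddCircle) := by
    have h0 : ((⌈t⌉ : ℝ) : UnitAddCircle) = 0 := by
      rw [AddCircle.coe_eq_zero_iff]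
      exact ⟨⌈t⌉, by simp⟩
    rw [show t - ⌈t⌉ + 1 / 2 = (t + 1 / 2) - ⌈t⌉ by ring, AddCircle.coe_sub, h0, sub_zero]
  rw [h, AddCircle.norm_coe_eq_abs_iff 1 one_ne_zero, abs_one, abs_le]
  constructor <;> linarith [Int.le_ceil t, Int.ceil_lt_add_one t]

theorem integral_unitAddCircle_norm_rpow {r : ℝ} (hr : 0 ≤ r) :
    ∫ z : UnitAddCircle, ‖z‖ ^ r = Cr r := by
  rw [← UnitAddCircle.intervalIntegral_preimage (-(1 / 2))]
  have h : ∫ a in (-(1 / 2 : ℝ))..(-(1 / 2) + 1), ‖(a : UnitAddCircle)‖ ^ r =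
      ∫ a in (-(1 / 2 : ℝ))..(1 / 2), |a| ^ r := by
    rw [show (-(1 / 2 : ℝ)) + 1 = 1 / 2 by norm_num]
    refine intervalIntegral.integral_congr fun a ha => ?_
    rw [uIcc_of_le (by norm_num)] at ha
    rw [(AddCircle.norm_coe_eq_abs_iff 1 one_ne_zero).2]
    rw [abs_one, abs_le]
    exact ha
  have hcont : Continuous fun a : ℝ => |a| ^ r :=
    continuous_abs.rpow_const fun _ => Or.inr hr
  have hpos : ∫ a in (0 : ℝ)..(1 / 2), |a| ^ r = (1 / 2) ^ (r + 1) / (r + 1) := by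
    have : ∫ a in (0 : ℝ)..(1 / 2), |a| ^ r = ∫ a in (0 : ℝ)..(1 / 2), a ^ r := by
      refine intervalIntegral.integral_congr fun a ha => ?_
      rw [uIcc_of_le (by norm_num)] at ha
      simp only [abs_of_nonneg ha.1]
    rw [this, integral_rpow (Or.inl (by linarith)), Real.zero_rpow (by linarith), sub_zero]
  have hneg : ∫ a in (-(1 / 2 : ℝ))..0, |a| ^ r = ∫ a in (0 : ℝ)..(1 / 2), |a| ^ r := by
    simpa using intervalIntegral.integral_comp_neg (a := -(1 / 2 : ℝ)) (b := 0)
      (fun a : ℝ => |a| ^ r)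
  rw [h, ← intervalIntegral.integral_add_adjacent_intervals (b := 0)
    (hcont.intervalIntegrable _ _) (hcont.intervalIntegrable _ _), hneg, hpos, Cr,
    Real.rpow_add_one (by norm_num), Real.div_rpow (by norm_num) (by norm_num), Real.one_rpow]
  have : (0 : ℝ) < 2 ^ r := by positivity
  field_simp
  ring

theorem tendsto_integral_cell_offset_rpow (ρ : Measure ℝ) [IsFiniteMeasure ρ]
    (hρ : ρ ≪ volume) {r : ℝ} (hr : 0 ≤ r) :
    Tendsto (fun N : ℕ => ∫ y, |(N : ℝ) * y - ⌈(N : ℝ) * y⌉ + 1 / 2| ^ r ∂ρ) atTop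
      (𝓝 (ρ.real univ * Cr r)) := by
  let F : C(UnitAddCircle, ℂ) :=
    ⟨fun z => ((‖z + ((1 / 2 : ℝ) : UnitAddCircle)‖ ^ r : ℝ) : ℂ),
      Complex.continuous_ofReal.comp
        ((continuous_norm.comp (continuous_id.add continuous_const)).rpow_const
          fun _ => Or.inr hr)⟩
  have hF : ∫ z, F z = (Cr r : ℂ) := by
    rw [← integral_unitAddCircle_norm_rpow hr, ← integral_complex_ofReal]
    exact integral_add_right_eq_self (μ := (volume : Measure UnitAddCircle))
      (fun z => ((‖z‖ ^ r : ℝ) : ℂ)) _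
  have h := tendsto_integral_continuousMap_natCast_mul ρ hρ F
  rw [hF] at h
  have hre := (Complex.continuous_re.tendsto _).comp h
  rw [← Complex.ofReal_mul, Complex.ofReal_re] at hre
  refine hre.congr fun N => ?_
  have hpt (y : ℝ) : F (((N : ℝ) * y : ℝ) : UnitAddCircle) =
      ((|(N : ℝ) * y - ⌈(N : ℝ) * y⌉ + 1 / 2| ^ r : ℝ) : ℂ) := by
    rw [← norm_coe_add_half, AddCircle.coe_add]
    rfl
  simp only [Function.comp_apply, hpt, integral_complex_ofReal, Complex.ofReal_re]

theorem compressor_sub_compressor {g : ℝ → ℝ} (hg : Integrable g) (x z : ℝ) :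
    compressor g z - compressor g x = ∫ y in x..z, g y :=
  intervalIntegral.integral_Iic_sub_Iic hg.integrableOn hg.integrableOn

theorem monotone_compressor {g : ℝ → ℝ} (hg : Integrable g) (hg_nonneg : 0 ≤ g) :
    Monotone (compressor g) := fun x z hxz => by
  rw [← sub_nonneg, compressor_sub_compressor hg]
  exact intervalIntegral.integral_nonneg hxz fun y _ => hg_nonneg y

theorem continuous_compressor {g : ℝ → ℝ} (hg : Integrable g) : Continuous (compressor g) := by
  have h : compressor g = fun x => compressor g 0 + ∫ y in (0 : ℝ)..x, g y := by
    ext x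
    rw [← compressor_sub_compressor hg]
    ring
  rw [h]
  exact continuous_const.add
    (intervalIntegral.continuous_primitive (fun _ _ => hg.intervalIntegrable) 0)

theorem ae_hasDerivAt_compressor {g : ℝ → ℝ} (hg : Integrable g) :
    ∀ᵐ x, HasDerivAt (compressor g) (g x) x := by
  filter_upwards [LocallyIntegrable.ae_hasDerivAt_integral hg.locallyIntegrable] with x hx
  have h : compressor g = fun x => compressor g 0 + ∫ y in (0 : ℝ)..x, g y := by
    ext x
    rw [← compressor_sub_compressor hg]
    ring
  rw [h]
  exact (hx 0).const_add _

theorem mul_sub_le_compressor_sub {g : ℝ → ℝ} (hg : Integrable g) {c d ε : ℝ}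
    (hginf : ∀ᵐ x ∂volume.restrict (Icc c d), ε ≤ g x) {x z : ℝ} (hcx : c ≤ x) (hxz : x ≤ z)
    (hzd : z ≤ d) : ε * (z - x) ≤ compressor g z - compressor g x := by
  rw [compressor_sub_compressor hg]
  have h : ∫ _ in x..z, ε = ε * (z - x) := by simp [mul_comm]
  rw [← h]
  refine intervalIntegral.integral_mono_ae_restrict hxz intervalIntegrable_const
    hg.intervalIntegrable ?_
  exact ae_restrict_of_ae_restrict_of_subset (Icc_subset_Icc hcx hzd) hginf

theorem mul_abs_sub_le_abs_compressor_sub {g : ℝ → ℝ} (hg : Integrable g) {c d ε : ℝ}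
    (hginf : ∀ᵐ x ∂volume.restrict (Icc c d), ε ≤ g x) {x z : ℝ} (hx : x ∈ Icc c d)
    (hz : z ∈ Icc c d) : ε * |x - z| ≤ |compressor g x - compressor g z| := by
  rcases le_total x z with h | h
  · rw [abs_sub_comm, abs_sub_comm (compressor g x), abs_of_nonneg (sub_nonneg.2 h)]
    exact (mul_sub_le_compressor_sub hg hginf hx.1 h hz.2).trans (le_abs_self _)
  · rw [abs_of_nonneg (sub_nonneg.2 h)]
    exact (mul_sub_le_compressor_sub hg hginf hz.1 h hx.2).trans (le_abs_self _)

theorem compressor_left_endpoint {g : ℝ → ℝ} {c d : ℝ}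
    (hgzero : ∀ᵐ x ∂volume.restrict (Icc c d)ᶜ, g x = 0) : compressor g c = 0 := by
  rw [compressor, integral_Iic_eq_integral_Iio]
  refine integral_eq_zero_of_ae ?_
  refine ae_restrict_of_ae_restrict_of_subset (fun x hx => ?_) hgzero
  exact fun h => absurd h.1 (not_le.2 hx)

theorem compressor_right_endpoint {g : ℝ → ℝ} (hg : Integrable g) (hg_prob : ∫ x, g x = 1)
    {c d : ℝ} (hgzero : ∀ᵐ x ∂volume.restrict (Icc c d)ᶜ, g x = 0) : compressor g d = 1 := by
  have h : ∫ x in (Iic d)ᶜ, g x = 0 := by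
    refine integral_eq_zero_of_ae ?_
    refine ae_restrict_of_ae_restrict_of_subset (fun x hx => ?_) hgzero
    exact fun h => hx h.2
  rw [← hg_prob, ← integral_add_compl measurableSet_Iic hg, h, add_zero]
  rfl

/-- A point of the interval `[c, d]` is recovered from its compressed value. -/
theorem geninv_compressor {g : ℝ → ℝ} (hg : Integrable g) (hg_nonneg : 0 ≤ g)
    {c d ε : ℝ} (hε : 0 < ε) (hginf : ∀ᵐ x ∂volume.restrict (Icc c d), ε ≤ g x)
    {x : ℝ} (hx : x ∈ Icc c d) (h0 : 0 < compressor g x) (h1 : compressor g x < 1)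
    (hd : compressor g d = 1) : geninv g (compressor g x) = x := by
  have hset : {z : ℝ | compressor g z ≤ compressor g x} = Iic x := by
    ext z
    simp only [mem_ofPred_eq, mem_Iic]
    refine ⟨fun hz => ?_, fun hz => monotone_compressor hg hg_nonneg hz⟩
    by_contra! hxz
    rcases le_total z d with hzd | hdz
    · have := mul_sub_le_compressor_sub hg hginf hx.1 hxz.le hzd
      have := mul_pos hε (sub_pos.2 hxz)
      linarith
    · have := monotone_compressor hg hg_nonneg hdz
      linarith
  rw [geninv, if_neg (not_le.2 h0), if_neg (not_le.2 h1), hset, csSup_Iic]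

theorem measurable_compand {g : ℝ → ℝ} (hg : Integrable g) (N : ℕ) :
    Measurable (compand g N) := by
  have h : compand g N =
      (fun k : ℤ => geninv g (((2 * max 1 k - 1 : ℤ) : ℝ) / (2 * (N : ℝ)))) ∘
        fun x => ⌈compressor g x * (N : ℝ)⌉ := rfl
  rw [h]
  exact (measurable_of_countable _).comp
    (Int.measurable_ceil.comp ((continuous_compressor hg).measurable.mul_const _))

/-- On the interior of `[c, d]` the companding quantizer takes values in `[c, d]`, and its
compressed value is the midpoint of a cell of the uniform quantizer. -/
theorem compand_mem_Icc_and_compressor_compand {g : ℝ → ℝ} (hg : Integrable g) (hg_nonneg : 0 ≤ g)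
    {c d ε : ℝ} (hcd : c ≤ d) (hε : 0 < ε)
    (hginf : ∀ᵐ x ∂volume.restrict (Icc c d), ε ≤ g x) (hc : compressor g c = 0)
    (hd : compressor g d = 1) {x : ℝ} (hx : x ∈ Ioo c d) {N : ℕ} (hN : 0 < N) :
    compand g N x ∈ Icc c d ∧
      N * (compressor g x - compressor g (compand g N x)) =
        N * compressor g x - ⌈N * compressor g x⌉ + 1 / 2 := by
  have hN' : (0 : ℝ) < N := by exact_mod_cast hN
  have hx0 : 0 < compressor g x := by
    have := mul_sub_le_compressor_sub hg hginf le_rfl hx.1.le hx.2.le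
    have := mul_pos hε (sub_pos.2 hx.1)
    linarith
  have hx1 : compressor g x ≤ 1 := hd ▸ monotone_compressor hg hg_nonneg hx.2.le
  set k := ⌈N * compressor g x⌉ with hk
  have hk1 : 1 ≤ k := Int.one_le_ceil_iff.2 (by positivity)
  have hkN : k ≤ N := by
    rw [hk, Int.ceil_le]
    push_cast
    nlinarith
  have hk1' : (1 : ℝ) ≤ k := by exact_mod_cast hk1
  have hkN' : (k : ℝ) ≤ N := by exact_mod_cast hkN
  have hQ : uniformQ N (compressor g x) = (2 * k - 1) / (2 * N) := by
    rw [uniformQ, mul_comm (compressor g x), ← hk, max_eq_right hk1]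
    push_cast
    ring
  have hQ0 : 0 < ((2 * k - 1) / (2 * N) : ℝ) := div_pos (by linarith) (by linarith)
  have hQ1 : ((2 * k - 1) / (2 * N) : ℝ) < 1 := (div_lt_one (by linarith)).2 (by linarith)
  obtain ⟨z, hz, hzQ⟩ := intermediate_value_Icc hcd (continuous_compressor hg).continuousOn
    (show ((2 * k - 1) / (2 * N) : ℝ) ∈ Icc (compressor g c) (compressor g d) by
      rw [hc, hd]; exact ⟨hQ0.le, hQ1.le⟩)
  have hqz : compand g N x = z := by
    rw [compand, hQ, ← hzQ]
    exact geninv_compressor hg hg_nonneg hε hginf hz (hzQ ▸ hQ0) (hzQ ▸ hQ1) hd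
  rw [hqz, hzQ]
  refine ⟨hz, ?_⟩
  field_simp
  ring

theorem measure_compl_eq_zero_of_msupport_subset {μ : Measure ℝ} {s : Set ℝ}
    (h : msupport μ ⊆ s) : μ sᶜ = 0 := by
  have hsub : sᶜ ⊆ μ.supportᶜ := compl_subset_compl.2 fun x hx => h fun ε hε =>
    (Measure.mem_support_iff_forall x).1 hx _ (Ioo_mem_nhds (by linarith) (by linarith))
  exact measure_mono_null hsub Measure.measure_compl_support

/-- The compressor of `g` pushes every measure which is absolutely continuous on a set where `g`
is the nonzero derivative of an injective compressor to an absolutely continuous measure. -/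
theorem map_compressor_absolutelyContinuous {g : ℝ → ℝ} (hg_meas : Measurable g)
    (hg : Integrable g) {s : Set ℝ} (hs : MeasurableSet s)
    (hderiv : ∀ x ∈ s, HasDerivAt (compressor g) (g x) x) (hne : ∀ x ∈ s, g x ≠ 0)
    (hinj : InjOn (compressor g) s) {μ : Measure ℝ} (hμ : μ ≪ volume.restrict s) :
    μ.map (compressor g) ≪ volume := by
  have hmap := map_withDensity_abs_det_fderiv_eq_addHaar volume hs.nullMeasurableSet
    (fun x hx => (hderiv x hx).hasDerivWithinAt.hasFDerivWithinAt) hinj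
  have hac : volume.restrict s ≪ (volume.restrict s).withDensity
      fun x => ENNReal.ofReal |(ContinuousLinearMap.toSpanSingleton ℝ (g x)).det| := by
    refine withDensity_absolutelyContinuous' ?_ ?_
    · simp only [ContinuousLinearMap.det_toSpanSingleton]
      fun_prop
    · filter_upwards [ae_restrict_mem hs] with x hx
      simpa using hne x hx
  refine ((hμ.trans hac).map (continuous_compressor hg).measurable).trans ?_
  rw [hmap]
  exact Measure.restrict_le_self.absolutelyContinuous

theorem abs_cell_offset_le (t : ℝ) : |t - ⌈t⌉ + 1 / 2| ≤ 1 / 2 := by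
  rw [abs_le]
  constructor <;> linarith [Int.le_ceil t, Int.ceil_lt_add_one t]

theorem cell_offset_rpow_le (t : ℝ) {r : ℝ} (hr : 0 ≤ r) :
    |t - ⌈t⌉ + 1 / 2| ^ r ≤ (1 / 2) ^ r :=
  Real.rpow_le_rpow (abs_nonneg _) (abs_cell_offset_le t) hr

theorem measurable_cell_offset_rpow (N : ℕ) (r : ℝ) :
    Measurable fun y : ℝ => |(N : ℝ) * y - ⌈(N : ℝ) * y⌉ + 1 / 2| ^ r := by
  fun_prop

/-- The scaled quantization error is at most `1 / (2 ε)` when `g ≥ ε`. -/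
theorem natCast_mul_abs_sub_compand_le {g : ℝ → ℝ} (hg : Integrable g) (hg_nonneg : 0 ≤ g)
    {c d ε : ℝ} (hcd : c ≤ d) (hε : 0 < ε)
    (hginf : ∀ᵐ x ∂volume.restrict (Icc c d), ε ≤ g x) (hc : compressor g c = 0)
    (hd : compressor g d = 1) {x : ℝ} (hx : x ∈ Ioo c d) {N : ℕ} (hN : 0 < N) :
    N * |x - compand g N x| ≤ 1 / 2 / ε := by
  obtain ⟨hq, hoff⟩ :=
    compand_mem_Icc_and_compressor_compand hg hg_nonneg hcd hε hginf hc hd hx hN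
  have hN' : (0 : ℝ) < N := by exact_mod_cast hN
  have h1 := mul_abs_sub_le_abs_compressor_sub hg hginf (Ioo_subset_Icc_self hx) hq
  have h2 := abs_cell_offset_le (N * compressor g x)
  rw [← hoff, abs_mul, abs_of_pos hN'] at h2
  rw [le_div_iff₀ hε]
  have h3 := mul_le_mul_of_nonneg_left h1 hN'.le
  linarith

/-- At a differentiability point of the compressor, the scaled quantization error is asymptotically
the scaled error of the uniform quantizer divided by the slope. -/
theorem tendsto_natCast_rpow_mul_error_sub {g : ℝ → ℝ} (hg : Integrable g) (hg_nonneg : 0 ≤ g)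
    {c d ε : ℝ} (hcd : c ≤ d) (hε : 0 < ε)
    (hginf : ∀ᵐ x ∂volume.restrict (Icc c d), ε ≤ g x) (hc : compressor g c = 0)
    (hd : compressor g d = 1) {x : ℝ} (hx : x ∈ Ioo c d) (hgx : 0 < g x)
    (hderiv : HasDerivAt (compressor g) (g x) x) {r : ℝ} (hr : 0 ≤ r) :
    Tendsto (fun N : ℕ => (N : ℝ) ^ r * |x - compand g N x| ^ r -
      |N * compressor g x - ⌈N * compressor g x⌉ + 1 / 2| ^ r * (g x ^ r)⁻¹) atTop (𝓝 0) := by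
  have hq : Tendsto (fun N => compand g N x) atTop (𝓝 x) := by
    rw [tendsto_iff_norm_sub_tendsto_zero]
    refine squeeze_zero' (Eventually.of_forall fun _ => norm_nonneg _) ?_
      (tendsto_const_div_atTop_nhds_zero_nat (1 / 2 / ε))
    filter_upwards [eventually_gt_atTop 0] with N hN
    have hN' : (0 : ℝ) < N := by exact_mod_cast hN
    rw [Real.norm_eq_abs, abs_sub_comm, le_div_iff₀' hN']
    exact natCast_mul_abs_sub_compand_le hg hg_nonneg hcd hε hginf hc hd hx hN
  set D : ℕ → ℝ := fun N => dslope (compressor g) x (compand g N x) with hD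
  have hDlim : Tendsto D atTop (𝓝 (g x)) := by
    have hcont := (continuousAt_dslope_same.2 hderiv.differentiableAt).tendsto.comp hq
    rwa [dslope_same, hderiv.deriv] at hcont
  have hinv : Tendsto (fun N => (|D N| ^ r)⁻¹) atTop (𝓝 (g x ^ r)⁻¹) := by
    have h := (hDlim.abs.rpow_const (p := r) (Or.inr hr)).inv₀ (by positivity)
    rwa [abs_of_pos hgx] at h
  have hbd : Tendsto (fun N => (1 / 2 : ℝ) ^ r * |(|D N| ^ r)⁻¹ - (g x ^ r)⁻¹|) atTop (𝓝 0) := by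
    simpa using (hinv.sub_const (g x ^ r)⁻¹).abs.const_mul ((1 / 2 : ℝ) ^ r)
  refine squeeze_zero_norm' ?_ hbd
  filter_upwards [eventually_gt_atTop 0, hDlim.eventually_ne hgx.ne'] with N hN hDN
  have hN' : (0 : ℝ) < N := by exact_mod_cast hN
  obtain ⟨-, hoff⟩ :=
    compand_mem_Icc_and_compressor_compand hg hg_nonneg hcd hε hginf hc hd hx hN
  have hslope : compressor g x - compressor g (compand g N x) = (x - compand g N x) * D N := by
    have h : (compand g N x - x) * D N = compressor g (compand g N x) - compressor g x :=
      sub_smul_dslope (compressor g) x (compand g N x)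
    linarith
  have hψ : |N * compressor g x - ⌈N * compressor g x⌉ + 1 / 2| ^ r =
      (N : ℝ) ^ r * |x - compand g N x| ^ r * |D N| ^ r := by
    rw [← hoff, hslope, abs_mul, abs_of_pos hN', abs_mul,
      Real.mul_rpow hN'.le (by positivity), Real.mul_rpow (abs_nonneg _) (abs_nonneg _), mul_assoc]
  have hDr : |D N| ^ r ≠ 0 := (Real.rpow_pos_of_pos (abs_pos.2 hDN) r).ne'
  have herr : (N : ℝ) ^ r * |x - compand g N x| ^ r =
      |N * compressor g x - ⌈N * compressor g x⌉ + 1 / 2| ^ r * (|D N| ^ r)⁻¹ := by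
    rw [hψ, mul_inv_cancel_right₀ hDr]
  rw [herr, ← mul_sub, norm_mul, Real.norm_of_nonneg (by positivity), Real.norm_eq_abs]
  gcongr
  exact abs_cell_offset_le _

/-- Bennett-type distortion asymptotics for companding quantizers. -/
theorem statement5
    (r : ℝ) (hr : 1 ≤ r)
    (μ : Measure ℝ) [IsProbabilityMeasure μ]
    (f : ℝ → ℝ) (hf_meas : Measurable f) (hf_nonneg : 0 ≤ f)
    (hμ : μ = volume.withDensity fun x => ENNReal.ofReal (f x))
    (g : ℝ → ℝ) (hg_meas : Measurable g) (hg_nonneg : 0 ≤ g)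
    (hg_prob : ∫ x, g x = 1)
    (c d : ℝ) (hcd : c ≤ d)
    (hsupp : msupport μ ⊆ Set.Icc c d)
    (hginf : ∃ ε > 0, ∀ᵐ x ∂(volume.restrict (Set.Icc c d)), ε ≤ g x)
    (hgzero : ∀ᵐ x ∂(volume.restrict (Set.Icc c d)ᶜ), g x = 0) :
    Tendsto (fun N : ℕ => ENNReal.ofReal ((N : ℝ) ^ r) * distortion r μ (compand g N))
      atTop
      (𝓝 (ENNReal.ofReal (Cr r * ∫ x in Set.Icc c d, f x / g x ^ r))) := by
  obtain ⟨ε, hε, hginf⟩ := hginf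
  have hr0 : 0 ≤ r := by linarith
  have hg : Integrable g := by
    by_contra h
    rw [integral_undef h] at hg_prob
    exact zero_ne_one hg_prob
  have hc := compressor_left_endpoint hgzero
  have hd := compressor_right_endpoint hg hg_prob hgzero
  have hGmeas : Measurable (compressor g) := (continuous_compressor hg).measurable
  have hμac : μ ≪ volume := hμ ▸ withDensity_absolutelyContinuous _ _
  have hμI : ∀ᵐ x ∂μ, x ∈ Icc c d := measure_compl_eq_zero_of_msupport_subset hsupp
  have hgood : ∀ᵐ x, x ∈ Icc c d →
      x ∈ Ioo c d ∧ ε ≤ g x ∧ HasDerivAt (compressor g) (g x) x := by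
    filter_upwards [ae_hasDerivAt_compressor hg, (ae_restrict_iff' measurableSet_Icc).1 hginf,
      Measure.ae_ne volume c, Measure.ae_ne volume d] with x h1 h2 h3 h4 hx
    exact ⟨⟨hx.1.lt_of_ne' h3, hx.2.lt_of_ne h4⟩, h2 hx, h1⟩
  obtain ⟨t, htsub, htmeas, htnull⟩ := exists_measurable_superset_of_null hgood
  set s := Icc c d ∩ tᶜ with hs
  have hsmeas : MeasurableSet s := measurableSet_Icc.inter htmeas.compl
  have hsgood : ∀ x ∈ s, x ∈ Ioo c d ∧ ε ≤ g x ∧ HasDerivAt (compressor g) (g x) x :=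
    fun x hx => not_not.1 (fun h => hx.2 (htsub fun h' => h (h' hx.1)))
  have hμs : ∀ᵐ x ∂μ, x ∈ s := by
    filter_upwards [hμI, hμac.ae_le (measure_eq_zero_iff_ae_notMem.1 htnull)] with x h1 h2
    exact ⟨h1, h2⟩
  have hμrestrict : μ ≪ volume.restrict s := by
    rw [← Measure.restrict_eq_self_of_ae_mem hμs]
    exact hμac.restrict s
  have hinj : InjOn (compressor g) s := fun x hx z hz hxz => by
    have h := mul_abs_sub_le_abs_compressor_sub hg hginf hx.1 hz.1
    rw [hxz, sub_self, abs_zero] at h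
    exact sub_eq_zero.1 (abs_eq_zero.1 (le_antisymm
      (nonpos_of_mul_nonpos_right h hε) (abs_nonneg _)))
  have hw_meas : Measurable fun x => (g x ^ r)⁻¹ := by fun_prop
  have hw_nonneg : ∀ x, 0 ≤ (g x ^ r)⁻¹ := fun x => inv_nonneg.2 (Real.rpow_nonneg (hg_nonneg x) r)
  have hw_le : ∀ x ∈ s, (g x ^ r)⁻¹ ≤ (ε ^ r)⁻¹ := fun x hx =>
    inv_anti₀ (Real.rpow_pos_of_pos hε r) (Real.rpow_le_rpow hε.le (hsgood x hx).2.1 hr0)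
  have hw_int : Integrable (fun x => (g x ^ r)⁻¹) μ := by
    refine Integrable.of_bound (C := (ε ^ r)⁻¹) hw_meas.aestronglyMeasurable ?_
    filter_upwards [hμs] with x hx
    rw [Real.norm_of_nonneg (hw_nonneg x)]
    exact hw_le x hx
  set ν := μ.withDensity fun x => ENNReal.ofReal (g x ^ r)⁻¹ with hν
  have : IsFiniteMeasure ν := isFiniteMeasure_withDensity_ofReal hw_int.hasFiniteIntegral
  set ρ := ν.map (compressor g) with hρ
  have hρac : ρ ≪ volume := map_compressor_absolutelyContinuous hg_meas hg hsmeas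
    (fun x hx => (hsgood x hx).2.2) (fun x hx => (hε.trans_le (hsgood x hx).2.1).ne') hinj
    ((withDensity_absolutelyContinuous _ _).trans hμrestrict)
  have hρint : ∀ φ : ℝ → ℝ, Measurable φ →
      ∫ y, φ y ∂ρ = ∫ x, φ (compressor g x) * (g x ^ r)⁻¹ ∂μ := fun φ hφ => by
    rw [hρ, integral_map hGmeas.aemeasurable hφ.aestronglyMeasurable, hν,
      integral_withDensity_eq_integral_toReal_smul hw_meas.ennreal_ofReal
        (Eventually.of_forall fun _ => ENNReal.ofReal_lt_top)]
    refine integral_congr_ae (Eventually.of_forall fun x => ?_)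
    simp only [ENNReal.toReal_ofReal (hw_nonneg x), smul_eq_mul, mul_comm]
  have hρuniv : ρ.real univ = ∫ x in Icc c d, f x / g x ^ r := by
    have h1 := hρint (fun _ => 1) measurable_const
    simp only [integral_const, smul_eq_mul, mul_one, one_mul] at h1
    rw [h1, ← Measure.restrict_eq_self_of_ae_mem hμI, hμ,
      setIntegral_withDensity_eq_setIntegral_toReal_smul hf_meas.ennreal_ofReal
        (Eventually.of_forall fun _ => ENNReal.ofReal_lt_top) _ measurableSet_Icc]
    refine integral_congr_ae (Eventually.of_forall fun x => ?_)
    simp only [ENNReal.toReal_ofReal (hf_nonneg x), smul_eq_mul, div_eq_mul_inv]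
  set E : ℕ → ℝ → ℝ := fun N x => (N : ℝ) ^ r * |x - compand g N x| ^ r with hE
  set U : ℕ → ℝ → ℝ := fun N x =>
    |N * compressor g x - ⌈N * compressor g x⌉ + 1 / 2| ^ r * (g x ^ r)⁻¹ with hU
  have hE_meas : ∀ N, Measurable (E N) := fun N => by
    have := measurable_compand hg N
    fun_prop
  have hU_meas : ∀ N, Measurable (U N) := fun N =>
    ((measurable_cell_offset_rpow N r).comp hGmeas).mul hw_meas
  have hE_nonneg : ∀ N x, 0 ≤ E N x := fun N x => by positivity
  have hU_nonneg : ∀ N x, 0 ≤ U N x := fun N x =>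
    mul_nonneg (by positivity) (hw_nonneg x)
  have hE_le : ∀ N, 0 < N → ∀ x ∈ s, E N x ≤ (1 / 2 / ε) ^ r := fun N hN x hx => by
    simp only [hE]
    rw [← Real.mul_rpow N.cast_nonneg (abs_nonneg _)]
    exact Real.rpow_le_rpow (by positivity) (natCast_mul_abs_sub_compand_le hg hg_nonneg hcd hε
      hginf hc hd (hsgood x hx).1 hN) hr0
  have hU_le : ∀ N, ∀ x ∈ s, U N x ≤ (1 / 2 / ε) ^ r := fun N x hx => by
    rw [Real.div_rpow (by norm_num) hε.le, div_eq_mul_inv]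
    exact mul_le_mul (cell_offset_rpow_le _ hr0) (hw_le x hx) (hw_nonneg x) (by positivity)
  have hE_int : ∀ N, 0 < N → Integrable (E N) μ := fun N hN => by
    refine Integrable.of_bound (C := (1 / 2 / ε) ^ r) (hE_meas N).aestronglyMeasurable ?_
    filter_upwards [hμs] with x hx
    rw [Real.norm_of_nonneg (hE_nonneg N x)]
    exact hE_le N hN x hx
  have hU_int : ∀ N, Integrable (U N) μ := fun N => by
    refine Integrable.of_bound (C := (1 / 2 / ε) ^ r) (hU_meas N).aestronglyMeasurable ?_
    filter_upwards [hμs] with x hx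
    rw [Real.norm_of_nonneg (hU_nonneg N x)]
    exact hU_le N x hx
  have hdiff : Tendsto (fun N => ∫ x, (E N x - U N x) ∂μ) atTop (𝓝 0) := by
    rw [← integral_zero ℝ ℝ (μ := μ)]
    refine tendsto_integral_filter_of_dominated_convergence (fun _ => (1 / 2 / ε) ^ r)
      (Eventually.of_forall fun N => ((hE_meas N).sub (hU_meas N)).aestronglyMeasurable) ?_
      (integrable_const _) ?_
    · filter_upwards [eventually_gt_atTop 0] with N hN
      filter_upwards [hμs] with x hx
      rw [Real.norm_eq_abs, abs_le]
      constructor <;>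
        linarith [hE_nonneg N x, hU_nonneg N x, hE_le N hN x hx, hU_le N x hx]
    · filter_upwards [hμs] with x hx
      exact tendsto_natCast_rpow_mul_error_sub hg hg_nonneg hcd hε hginf hc hd (hsgood x hx).1
        (hε.trans_le (hsgood x hx).2.1) (hsgood x hx).2.2 hr0
  have hUlim : Tendsto (fun N => ∫ x, U N x ∂μ) atTop
      (𝓝 (Cr r * ∫ x in Icc c d, f x / g x ^ r)) := by
    rw [← hρuniv, mul_comm]
    exact (tendsto_integral_cell_offset_rpow ρ hρac hr0).congr fun N =>
      hρint _ (measurable_cell_offset_rpow N r)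
  have hElim : Tendsto (fun N => ∫ x, E N x ∂μ) atTop
      (𝓝 (Cr r * ∫ x in Icc c d, f x / g x ^ r)) := by
    have h := hdiff.add hUlim
    rw [zero_add] at h
    refine h.congr' ?_
    filter_upwards [eventually_gt_atTop 0] with N hN
    rw [integral_sub (hE_int N hN) (hU_int N), sub_add_cancel]
  refine (ENNReal.tendsto_ofReal hElim).congr' ?_
  filter_upwards [eventually_gt_atTop 0] with N hN
  have hmeas : Measurable fun x => ENNReal.ofReal (|x - compand g N x| ^ r) := by
    have := measurable_compand hg N
    fun_prop
  rw [ofReal_integral_eq_lintegral_ofReal (hE_int N hN)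
    (Eventually.of_forall (hE_nonneg N)), distortion, ← lintegral_const_mul _ hmeas]
  refine lintegral_congr fun x => ?_
  rw [← ENNReal.ofReal_mul (by positivity)]

end
end

section
/- Let r ≥ 1 and α ∈ [−∞, 1+r). Let μ be a Borel probability measure supported on a compact interval I, absolutely continuous with respect to Lebesgue measure λ, with density f satisfying ess inf_I f > 0; assume f^{a₁} is integrable if α ∈ (1, 1+r) and f·log f is integrable if α = 1. Define the point density f* = (∫_I f^{1/a₂} dλ)^{−1}·f^{1/a₂} for α ∈ (−∞, 1+r) with α ≠ 1, f* = (λ(I))^{−1}·1_I for α = 1, and f* = f for α = −∞. Then lim_{N→∞} e^{r·H^α_μ(Q_{f*,N})}·D_μ(Q_{f*,N}) equals C(r)·(∫_I f^{a₁} dλ)^{a₂} for α ∈ (−∞, 1+r) with α ≠ 1, equals C(r)·e^{−r∫ f log f dλ} for α = 1, and equals C(r)·∫_I f^{1−r} dλ for α = −∞. -/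
open MeasureTheory Filter Set
open scoped ENNReal Topology Classical

noncomputable section

/-- The `i`-th cell `(i/N, (i+1)/N]` of the uniform partition of `(0,1]` into `N` cells. -/
def unitCell (N i : ℕ) : Set ℝ := Ioc ((i : ℝ) / N) ((i + 1 : ℝ) / N)

/-- The midpoint of the `i`-th cell of the uniform partition. -/
def unitMid (N i : ℕ) : ℝ := (2 * (i : ℝ) + 1) / (2 * N)

/-- The index of the cell of the uniform partition that contains `y`. -/
def cellIdx (N : ℕ) (y : ℝ) : ℕ := ⌈y * N⌉₊ - 1

theorem mem_unitCell_iff {N i : ℕ} (hN : 0 < N) {y : ℝ} :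
    y ∈ unitCell N i ↔ (i : ℝ) < y * N ∧ y * N ≤ i + 1 := by
  have hN' : (0 : ℝ) < N := by exact_mod_cast hN
  rw [unitCell, mem_Ioc, div_lt_iff₀ hN', le_div_iff₀ hN']

theorem cellIdx_eq {N i : ℕ} (hN : 0 < N) {y : ℝ} (hy : y ∈ unitCell N i) :
    cellIdx N y = i := by
  rw [mem_unitCell_iff hN] at hy
  have : ⌈y * N⌉₊ = i + 1 := by
    rw [Nat.ceil_eq_iff (by simp)]
    simpa using hy
  simp [cellIdx, this]

theorem mem_unitCell_cellIdx {N : ℕ} (hN : 0 < N) {y : ℝ} (hy : y ∈ Ioc (0 : ℝ) 1) :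
    cellIdx N y < N ∧ y ∈ unitCell N (cellIdx N y) := by
  have hN' : (0 : ℝ) < N := by exact_mod_cast hN
  have h0 : 0 < y * N := mul_pos hy.1 hN'
  have h1 : y * N ≤ N := by nlinarith [hy.2]
  have hc : 0 < ⌈y * N⌉₊ := Nat.ceil_pos.2 h0
  have hc' : ⌈y * N⌉₊ ≤ N := Nat.ceil_le.2 h1
  obtain ⟨j, hj⟩ : ∃ j, ⌈y * N⌉₊ = j + 1 := ⟨⌈y * N⌉₊ - 1, by omega⟩
  have hj' : cellIdx N y = j := by simp [cellIdx, hj]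
  refine ⟨by omega, ?_⟩
  rw [mem_unitCell_iff hN, hj']
  simpa using (Nat.ceil_eq_iff (by simp)).1 hj

theorem measurableSet_unitCell (N i : ℕ) : MeasurableSet (unitCell N i) := measurableSet_Ioc

theorem unitCell_subset {N i : ℕ} (hi : i < N) : unitCell N i ⊆ Ioc 0 1 := by
  have hN' : (0 : ℝ) < N := by exact_mod_cast (Nat.zero_lt_of_lt hi)
  have hi' : (i + 1 : ℝ) ≤ N := by exact_mod_cast hi
  exact Ioc_subset_Ioc (by positivity) ((div_le_one hN').2 hi')

theorem volume_real_unitCell (N i : ℕ) : volume.real (unitCell N i) = 1 / N := by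
  have hle : (i : ℝ) / N ≤ (i + 1 : ℝ) / N := by gcongr; linarith
  rw [unitCell, Real.volume_real_Ioc_of_le hle]
  ring

theorem sum_setIntegral_unitCell {N : ℕ} (hN : 0 < N) {u : ℝ → ℝ}
    (hu : IntegrableOn u (Ioc 0 1)) :
    ∑ i ∈ Finset.range N, ∫ z in unitCell N i, u z = ∫ z in Ioc 0 1, u z := by
  have hN' : (0 : ℝ) < N := by exact_mod_cast hN
  have hle : ∀ i : ℕ, (i : ℝ) / N ≤ ((i + 1 : ℕ) : ℝ) / N := fun i => by
    gcongr; exact Nat.le_succ i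
  have := intervalIntegral.sum_integral_adjacent_intervals (f := u) (μ := volume)
    (a := fun k : ℕ => (k : ℝ) / N) (n := N) (fun k hk => by
      rw [intervalIntegrable_iff_integrableOn_Ioc_of_le (hle k)]
      refine hu.mono_set ?_
      have := unitCell_subset hk
      simpa [unitCell] using this)
  rw [Nat.cast_zero, zero_div, div_self hN'.ne',
    intervalIntegral.integral_of_le zero_le_one] at this
  rw [← this]
  refine Finset.sum_congr rfl fun i _ => ?_
  rw [intervalIntegral.integral_of_le (hle i)]
  simp [unitCell]

theorem measurable_cellIdx (N : ℕ) : Measurable (cellIdx N) := by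
  unfold cellIdx
  exact (measurable_from_top (f := fun n : ℕ => n - 1)).comp
    (Nat.measurable_ceil.comp (measurable_id.mul_const _))

theorem integrableOn_comp_cellIdx {N : ℕ} (hN : 0 < N) (Φ : ℕ → ℝ) :
    IntegrableOn (fun y => Φ (cellIdx N y)) (Ioc 0 1) := by
  refine Measure.integrableOn_of_bounded (M := ∑ i ∈ Finset.range N, |Φ i|) (by simp)
    ((measurable_from_top (f := Φ)).comp (measurable_cellIdx N)).aestronglyMeasurable ?_
  refine (ae_restrict_iff' measurableSet_Ioc).2 (ae_of_all _ fun y hy => ?_)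
  exact Finset.single_le_sum (f := fun i => |Φ i|) (fun i _ => abs_nonneg _)
    (Finset.mem_range.2 (mem_unitCell_cellIdx hN hy).1)

theorem setIntegral_comp_cellIdx {N : ℕ} (hN : 0 < N) (Φ : ℕ → ℝ) :
    ∫ y in Ioc 0 1, Φ (cellIdx N y) = ∑ i ∈ Finset.range N, Φ i / N := by
  rw [← sum_setIntegral_unitCell hN (integrableOn_comp_cellIdx hN Φ)]
  refine Finset.sum_congr rfl fun i _ => ?_
  rw [setIntegral_congr_fun (g := fun _ => Φ i) (measurableSet_unitCell N i)
    (fun y hy => by simp only [cellIdx_eq hN hy]), setIntegral_const, volume_real_unitCell]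
  simp [div_eq_inv_mul]

theorem ae_eq_closedBall_unitCell {N i : ℕ} (hN : 0 < N) :
    Metric.closedBall (unitMid N i) (1 / (2 * N)) =ᵐ[volume] unitCell N i := by
  have hN' : (N : ℝ) ≠ 0 := by exact_mod_cast hN.ne'
  rw [Real.closedBall_eq_Icc, unitCell, unitMid]
  have h1 : (2 * (i : ℝ) + 1) / (2 * N) - 1 / (2 * N) = i / N := by field_simp; ring
  have h2 : (2 * (i : ℝ) + 1) / (2 * N) + 1 / (2 * N) = (i + 1) / N := by field_simp; ring
  rw [h1, h2]
  exact Ioc_ae_eq_Icc.symm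

theorem setAverage_unitCell {N i : ℕ} (u : ℝ → ℝ) :
    ⨍ z in unitCell N i, u z = N * ∫ z in unitCell N i, u z := by
  rw [setAverage_eq, volume_real_unitCell]
  simp

/-- Lebesgue differentiation along the cells of the uniform partition. -/
theorem ae_tendsto_unitCell_norm_sub {u : ℝ → ℝ} (hu : IntegrableOn u (Ioc 0 1)) :
    ∀ᵐ y ∂(volume.restrict (Ioc (0 : ℝ) 1)),
      Tendsto (fun N : ℕ => N * ∫ z in unitCell N (cellIdx N y), |u z - u y|) atTop (𝓝 0) := by
  have hint : Integrable ((Ioc (0 : ℝ) 1).indicator u) :=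
    (integrable_indicator_iff measurableSet_Ioc).2 hu
  rw [ae_restrict_iff' measurableSet_Ioc]
  filter_upwards [IsUnifLocDoublingMeasure.ae_tendsto_average_norm_sub
    volume hint.locallyIntegrable 1] with y hy hy01
  have hδ : Tendsto (fun N : ℕ => 1 / (2 * (N : ℝ))) atTop (𝓝[>] 0) := by
    refine tendsto_nhdsWithin_iff.2 ⟨?_, ?_⟩
    · have := (tendsto_one_div_atTop_nhds_zero_nat (𝕜 := ℝ)).const_mul (1 / 2)
      simp only [mul_zero] at this
      refine this.congr fun N => ?_
      ring
    · filter_upwards [eventually_gt_atTop 0] with N hN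
      have : (0 : ℝ) < N := by exact_mod_cast hN
      simp only [mem_Ioi]; positivity
  have hmem : ∀ᶠ N : ℕ in atTop,
      y ∈ Metric.closedBall (unitMid N (cellIdx N y)) (1 * (1 / (2 * (N : ℝ)))) := by
    filter_upwards [eventually_gt_atTop 0] with N hN
    have hN' : (N : ℝ) ≠ 0 := by exact_mod_cast hN.ne'
    have := (mem_unitCell_cellIdx hN hy01).2
    rw [unitCell, mem_Ioc] at this
    rw [one_mul, Real.closedBall_eq_Icc, unitMid]
    have h1 : (2 * (cellIdx N y : ℝ) + 1) / (2 * N) - 1 / (2 * N) = cellIdx N y / N := by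
      field_simp; ring
    have h2 : (2 * (cellIdx N y : ℝ) + 1) / (2 * N) + 1 / (2 * N) = (cellIdx N y + 1) / N := by
      field_simp; ring
    rw [h1, h2]
    exact ⟨this.1.le, this.2⟩
  refine (hy _ _ hδ hmem).congr' ?_
  filter_upwards [eventually_gt_atTop 0] with N hN
  rw [setAverage_congr (ae_eq_closedBall_unitCell hN), setAverage_unitCell]
  congr 1
  refine setIntegral_congr_fun (measurableSet_unitCell _ _) fun z hz => ?_
  have hz' := unitCell_subset (mem_unitCell_cellIdx hN hy01).1 hz
  simp [indicator_of_mem hz', indicator_of_mem hy01]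

theorem integrableOn_unitCell {N i : ℕ} (hi : i < N) {u : ℝ → ℝ}
    (hu : IntegrableOn u (Ioc 0 1)) : IntegrableOn u (unitCell N i) :=
  hu.mono_set (unitCell_subset hi)

theorem volume_unitCell_ne_top (N i : ℕ) : volume (unitCell N i) ≠ ∞ := by
  simp [unitCell]

/-- Cell averages converge almost everywhere. -/
theorem ae_tendsto_unitCell_average {u : ℝ → ℝ} (hu : IntegrableOn u (Ioc 0 1)) :
    ∀ᵐ y ∂(volume.restrict (Ioc (0 : ℝ) 1)),
      Tendsto (fun N : ℕ => N * ∫ z in unitCell N (cellIdx N y), u z) atTop (𝓝 (u y)) := by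
  filter_upwards [ae_tendsto_unitCell_norm_sub hu, ae_restrict_mem measurableSet_Ioc]
    with y hy hy01
  rw [tendsto_iff_norm_sub_tendsto_zero]
  refine squeeze_zero' (Eventually.of_forall fun _ => norm_nonneg _) ?_ hy
  filter_upwards [eventually_gt_atTop 0] with N hN
  have hN' : (N : ℝ) ≠ 0 := by exact_mod_cast hN.ne'
  have hi := mem_unitCell_cellIdx hN hy01
  have h1 : N * (∫ z in unitCell N (cellIdx N y), u z) - u y
      = N * ∫ z in unitCell N (cellIdx N y), (u z - u y) := by
    rw [integral_sub (integrableOn_unitCell hi.1 hu)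
      (integrableOn_const (volume_unitCell_ne_top _ _)), setIntegral_const, volume_real_unitCell,
      smul_eq_mul]
    field_simp
  rw [h1, norm_mul, Real.norm_natCast]
  gcongr
  exact norm_integral_le_integral_norm _

/-- A real-valued form of Fatou's lemma. -/
theorem eventually_lt_integral_of_ae_tendsto {ν : Measure ℝ} {u : ℕ → ℝ → ℝ} {v : ℝ → ℝ}
    (hu : ∀ᶠ N in atTop, Integrable (u N) ν) (hu0 : ∀ᶠ N in atTop, ∀ᵐ y ∂ν, 0 ≤ u N y)
    (hv : Integrable v ν)
    (hlim : ∀ᵐ y ∂ν, Tendsto (fun N => u N y) atTop (𝓝 (v y))) {b : ℝ}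
    (hb : b < ∫ y, v y ∂ν) : ∀ᶠ N in atTop, b < ∫ y, u N y ∂ν := by
  obtain ⟨M, hM⟩ := eventually_atTop.1 (hu.and hu0)
  have hM1 : ∀ N, Integrable (u (N + M)) ν := fun N => (hM _ (Nat.le_add_left _ _)).1
  have hM2 : ∀ N, ∀ᵐ y ∂ν, 0 ≤ u (N + M) y := fun N => (hM _ (Nat.le_add_left _ _)).2
  have hlim' : ∀ᵐ y ∂ν, Tendsto (fun N => u (N + M) y) atTop (𝓝 (v y)) := by
    filter_upwards [hlim] with y hy using hy.comp (tendsto_add_atTop_nat M)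
  have hv0 : ∀ᵐ y ∂ν, 0 ≤ v y := by
    filter_upwards [hlim', ae_all_iff.2 hM2] with y hy hy0
    exact ge_of_tendsto' hy hy0
  rw [← map_add_atTop_eq_nat M, eventually_map]
  rcases lt_or_ge b 0 with hb0 | hb0
  · exact Eventually.of_forall fun N => hb0.trans_le (integral_nonneg_of_ae (hM2 N))
  have key : ENNReal.ofReal b < liminf (fun N => ∫⁻ y, ENNReal.ofReal (u (N + M) y) ∂ν) atTop :=
    calc ENNReal.ofReal b < ENNReal.ofReal (∫ y, v y ∂ν) :=
          (ENNReal.ofReal_lt_ofReal_iff (hb0.trans_lt hb)).2 hb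
      _ = ∫⁻ y, ENNReal.ofReal (v y) ∂ν := ofReal_integral_eq_lintegral_ofReal hv hv0
      _ = ∫⁻ y, liminf (fun N => ENNReal.ofReal (u (N + M) y)) atTop ∂ν := by
          refine lintegral_congr_ae ?_
          filter_upwards [hlim'] with y hy
          exact (ENNReal.tendsto_ofReal hy).liminf_eq.symm
      _ ≤ _ := lintegral_liminf_le' fun N => (hM1 N).aemeasurable.ennreal_ofReal
  filter_upwards [eventually_lt_of_lt_liminf key] with N hN
  rw [← ofReal_integral_eq_lintegral_ofReal (hM1 N) (hM2 N)] at hN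
  exact lt_of_not_ge fun h => absurd (ENNReal.ofReal_le_ofReal h) (not_le.2 hN)

/-- A dominated convergence theorem with converging dominating functions of constant integral. -/
theorem tendsto_integral_of_le_of_integral_eq {ν : Measure ℝ} {u k : ℕ → ℝ → ℝ} {v l : ℝ → ℝ}
    (hu : ∀ᶠ N in atTop, Integrable (u N) ν) (hu0 : ∀ᶠ N in atTop, ∀ᵐ y ∂ν, 0 ≤ u N y)
    (hk : ∀ᶠ N in atTop, Integrable (k N) ν) (huk : ∀ᶠ N in atTop, ∀ᵐ y ∂ν, u N y ≤ k N y)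
    (hv : Integrable v ν) (hl : Integrable l ν)
    (hlimu : ∀ᵐ y ∂ν, Tendsto (fun N => u N y) atTop (𝓝 (v y)))
    (hlimk : ∀ᵐ y ∂ν, Tendsto (fun N => k N y) atTop (𝓝 (l y)))
    (hkl : ∀ᶠ N in atTop, ∫ y, k N y ∂ν = ∫ y, l y ∂ν) :
    Tendsto (fun N => ∫ y, u N y ∂ν) atTop (𝓝 (∫ y, v y ∂ν)) := by
  refine tendsto_order.2 ⟨fun b hb =>
    eventually_lt_integral_of_ae_tendsto hu hu0 hv hlimu hb, fun b hb => ?_⟩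
  have h := eventually_lt_integral_of_ae_tendsto (u := fun N y => k N y - u N y)
    (v := fun y => l y - v y) (b := (∫ y, l y ∂ν) - b)
    (by filter_upwards [hu, hk] with N h1 h2 using h2.sub h1)
    (by filter_upwards [huk] with N h; filter_upwards [h] with y hy using sub_nonneg.2 hy)
    (hl.sub hv)
    (by filter_upwards [hlimu, hlimk] with y h1 h2 using h2.sub h1)
    (by rw [integral_sub hl hv]; linarith)
  filter_upwards [h, hu, hk, hkl] with N h1 h2 h3 h4
  rw [integral_sub h3 h2, h4] at h1
  linarith

/-- The `φ`-sums of the cell averages of `h` converge to the integral of `φ ∘ h`. -/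
theorem tendsto_sum_convexOn_unitCell {h φ : ℝ → ℝ} {s : Set ℝ} (hs : IsClosed s)
    (hφ : ConvexOn ℝ s φ) (hφc : ContinuousOn φ s) (hφ0 : ∀ t ∈ s, 0 ≤ φ t)
    (hh : IntegrableOn h (Ioc 0 1)) (hhs : ∀ y, h y ∈ s)
    (hφh : IntegrableOn (fun y => φ (h y)) (Ioc 0 1)) :
    Tendsto (fun N : ℕ => ∑ i ∈ Finset.range N, φ (N * ∫ z in unitCell N i, h z) / N) atTop
      (𝓝 (∫ y in Ioc 0 1, φ (h y))) := by
  have hne : ∀ {N i : ℕ}, i < N → volume (unitCell N i) ≠ 0 := by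
    intro N i hi h0
    have h1 := volume_real_unitCell N i
    have : (0 : ℝ) < N := by exact_mod_cast (Nat.zero_lt_of_lt hi)
    rw [measureReal_def, h0, ENNReal.toReal_zero] at h1
    have : (0 : ℝ) < 1 / N := by positivity
    linarith
  have hmem : ∀ {N i : ℕ}, i < N → N * ∫ z in unitCell N i, h z ∈ s := by
    intro N i hi
    rw [← setAverage_unitCell]
    exact hφ.1.set_average_mem hs (hne hi) (volume_unitCell_ne_top N i) (ae_of_all _ hhs)
      (integrableOn_unitCell hi hh)
  have hjen : ∀ {N i : ℕ}, i < N →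
      φ (N * ∫ z in unitCell N i, h z) ≤ N * ∫ z in unitCell N i, φ (h z) := by
    intro N i hi
    rw [← setAverage_unitCell, ← setAverage_unitCell]
    exact hφ.map_set_average_le hφc hs (hne hi) (volume_unitCell_ne_top N i) (ae_of_all _ hhs)
      (integrableOn_unitCell hi hh) (integrableOn_unitCell hi hφh)
  have hpos : ∀ᶠ N : ℕ in atTop, 0 < N := eventually_gt_atTop 0
  refine Tendsto.congr' (f₁ := fun N : ℕ => ∫ y in Ioc 0 1,
    φ (N * ∫ z in unitCell N (cellIdx N y), h z)) ?_ ?_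
  · filter_upwards [hpos] with N hN
    exact setIntegral_comp_cellIdx hN fun i => φ (N * ∫ z in unitCell N i, h z)
  refine tendsto_integral_of_le_of_integral_eq
    (k := fun N y => N * ∫ z in unitCell N (cellIdx N y), φ (h z)) (l := fun y => φ (h y))
    ?_ ?_ ?_ ?_ hφh hφh ?_ (ae_tendsto_unitCell_average hφh) ?_
  · filter_upwards [hpos] with N hN
    exact integrableOn_comp_cellIdx hN fun i => φ (N * ∫ z in unitCell N i, h z)
  · filter_upwards [hpos] with N hN
    filter_upwards [ae_restrict_mem measurableSet_Ioc] with y hy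
    exact hφ0 _ (hmem (mem_unitCell_cellIdx hN hy).1)
  · filter_upwards [hpos] with N hN
    exact integrableOn_comp_cellIdx hN fun i => N * ∫ z in unitCell N i, φ (h z)
  · filter_upwards [hpos] with N hN
    filter_upwards [ae_restrict_mem measurableSet_Ioc] with y hy
    exact hjen (mem_unitCell_cellIdx hN hy).1
  · filter_upwards [ae_tendsto_unitCell_average hh, ae_restrict_mem measurableSet_Ioc] with y hy hy01
    refine (hφc (h y) (hhs y)).tendsto.comp (tendsto_nhdsWithin_iff.2 ⟨hy, ?_⟩)
    filter_upwards [hpos] with N hN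
    exact hmem (mem_unitCell_cellIdx hN hy01).1
  · filter_upwards [hpos] with N hN
    rw [setIntegral_comp_cellIdx hN fun i => N * ∫ z in unitCell N i, φ (h z),
      ← sum_setIntegral_unitCell hN hφh]
    have hN' : (N : ℝ) ≠ 0 := by exact_mod_cast hN.ne'
    exact Finset.sum_congr rfl fun i _ => by field_simp

theorem unitMid_mem_unitCell {N i : ℕ} (hN : 0 < N) : unitMid N i ∈ unitCell N i := by
  have hN' : (0 : ℝ) < N := by exact_mod_cast hN
  rw [mem_unitCell_iff hN, unitMid]
  have : (2 * (i : ℝ) + 1) / (2 * N) * N = i + 1 / 2 := by field_simp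
  rw [this]
  constructor <;> linarith

theorem natCast_mul_abs_sub_unitMid_le {N i : ℕ} (hN : 0 < N) {z : ℝ} (hz : z ∈ unitCell N i) :
    N * |z - unitMid N i| ≤ 1 / 2 := by
  have hN' : (0 : ℝ) < N := by exact_mod_cast hN
  rw [mem_unitCell_iff hN] at hz
  have : N * |z - unitMid N i| = |z * N - (i + 1 / 2)| := by
    rw [← abs_of_pos hN', ← abs_mul, unitMid, abs_of_pos hN']
    congr 1
    field_simp
  rw [this, abs_le]
  constructor <;> linarith [hz.1, hz.2]

theorem integral_abs_rpow_half {r : ℝ} (hr : 0 < r) :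
    ∫ x in (-(1 / 2) : ℝ)..(1 / 2), |x| ^ r = Cr r := by
  have hcont : Continuous fun x : ℝ => |x| ^ r :=
    continuous_abs.rpow_const fun _ => Or.inr hr.le
  have h1 : ∫ x in (0 : ℝ)..(1 / 2), |x| ^ r = (1 / 2) ^ (r + 1) / (r + 1) := by
    rw [intervalIntegral.integral_congr (g := fun x : ℝ => x ^ r), integral_rpow (Or.inl (by linarith)),
      Real.zero_rpow (by linarith), sub_zero]
    intro x hx
    rw [uIcc_of_le (by norm_num)] at hx
    simp only [abs_of_nonneg hx.1]
  have h2 : ∫ x in (-(1 / 2) : ℝ)..0, |x| ^ r = (1 / 2) ^ (r + 1) / (r + 1) := by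
    rw [← h1]
    have := intervalIntegral.integral_comp_neg (a := 0) (b := 1 / 2) (fun x : ℝ => |x| ^ r)
    simpa using this.symm
  rw [← intervalIntegral.integral_add_adjacent_intervals (hcont.intervalIntegrable _ 0)
    (hcont.intervalIntegrable 0 _), h1, h2, Cr, Real.rpow_add (by norm_num), Real.rpow_one,
    Real.div_rpow (by norm_num) (by norm_num), Real.one_rpow]
  have : (2 : ℝ) ^ r ≠ 0 := by positivity
  field_simp
  ring

theorem natCast_mul_setIntegral_abs_sub_unitMid {N i : ℕ} (hN : 0 < N) {r : ℝ} (hr : 0 < r) :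
    N * ∫ z in unitCell N i, (N * |z - unitMid N i|) ^ r = Cr r := by
  have hN' : (0 : ℝ) < N := by exact_mod_cast hN
  have hle : (i : ℝ) / N ≤ (i + 1 : ℝ) / N := by gcongr; linarith
  have h := intervalIntegral.integral_comp_mul_sub (a := (i : ℝ) / N) (b := (i + 1 : ℝ) / N)
    (fun x : ℝ => |x| ^ r) hN'.ne' (N * unitMid N i)
  have e1 : N * ((i : ℝ) / N) - N * unitMid N i = -(1 / 2) := by
    rw [unitMid]; field_simp; ring
  have e2 : N * ((i + 1 : ℝ) / N) - N * unitMid N i = 1 / 2 := by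
    rw [unitMid]; field_simp; ring
  rw [e1, e2, integral_abs_rpow_half hr, intervalIntegral.integral_of_le hle] at h
  have h' : ∫ z in unitCell N i, (N * |z - unitMid N i|) ^ r = (N : ℝ)⁻¹ • Cr r := by
    rw [← h]
    refine setIntegral_congr_fun measurableSet_Ioc fun z _ => ?_
    rw [← mul_sub, abs_mul, abs_of_pos hN']
  rw [h', smul_eq_mul, mul_inv_cancel_left₀ hN'.ne']

theorem abs_rpow_sub_rpow_le {r : ℝ} (hr : 1 ≤ r) {s t M : ℝ} (hs : s ∈ Icc 0 M)
    (ht : t ∈ Icc 0 M) : |s ^ r - t ^ r| ≤ r * M ^ (r - 1) * |s - t| := by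
  have h := Convex.norm_image_sub_le_of_norm_hasDerivWithin_le (𝕜 := ℝ) (f := fun x : ℝ => x ^ r)
    (f' := fun x => r * x ^ (r - 1)) (s := Icc 0 M) (C := r * M ^ (r - 1)) (x := t) (y := s)
    (fun x _ => (Real.hasDerivAt_rpow_const (Or.inr hr)).hasDerivWithinAt)
    (fun x hx => by
      have hr0 : 0 ≤ r := by linarith
      rw [Real.norm_eq_abs, abs_of_nonneg (mul_nonneg hr0 (Real.rpow_nonneg hx.1 _))]
      exact mul_le_mul_of_nonneg_left (Real.rpow_le_rpow hx.1 hx.2 (by linarith)) hr0)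
    (convex_Icc _ _) ht hs
  simpa [Real.norm_eq_abs] using h

theorem abs_intervalIntegral_unitMid_le {N i : ℕ} (hi : i < N) {v : ℝ → ℝ}
    (hv : IntegrableOn v (unitCell N i)) {z : ℝ} (hz : z ∈ unitCell N i) :
    |∫ t in unitMid N i..z, v t| ≤ ∫ t in unitCell N i, |v t| := by
  have hN := Nat.zero_lt_of_lt hi
  have hm := unitMid_mem_unitCell (i := i) hN
  refine (intervalIntegral.norm_integral_le_integral_norm_uIoc (f := v)).trans ?_
  refine setIntegral_mono_set hv.norm (ae_of_all _ fun _ => norm_nonneg _) ?_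
  refine LE.le.eventuallyLE ?_
  intro t ht
  rw [uIoc, mem_Ioc] at ht
  rw [unitCell, mem_Ioc] at *
  exact ⟨lt_of_le_of_lt (le_min hm.1.le hz.1.le) ht.1 |>.trans_le le_rfl,
    ht.2.trans (max_le hm.2 hz.2)⟩

/-- The normalised distortion on a cell of a quantizer with primitive `W`. -/
theorem tendsto_sum_rpow_unitCell {r : ℝ} (hr : 1 ≤ r) {w h k W : ℝ → ℝ} (hW : Measurable W)
    (hWw : ∀ x ∈ Ioc (0 : ℝ) 1, ∀ y ∈ Ioc (0 : ℝ) 1, W y - W x = ∫ t in x..y, w t)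
    (hw : IntegrableOn w (Ioc 0 1)) (hw0 : ∀ y, 0 ≤ w y)
    (hh : IntegrableOn h (Ioc 0 1)) (hh0 : ∀ y, 0 ≤ h y)
    (hk : IntegrableOn k (Ioc 0 1))
    (hwhk : ∀ N i : ℕ, i < N → (N * ∫ z in unitCell N i, w z) ^ r * (N * ∫ z in unitCell N i, h z)
      ≤ N * ∫ z in unitCell N i, k z)
    (hwh : IntegrableOn (fun y => w y ^ r * h y) (Ioc 0 1)) :
    Tendsto (fun N : ℕ => (N : ℝ) ^ r * ∑ i ∈ Finset.range N, ∫ z in unitCell N i,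
        |W z - W (unitMid N i)| ^ r * h z) atTop
      (𝓝 (Cr r * ∫ y in Ioc 0 1, w y ^ r * h y)) := by
  have hr0 : 0 < r := by linarith
  have hpos : ∀ᶠ N : ℕ in atTop, 0 < N := eventually_gt_atTop 0
  have hbound : ∀ {N i : ℕ}, i < N → ∀ z ∈ unitCell N i,
      |W z - W (unitMid N i)| ≤ ∫ z in unitCell N i, w z := by
    intro N i hi z hz
    have hN := Nat.zero_lt_of_lt hi
    rw [hWw _ (unitCell_subset hi (unitMid_mem_unitCell hN)) _ (unitCell_subset hi hz)]
    refine (abs_intervalIntegral_unitMid_le hi (integrableOn_unitCell hi hw) hz).trans_eq ?_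
    exact integral_congr_ae (ae_of_all _ fun t => abs_of_nonneg (hw0 t))
  have hmeas : ∀ N i : ℕ, Measurable fun z => (N * |W z - W (unitMid N i)|) ^ r := fun N i => by
    fun_prop
  have hAb : ∀ {N i : ℕ}, i < N → ∀ z ∈ unitCell N i,
      (N * |W z - W (unitMid N i)|) ^ r ≤ (N * ∫ z in unitCell N i, w z) ^ r := by
    intro N i hi z hz
    have := hbound hi z hz
    gcongr
  have hAh : ∀ {N i : ℕ}, i < N →
      IntegrableOn (fun z => (N * |W z - W (unitMid N i)|) ^ r * h z) (unitCell N i) := by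
    intro N i hi
    refine Integrable.bdd_mul (c := (N * ∫ z in unitCell N i, w z) ^ r)
      (integrableOn_unitCell hi hh) (hmeas N i).aestronglyMeasurable ?_
    filter_upwards [ae_restrict_mem (measurableSet_unitCell N i)] with z hz
    rw [Real.norm_eq_abs, abs_of_nonneg (by positivity)]
    exact hAb hi z hz
  set S : ℕ → ℕ → ℝ := fun N i =>
    N * ∫ z in unitCell N i, (N * |W z - W (unitMid N i)|) ^ r * h z with hS
  have hS0 : ∀ N i, 0 ≤ S N i := fun N i => by
    refine mul_nonneg (Nat.cast_nonneg _) (integral_nonneg fun z => ?_)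
    exact mul_nonneg (by positivity) (hh0 z)
  have hSk : ∀ {N i : ℕ}, i < N → S N i ≤ N * ∫ z in unitCell N i, k z := by
    intro N i hi
    refine le_trans ?_ (hwhk N i hi)
    rw [mul_left_comm]
    refine mul_le_mul_of_nonneg_left ?_ (Nat.cast_nonneg _)
    rw [← integral_const_mul]
    refine setIntegral_mono_on (hAh hi) ((integrableOn_unitCell hi hh).const_mul _)
      (measurableSet_unitCell N i) fun z hz => ?_
    exact mul_le_mul_of_nonneg_right (hAb hi z hz) (hh0 z)
  have hlim : ∀ᵐ y ∂(volume.restrict (Ioc (0 : ℝ) 1)),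
      Tendsto (fun N : ℕ => S N (cellIdx N y)) atTop (𝓝 (Cr r * (w y ^ r * h y))) := by
    filter_upwards [ae_tendsto_unitCell_norm_sub hw, ae_tendsto_unitCell_norm_sub hh,
      ae_tendsto_unitCell_average hh, ae_restrict_mem measurableSet_Ioc] with y h1 h2 h3 hy
    rw [tendsto_iff_norm_sub_tendsto_zero]
    have hη : Tendsto (fun N : ℕ => r * (w y + N * ∫ z in unitCell N (cellIdx N y), |w z - w y|)
          ^ (r - 1) * (N * ∫ z in unitCell N (cellIdx N y), |w z - w y|)
          * (N * ∫ z in unitCell N (cellIdx N y), h z)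
        + w y ^ r * (N * ∫ z in unitCell N (cellIdx N y), |h z - h y|)) atTop (𝓝 0) := by
      have e1 := (((h1.const_add (w y)).rpow_const (p := r - 1)
        (Or.inr (by linarith))).const_mul r).mul h1
      have e2 := (e1.mul h3).add (h2.const_mul (w y ^ r))
      simpa using e2
    refine squeeze_zero' (Eventually.of_forall fun _ => norm_nonneg _) ?_ hη
    filter_upwards [hpos] with N hN
    have hN' : (0 : ℝ) < N := by exact_mod_cast hN
    obtain ⟨hi, -⟩ := mem_unitCell_cellIdx hN hy
    generalize cellIdx N y = i at hi ⊢
    set e : ℝ := N * ∫ z in unitCell N i, |w z - w y| with he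
    have he0 : 0 ≤ e := mul_nonneg hN'.le (integral_nonneg fun z => abs_nonneg _)
    have hwy := integrableOn_unitCell hi hw
    have hcst : ∀ C : ℝ, IntegrableOn (fun _ : ℝ => C) (unitCell N i) := fun C =>
      integrableOn_const (volume_unitCell_ne_top _ _)
    have hclose : ∀ z ∈ unitCell N i,
        |N * |W z - W (unitMid N i)| - N * |z - unitMid N i| * w y| ≤ e := by
      intro z hz
      have hsub : uIcc (unitMid N i) z ⊆ Ioc 0 1 := by
        have h01 : OrdConnected (Ioc (0 : ℝ) 1) := ordConnected_Ioc
        exact h01.uIcc_subset (unitCell_subset hi (unitMid_mem_unitCell hN))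
          (unitCell_subset hi hz)
      have hii : IntervalIntegrable w volume (unitMid N i) z :=
        (hw.mono_set hsub).intervalIntegrable
      have h4 : W z - W (unitMid N i) - (z - unitMid N i) * w y
          = ∫ t in unitMid N i..z, (w t - w y) := by
        rw [intervalIntegral.integral_sub hii (by simp), ← hWw _
          (unitCell_subset hi (unitMid_mem_unitCell hN)) _ (unitCell_subset hi hz),
          intervalIntegral.integral_const, smul_eq_mul]
      have h5 := abs_intervalIntegral_unitMid_le hi (hwy.sub (hcst (w y))) hz
      rw [Pi.sub_def, ← h4] at h5
      have h6 : |z - unitMid N i| * w y = |(z - unitMid N i) * w y| := by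
        rw [abs_mul, abs_of_nonneg (hw0 y)]
      rw [mul_assoc, ← mul_sub, abs_mul, abs_of_pos hN', he, h6]
      exact mul_le_mul_of_nonneg_left ((abs_abs_sub_abs_le_abs_sub _ _).trans h5) hN'.le
    have hB : Cr r * (w y ^ r * h y)
        = N * ∫ z in unitCell N i, (N * |z - unitMid N i|) ^ r * (w y ^ r * h y) := by
      rw [integral_mul_const, ← mul_assoc (N : ℝ), natCast_mul_setIntegral_abs_sub_unitMid hN hr0]
    have hBint : IntegrableOn (fun z => (N * |z - unitMid N i|) ^ r * (w y ^ r * h y))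
        (unitCell N i) := by
      refine Integrable.mul_const ?_ _
      have hc : Continuous fun z : ℝ => (N * |z - unitMid N i|) ^ r :=
        (by fun_prop : Continuous fun z : ℝ => N * |z - unitMid N i|).rpow_const
          fun _ => Or.inr hr0.le
      exact hc.locallyIntegrable.integrableOn_isCompact isCompact_Icc |>.mono_set Ioc_subset_Icc_self
    rw [hB, hS, ← mul_sub, ← integral_sub (hAh hi) hBint, norm_mul, Real.norm_natCast]
    have hdom : ∀ z ∈ unitCell N i,
        ‖(N * |W z - W (unitMid N i)|) ^ r * h z
          - (N * |z - unitMid N i|) ^ r * (w y ^ r * h y)‖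
        ≤ r * (w y + e) ^ (r - 1) * e * h z + w y ^ r * |h z - h y| := by
      intro z hz
      have hz1 := natCast_mul_abs_sub_unitMid_le hN hz
      have hz0 : 0 ≤ N * |z - unitMid N i| := by positivity
      have ht : N * |z - unitMid N i| * w y ∈ Icc 0 (w y + e) :=
        ⟨mul_nonneg hz0 (hw0 y), by nlinarith [hw0 y]⟩
      have hs : N * |W z - W (unitMid N i)| ∈ Icc 0 (w y + e) :=
        ⟨by positivity, by nlinarith [hw0 y, (abs_le.1 (hclose z hz)).2]⟩
      have h7 := abs_rpow_sub_rpow_le hr hs ht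
      have h8 : (N * |W z - W (unitMid N i)|) ^ r * h z
          - (N * |z - unitMid N i|) ^ r * (w y ^ r * h y)
        = ((N * |W z - W (unitMid N i)|) ^ r - (N * |z - unitMid N i| * w y) ^ r) * h z
          + (N * |z - unitMid N i|) ^ r * w y ^ r * (h z - h y) := by
        rw [Real.mul_rpow hz0 (hw0 y)]; ring
      rw [h8, Real.norm_eq_abs]
      refine (abs_add_le _ _).trans (add_le_add ?_ ?_)
      · rw [abs_mul, abs_of_nonneg (hh0 z)]
        refine mul_le_mul_of_nonneg_right (h7.trans ?_) (hh0 z)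
        exact mul_le_mul_of_nonneg_left (hclose z hz)
          (mul_nonneg hr0.le (Real.rpow_nonneg (add_nonneg (hw0 y) he0) _))
      · have h9 : (N * |z - unitMid N i|) ^ r ≤ 1 :=
          Real.rpow_le_one hz0 (by linarith) hr0.le
        have h10 : 0 ≤ w y ^ r := Real.rpow_nonneg (hw0 y) _
        have h11 : 0 ≤ (N * |z - unitMid N i|) ^ r := Real.rpow_nonneg hz0 _
        rw [abs_mul, abs_of_nonneg (mul_nonneg h11 h10)]
        exact mul_le_mul_of_nonneg_right (mul_le_of_le_one_left h10 h9) (abs_nonneg _)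
    have hhi := integrableOn_unitCell hi hh
    have hi1 : IntegrableOn (fun z => r * (w y + e) ^ (r - 1) * e * h z) (unitCell N i) :=
      hhi.const_mul _
    have hi2 : IntegrableOn (fun z => w y ^ r * |h z - h y|) (unitCell N i) :=
      ((hhi.sub (hcst (h y))).norm).const_mul _
    calc (N : ℝ) * ‖∫ z in unitCell N i, ((N * |W z - W (unitMid N i)|) ^ r * h z
          - (N * |z - unitMid N i|) ^ r * (w y ^ r * h y))‖
        ≤ N * ∫ z in unitCell N i,
            (r * (w y + e) ^ (r - 1) * e * h z + w y ^ r * |h z - h y|) := by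
          refine mul_le_mul_of_nonneg_left ?_ hN'.le
          refine norm_integral_le_of_norm_le (hi1.add hi2) ?_
          filter_upwards [ae_restrict_mem (measurableSet_unitCell N i)] with z hz using hdom z hz
      _ = _ := by
          rw [integral_add hi1 hi2, integral_const_mul, integral_const_mul]
          ring
  have hfin := tendsto_integral_of_le_of_integral_eq (ν := volume.restrict (Ioc (0 : ℝ) 1))
    (u := fun N y => S N (cellIdx N y))
    (k := fun N y => N * ∫ z in unitCell N (cellIdx N y), k z)
    (v := fun y => Cr r * (w y ^ r * h y)) (l := k)
    (by filter_upwards [hpos] with N hN using integrableOn_comp_cellIdx hN (S N))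
    (Eventually.of_forall fun N => ae_of_all _ fun y => hS0 _ _)
    (by filter_upwards [hpos] with N hN using
          integrableOn_comp_cellIdx hN fun i => N * ∫ z in unitCell N i, k z)
    (by filter_upwards [hpos] with N hN
        filter_upwards [ae_restrict_mem measurableSet_Ioc] with y hy
        exact hSk (mem_unitCell_cellIdx hN hy).1)
    (hwh.const_mul _) hk hlim (ae_tendsto_unitCell_average hk)
    (by filter_upwards [hpos] with N hN
        rw [setIntegral_comp_cellIdx hN fun i => N * ∫ z in unitCell N i, k z,
          ← sum_setIntegral_unitCell hN hk]
        have hN' : (N : ℝ) ≠ 0 := by exact_mod_cast hN.ne'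
        exact Finset.sum_congr rfl fun i _ => by field_simp)
  rw [integral_const_mul] at hfin
  refine hfin.congr' ?_
  filter_upwards [hpos] with N hN
  have hN' : (0 : ℝ) < N := by exact_mod_cast hN
  rw [setIntegral_comp_cellIdx hN (S N), Finset.mul_sum]
  refine Finset.sum_congr rfl fun i _ => ?_
  simp only [hS]
  rw [mul_div_cancel_left₀ _ hN'.ne', ← integral_const_mul]
  refine integral_congr_ae (ae_of_all _ fun z => ?_)
  simp only
  rw [Real.mul_rpow hN'.le (abs_nonneg _), mul_assoc]

/-- A probability density that is positive exactly on the compact interval `[c,d]`. -/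
structure IsPointDensity (g : ℝ → ℝ) (c d : ℝ) : Prop where
  lt : c < d
  measurable : Measurable g
  pos : ∀ x ∈ Icc c d, 0 < g x
  zero : ∀ x ∉ Icc c d, g x = 0
  integral_eq_one : ∫ x, g x = 1

/-- The inverse on `[c,d]` of the compressor of a point density, extended monotonically to `ℝ`. -/
def invCompressor (g : ℝ → ℝ) (c d y : ℝ) : ℝ :=
  sSup (insert c {x | x ∈ Icc c d ∧ compressor g x ≤ y})

namespace IsPointDensity

variable {g : ℝ → ℝ} {c d : ℝ}

theorem integrable (hg : IsPointDensity g c d) : Integrable g :=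
  Integrable.of_integral_ne_zero (by rw [hg.integral_eq_one]; exact one_ne_zero)

theorem nonneg (hg : IsPointDensity g c d) (x : ℝ) : 0 ≤ g x := by
  by_cases hx : x ∈ Icc c d
  · exact (hg.pos x hx).le
  · exact (hg.zero x hx).ge

theorem compressor_sub (hg : IsPointDensity g c d) (x y : ℝ) :
    compressor g y - compressor g x = ∫ t in x..y, g t :=
  intervalIntegral.integral_Iic_sub_Iic hg.integrable.integrableOn hg.integrable.integrableOn

theorem continuous_compressor (hg : IsPointDensity g c d) : Continuous (compressor g) := by
  have : compressor g = fun x => compressor g c + ∫ t in c..x, g t := by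
    funext x
    rw [← hg.compressor_sub]; ring
  rw [this]
  exact continuous_const.add
    (intervalIntegral.continuous_primitive (fun _ _ => hg.integrable.intervalIntegrable) _)

theorem monotone_compressor (hg : IsPointDensity g c d) : Monotone (compressor g) := by
  intro x y hxy
  have := hg.compressor_sub x y
  have h0 : 0 ≤ ∫ t in x..y, g t := intervalIntegral.integral_nonneg hxy fun u _ => hg.nonneg u
  linarith

theorem strictMonoOn_compressor (hg : IsPointDensity g c d) :
    StrictMonoOn (compressor g) (Icc c d) := by
  intro x hx y hy hxy
  have := hg.compressor_sub x y
  have h0 : 0 < ∫ t in x..y, g t :=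
    intervalIntegral.intervalIntegral_pos_of_pos_on hg.integrable.intervalIntegrable
      (fun t ht => hg.pos t ⟨hx.1.trans ht.1.le, ht.2.le.trans hy.2⟩) hxy
  linarith

theorem compressor_of_le (hg : IsPointDensity g c d) {x : ℝ} (hx : x ≤ c) :
    compressor g x = 0 := by
  have hc : compressor g x = ∫ t in Iio x, g t := integral_Iic_eq_integral_Iio
  rw [hc]
  refine setIntegral_eq_zero_of_forall_eq_zero fun t ht => hg.zero t fun h => ?_
  exact absurd (lt_of_lt_of_le ht hx) (not_lt.2 h.1)

theorem compressor_of_ge (hg : IsPointDensity g c d) {x : ℝ} (hx : d ≤ x) :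
    compressor g x = 1 := by
  rw [compressor, ← hg.integral_eq_one]
  refine setIntegral_eq_integral_of_forall_compl_eq_zero fun t ht => hg.zero t fun h => ?_
  exact ht (h.2.trans hx)

theorem compressor_mem (hg : IsPointDensity g c d) (x : ℝ) : compressor g x ∈ Icc (0 : ℝ) 1 := by
  rw [← hg.compressor_of_le (min_le_right x c), ← hg.compressor_of_ge (le_max_right x d)]
  exact ⟨hg.monotone_compressor (min_le_left _ _), hg.monotone_compressor (le_max_left _ _)⟩

theorem exists_compressor_eq (hg : IsPointDensity g c d) {y : ℝ} (hy : y ∈ Icc (0 : ℝ) 1) :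
    ∃ x ∈ Icc c d, compressor g x = y := by
  rw [← hg.compressor_of_le le_rfl, ← hg.compressor_of_ge le_rfl] at hy
  obtain ⟨x, hx, h⟩ := intermediate_value_Icc hg.lt.le hg.continuous_compressor.continuousOn hy
  exact ⟨x, hx, h⟩

theorem insert_subset (hg : IsPointDensity g c d) (y : ℝ) :
    insert c {x | x ∈ Icc c d ∧ compressor g x ≤ y} ⊆ Icc c d :=
  insert_subset_iff.2 ⟨left_mem_Icc.2 hg.lt.le, fun _ hx => hx.1⟩

theorem invCompressor_mem (hg : IsPointDensity g c d) (y : ℝ) :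
    invCompressor g c d y ∈ Icc c d :=
  ⟨le_csSup (bddAbove_Icc.mono (hg.insert_subset y)) (mem_insert _ _),
    csSup_le (insert_nonempty _ _) fun _ hx => (hg.insert_subset y hx).2⟩

theorem monotone_invCompressor (hg : IsPointDensity g c d) : Monotone (invCompressor g c d) := by
  intro y z hyz
  refine csSup_le_csSup (bddAbove_Icc.mono (hg.insert_subset z)) (insert_nonempty _ _) ?_
  exact insert_subset_insert fun x hx => ⟨hx.1, hx.2.trans hyz⟩

theorem invCompressor_compressor (hg : IsPointDensity g c d) {x : ℝ} (hx : x ∈ Icc c d) :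
    invCompressor g c d (compressor g x) = x := by
  refine le_antisymm (csSup_le (insert_nonempty _ _) ?_)
    (le_csSup (bddAbove_Icc.mono (hg.insert_subset _)) (mem_insert_of_mem _ ⟨hx, le_rfl⟩))
  rintro z (rfl | hz)
  · exact hx.1
  · exact (hg.strictMonoOn_compressor.le_iff_le hz.1 hx).1 hz.2

theorem compressor_invCompressor (hg : IsPointDensity g c d) {y : ℝ} (hy : y ∈ Icc (0 : ℝ) 1) :
    compressor g (invCompressor g c d y) = y := by
  obtain ⟨x, hx, rfl⟩ := hg.exists_compressor_eq hy
  rw [hg.invCompressor_compressor hx]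

theorem geninv_eq (hg : IsPointDensity g c d) {y : ℝ} (hy : y ∈ Ioo (0 : ℝ) 1) :
    geninv g y = invCompressor g c d y := by
  rw [geninv, if_neg (not_le.2 hy.1), if_neg (not_le.2 hy.2)]
  obtain ⟨x, hx, rfl⟩ := hg.exists_compressor_eq (Ioo_subset_Icc_self hy)
  rw [hg.invCompressor_compressor hx]
  have : {z | compressor g z ≤ compressor g x} = Iic x := by
    ext z
    refine ⟨fun hz => ?_, fun hz => hg.monotone_compressor hz⟩
    by_contra hlt
    rw [mem_Iic, not_le] at hlt
    rcases le_or_gt z d with hzd | hzd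
    · exact absurd (hg.strictMonoOn_compressor hx ⟨hx.1.trans hlt.le, hzd⟩ hlt) (not_lt.2 hz)
    · have h1 := hg.compressor_of_ge hzd.le
      rw [mem_ofPred_eq, h1] at hz
      exact absurd hy.2 (not_lt.2 hz)
  rw [this, csSup_Iic]

/-- Change of variables along the compressor. -/
theorem map_invCompressor (hg : IsPointDensity g c d) :
    Measure.map (invCompressor g c d) (volume.restrict (Ioc (0 : ℝ) 1))
      = volume.withDensity fun x => ENNReal.ofReal (g x) := by
  have hX := hg.monotone_invCompressor.measurable
  have hfin : IsFiniteMeasure (Measure.map (invCompressor g c d) (volume.restrict (Ioc (0 : ℝ) 1))) :=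
    Measure.isFiniteMeasure_map _ _
  refine Measure.ext_of_Iic _ _ fun a => ?_
  rw [Measure.map_apply hX measurableSet_Iic, Measure.restrict_apply (hX measurableSet_Iic),
    withDensity_apply _ measurableSet_Iic,
    ← ofReal_integral_eq_lintegral_ofReal hg.integrable.integrableOn (ae_of_all _ hg.nonneg)]
  change _ = ENNReal.ofReal (compressor g a)
  rcases lt_or_ge a c with hac | hac
  · have : invCompressor g c d ⁻¹' Iic a ∩ Ioc 0 1 = ∅ := by
      ext y
      simp only [mem_inter_iff, mem_preimage, mem_Iic, mem_empty_iff_false, iff_false, not_and]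
      intro h
      exact absurd ((hg.invCompressor_mem y).1.trans h) (not_le.2 hac)
    rw [this, hg.compressor_of_le hac.le]
    simp
  · have : invCompressor g c d ⁻¹' Iic a ∩ Ioc 0 1 = Ioc 0 (compressor g a) := by
      ext y
      simp only [mem_inter_iff, mem_preimage, mem_Iic, mem_Ioc]
      constructor
      · rintro ⟨h1, h2, h3⟩
        refine ⟨h2, ?_⟩
        rw [← hg.compressor_invCompressor ⟨h2.le, h3⟩]
        exact hg.monotone_compressor h1
      · rintro ⟨h1, h2⟩
        refine ⟨?_, h1, h2.trans (hg.compressor_mem a).2⟩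
        rcases le_or_gt a d with had | had
        · rw [← hg.invCompressor_compressor ⟨hac, had⟩]
          exact hg.monotone_invCompressor h2
        · exact (hg.invCompressor_mem y).2.trans had.le
    rw [this, Real.volume_Ioc, sub_zero]

theorem restrict_eq_withDensity_map (hg : IsPointDensity g c d) :
    volume.restrict (Icc c d) = (Measure.map (invCompressor g c d)
      (volume.restrict (Ioc (0 : ℝ) 1))).withDensity fun x => ENNReal.ofReal (g x)⁻¹ := by
  have h1 : Measurable fun x => ENNReal.ofReal (g x) := hg.measurable.ennreal_ofReal
  have h2 : Measurable fun x => ENNReal.ofReal (g x)⁻¹ := hg.measurable.inv.ennreal_ofReal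
  rw [hg.map_invCompressor, ← withDensity_mul _ h1 h2, ← withDensity_indicator_one measurableSet_Icc]
  congr 1
  funext x
  by_cases hx : x ∈ Icc c d
  · have := hg.pos x hx
    rw [indicator_of_mem hx, Pi.mul_apply, ← ENNReal.ofReal_mul this.le, mul_inv_cancel₀ this.ne']
    simp
  · rw [indicator_of_notMem hx, Pi.mul_apply, hg.zero x hx]
    simp

theorem lintegral_Icc (hg : IsPointDensity g c d) {φ : ℝ → ℝ≥0∞} (hφ : Measurable φ) :
    ∫⁻ x in Icc c d, φ x = ∫⁻ y in Ioc 0 1,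
      ENNReal.ofReal (g (invCompressor g c d y))⁻¹ * φ (invCompressor g c d y) := by
  have h2 : Measurable fun x => ENNReal.ofReal (g x)⁻¹ := hg.measurable.inv.ennreal_ofReal
  rw [hg.restrict_eq_withDensity_map, lintegral_withDensity_eq_lintegral_mul _ h2 hφ,
    lintegral_map (h2.mul hφ) hg.monotone_invCompressor.measurable]
  rfl

theorem integral_Icc (hg : IsPointDensity g c d) {φ : ℝ → ℝ} (hφ : Measurable φ) :
    ∫ x in Icc c d, φ x = ∫ y in Ioc 0 1,
      (g (invCompressor g c d y))⁻¹ * φ (invCompressor g c d y) := by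
  have h2 : Measurable fun x => ENNReal.ofReal (g x)⁻¹ := hg.measurable.inv.ennreal_ofReal
  rw [hg.restrict_eq_withDensity_map, integral_withDensity_eq_integral_toReal_smul h2
    (ae_of_all _ fun _ => ENNReal.ofReal_lt_top), integral_map
    hg.monotone_invCompressor.measurable.aemeasurable
    (f := fun x => (ENNReal.ofReal (g x)⁻¹).toReal • φ x)
    (h2.ennreal_toReal.smul hφ).aestronglyMeasurable]
  refine integral_congr_ae (ae_of_all _ fun y => ?_)
  simp only [smul_eq_mul]
  rw [ENNReal.toReal_ofReal (inv_nonneg.2 (hg.nonneg _))]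

theorem integrableOn_Icc_iff (hg : IsPointDensity g c d) {φ : ℝ → ℝ} (hφ : Measurable φ) :
    IntegrableOn φ (Icc c d) ↔ IntegrableOn (fun y =>
      (g (invCompressor g c d y))⁻¹ * φ (invCompressor g c d y)) (Ioc 0 1) := by
  have h2 : Measurable fun x => ENNReal.ofReal (g x)⁻¹ := hg.measurable.inv.ennreal_ofReal
  rw [IntegrableOn, hg.restrict_eq_withDensity_map, integrable_withDensity_iff_integrable_smul' h2
    (ae_of_all _ fun _ => ENNReal.ofReal_lt_top), integrable_map_measure
    (g := fun x => (ENNReal.ofReal (g x)⁻¹).toReal • φ x)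
    (h2.ennreal_toReal.smul hφ).aestronglyMeasurable
    hg.monotone_invCompressor.measurable.aemeasurable, IntegrableOn]
  refine integrable_congr (ae_of_all _ fun y => ?_)
  simp only [Function.comp, smul_eq_mul]
  rw [ENNReal.toReal_ofReal (inv_nonneg.2 (hg.nonneg _))]

theorem invCompressor_sub (hg : IsPointDensity g c d) {x y : ℝ} (hx : x ∈ Ioc (0 : ℝ) 1)
    (hy : y ∈ Ioc (0 : ℝ) 1) :
    invCompressor g c d y - invCompressor g c d x
      = ∫ t in x..y, (g (invCompressor g c d t))⁻¹ := by
  wlog hxy : x ≤ y generalizing x y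
  · rw [intervalIntegral.integral_symm, ← this hy hx (le_of_not_ge hxy)]; ring
  set X := invCompressor g c d with hX
  have hX01 : ∀ t ∈ Ioc (0 : ℝ) 1, compressor g (X t) = t := fun t ht =>
    hg.compressor_invCompressor (Ioc_subset_Icc_self ht)
  have hlt : ∀ s ∈ Ioc (0 : ℝ) 1, ∀ t ∈ Ioc (0 : ℝ) 1, s < t → X s < X t := by
    intro s hs t ht hst
    refine lt_of_le_of_ne (hg.monotone_invCompressor hst.le) fun h => ?_
    have := hX01 s hs
    rw [h, hX01 t ht] at this
    exact hst.ne this.symm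
  have h := hg.integral_Icc (φ := (Ioc (X x) (X y)).indicator fun _ => 1)
    (measurable_const.indicator measurableSet_Ioc)
  rw [integral_indicator measurableSet_Ioc, Measure.restrict_restrict measurableSet_Ioc,
    inter_eq_left.2 (Ioc_subset_Icc_self.trans (Icc_subset_Icc (hg.invCompressor_mem x).1
      (hg.invCompressor_mem y).2)), setIntegral_const, Real.volume_real_Ioc_of_le
      (hg.monotone_invCompressor hxy), smul_eq_mul, mul_one] at h
  rw [h, intervalIntegral.integral_of_le hxy]
  have hsub : Ioc x y ⊆ Ioc 0 1 := Ioc_subset_Ioc hx.1.le hy.2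
  rw [← inter_eq_right.2 hsub, ← setIntegral_indicator measurableSet_Ioc]
  refine setIntegral_congr_fun measurableSet_Ioc fun t ht => ?_
  have hiff : X t ∈ Ioc (X x) (X y) ↔ t ∈ Ioc x y := by
    constructor
    · rintro ⟨h1, h2⟩
      refine ⟨lt_of_not_ge fun h => ?_, le_of_not_gt fun h => ?_⟩
      · exact absurd (hg.monotone_invCompressor h) (not_le.2 h1)
      · exact absurd (hlt y hy t ht h) (not_lt.2 h2)
    · rintro ⟨h1, h2⟩
      exact ⟨hlt x hx t ht h1, hg.monotone_invCompressor h2⟩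
  by_cases hm : t ∈ Ioc x y
  · rw [indicator_of_mem hm, indicator_of_mem (hiff.2 hm), mul_one]
  · rw [indicator_of_notMem hm, indicator_of_notMem (fun h => hm (hiff.1 h)), mul_zero]

end IsPointDensity

theorem uniformQ_eq_unitMid {N i : ℕ} (hN : 0 < N) {y : ℝ} (hy : y ∈ unitCell N i) :
    uniformQ N y = unitMid N i := by
  rw [mem_unitCell_iff hN] at hy
  have : ⌈y * (N : ℝ)⌉ = i + 1 := by
    rw [Int.ceil_eq_iff]
    push_cast
    exact ⟨by linarith [hy.1], hy.2⟩
  have hmax : max 1 ((i : ℤ) + 1) = i + 1 := max_eq_right (by omega)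
  rw [uniformQ, this, hmax, unitMid]
  push_cast
  ring

theorem measurable_uniformQ (N : ℕ) : Measurable (uniformQ N) := by
  unfold uniformQ
  have h : Measurable fun x : ℝ => ⌈x * (N : ℝ)⌉ :=
    Int.measurable_ceil.comp (measurable_id.mul_const _)
  exact ((measurable_from_top (f := fun n : ℤ => ((2 * max 1 n - 1 : ℤ) : ℝ))).comp h).div_const _

theorem unitMid_mem_Ioo {N i : ℕ} (hi : i < N) : unitMid N i ∈ Ioo (0 : ℝ) 1 := by
  have hN' : (0 : ℝ) < N := by exact_mod_cast (Nat.zero_lt_of_lt hi)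
  have hi' : (i + 1 : ℝ) ≤ N := by exact_mod_cast hi
  rw [unitMid]
  exact ⟨by positivity, by rw [div_lt_one (by positivity)]; linarith⟩

theorem uniformQ_mem_Ioo {N : ℕ} (hN : 0 < N) {y : ℝ} (hy : y ∈ Icc (0 : ℝ) 1) :
    uniformQ N y ∈ Ioo (0 : ℝ) 1 := by
  rcases hy.1.eq_or_lt with rfl | h0
  · have : uniformQ N 0 = unitMid N 0 := by simp [uniformQ, unitMid]
    rw [this]
    exact unitMid_mem_Ioo hN
  · obtain ⟨h1, h2⟩ := mem_unitCell_cellIdx hN ⟨h0, hy.2⟩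
    rw [uniformQ_eq_unitMid hN h2]
    exact unitMid_mem_Ioo h1

namespace IsPointDensity

variable {g f : ℝ → ℝ} {c d : ℝ}

theorem compand_eq (hg : IsPointDensity g c d) {N : ℕ} (hN : 0 < N) (x : ℝ) :
    compand g N x = invCompressor g c d (uniformQ N (compressor g x)) :=
  hg.geninv_eq (uniformQ_mem_Ioo hN (hg.compressor_mem x))

theorem measurable_compand (hg : IsPointDensity g c d) {N : ℕ} (hN : 0 < N) :
    Measurable (compand g N) := by
  have : compand g N = fun x => invCompressor g c d (uniformQ N (compressor g x)) :=
    funext (hg.compand_eq hN)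
  rw [this]
  exact hg.monotone_invCompressor.measurable.comp
    ((measurable_uniformQ N).comp hg.continuous_compressor.measurable)

theorem compand_invCompressor (hg : IsPointDensity g c d) {N i : ℕ} (hi : i < N) {y : ℝ}
    (hy : y ∈ unitCell N i) :
    compand g N (invCompressor g c d y) = invCompressor g c d (unitMid N i) := by
  have hN := Nat.zero_lt_of_lt hi
  rw [hg.compand_eq hN, hg.compressor_invCompressor
    (Ioc_subset_Icc_self (unitCell_subset hi hy)), uniformQ_eq_unitMid hN hy]

/-- Integrals against the source measure, in the compressed variable. -/
theorem lintegral_withDensity (hg : IsPointDensity g c d) (hf : Measurable f)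
    (hfz : ∀ x ∉ Icc c d, f x = 0) {φ : ℝ → ℝ≥0∞} (hφ : Measurable φ) :
    ∫⁻ x, φ x ∂(volume.withDensity fun x => ENNReal.ofReal (f x)) = ∫⁻ y in Ioc 0 1,
      ENNReal.ofReal (f (invCompressor g c d y) / g (invCompressor g c d y))
        * φ (invCompressor g c d y) := by
  rw [lintegral_withDensity_eq_lintegral_mul _ hf.ennreal_ofReal hφ,
    ← setLIntegral_eq_of_support_subset (s := Icc c d), hg.lintegral_Icc (hf.ennreal_ofReal.mul hφ)]
  · refine lintegral_congr fun y => ?_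
    rw [Pi.mul_apply, ← mul_assoc, ← ENNReal.ofReal_mul (inv_nonneg.2 (hg.nonneg _)), div_eq_inv_mul]
  · intro x hx
    by_contra h
    exact hx (by simp [hfz x h])

theorem integrableOn_div_invCompressor (hg : IsPointDensity g c d) (hf : Measurable f)
    (hfi : Integrable f) :
    IntegrableOn (fun y => f (invCompressor g c d y) / g (invCompressor g c d y)) (Ioc 0 1) := by
  have := (hg.integrableOn_Icc_iff hf).1 hfi.integrableOn
  simpa only [div_eq_inv_mul] using this

theorem measure_compand_preimage (hg : IsPointDensity g c d) (hf : Measurable f)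
    (hf0 : ∀ x, 0 ≤ f x) (hfz : ∀ x ∉ Icc c d, f x = 0) (hfi : Integrable f) {N i : ℕ}
    (hi : i < N) :
    (volume.withDensity fun x => ENNReal.ofReal (f x))
        (compand g N ⁻¹' {invCompressor g c d (unitMid N i)})
      = ENNReal.ofReal (∫ y in unitCell N i,
          f (invCompressor g c d y) / g (invCompressor g c d y)) := by
  have hN := Nat.zero_lt_of_lt hi
  have hm : MeasurableSet (compand g N ⁻¹' {invCompressor g c d (unitMid N i)}) :=
    hg.measurable_compand hN (measurableSet_singleton _)
  rw [← lintegral_indicator_one hm, hg.lintegral_withDensity hf hfz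
      (measurable_one.indicator hm),
    ofReal_integral_eq_lintegral_ofReal
      (integrableOn_unitCell hi (hg.integrableOn_div_invCompressor hf hfi))
      (ae_of_all _ fun y => div_nonneg (hf0 _) (hg.nonneg _)),
    ← inter_eq_left.2 (unitCell_subset hi), ← setLIntegral_indicator (measurableSet_unitCell N i)]
  refine setLIntegral_congr_fun measurableSet_Ioc fun y hy => ?_
  obtain ⟨hj, hy'⟩ := mem_unitCell_cellIdx hN hy
  by_cases hyi : y ∈ unitCell N i
  · have hy'' : invCompressor g c d y ∈ compand g N ⁻¹' {invCompressor g c d (unitMid N i)} :=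
      hg.compand_invCompressor hi hyi
    rw [indicator_of_mem hyi, indicator_of_mem hy'', Pi.one_apply, mul_one]
  · rw [indicator_of_notMem hyi, indicator_of_notMem, mul_zero]
    intro h
    rw [mem_preimage, mem_singleton_iff, hg.compand_invCompressor hj hy'] at h
    have h' := congrArg (compressor g) h
    rw [hg.compressor_invCompressor (Ioo_subset_Icc_self (unitMid_mem_Ioo hj)),
      hg.compressor_invCompressor (Ioo_subset_Icc_self (unitMid_mem_Ioo hi))] at h'
    have h1 := unitMid_mem_unitCell (N := N) (i := cellIdx N y) hN
    have h2 := unitMid_mem_unitCell (N := N) (i := i) hN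
    rw [h'] at h1
    have : cellIdx N y = i := (cellIdx_eq hN h1).symm.trans (cellIdx_eq hN h2)
    exact hyi (this ▸ hy')

theorem measure_compand_preimage_eq_zero (hg : IsPointDensity g c d) (hf : Measurable f)
    (hfz : ∀ x ∉ Icc c d, f x = 0) {N : ℕ} (hN : 0 < N) {a : ℝ}
    (ha : ∀ i < N, a ≠ invCompressor g c d (unitMid N i)) :
    (volume.withDensity fun x => ENNReal.ofReal (f x)) (compand g N ⁻¹' {a}) = 0 := by
  have hm : MeasurableSet (compand g N ⁻¹' {a}) :=
    hg.measurable_compand hN (measurableSet_singleton _)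
  rw [← lintegral_indicator_one hm, hg.lintegral_withDensity hf hfz (measurable_one.indicator hm)]
  refine setLIntegral_eq_zero measurableSet_Ioc fun y hy => ?_
  obtain ⟨hj, hy'⟩ := mem_unitCell_cellIdx hN hy
  rw [indicator_of_notMem, mul_zero]
  · rfl
  · intro h
    rw [mem_preimage, mem_singleton_iff, hg.compand_invCompressor hj hy'] at h
    exact ha _ hj h.symm

theorem injOn_invCompressor_unitMid (hg : IsPointDensity g c d) (N : ℕ) :
    InjOn (fun i => invCompressor g c d (unitMid N i)) (Finset.range N) := by
  intro i hi j hj h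
  rw [Finset.coe_range, mem_Iio] at hi hj
  have hN := Nat.zero_lt_of_lt hi
  have h' := congrArg (compressor g) h
  simp only at h'
  rw [hg.compressor_invCompressor (Ioo_subset_Icc_self (unitMid_mem_Ioo hi)),
    hg.compressor_invCompressor (Ioo_subset_Icc_self (unitMid_mem_Ioo hj))] at h'
  have h1 := unitMid_mem_unitCell (N := N) (i := i) hN
  have h2 := unitMid_mem_unitCell (N := N) (i := j) hN
  rw [h'] at h1
  exact (cellIdx_eq hN h1).symm.trans (cellIdx_eq hN h2)

theorem tsum_measure_compand_preimage (hg : IsPointDensity g c d) (hf : Measurable f)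
    (hf0 : ∀ x, 0 ≤ f x) (hfz : ∀ x ∉ Icc c d, f x = 0) (hfi : Integrable f) {N : ℕ}
    (hN : 0 < N) (F : ℝ≥0∞ → ℝ≥0∞) (hF : F 0 = 0) :
    ∑' a : ℝ, F ((volume.withDensity fun x => ENNReal.ofReal (f x)) (compand g N ⁻¹' {a}))
      = ∑ i ∈ Finset.range N, F (ENNReal.ofReal (∫ y in unitCell N i,
          f (invCompressor g c d y) / g (invCompressor g c d y))) := by
  rw [tsum_eq_sum (s := (Finset.range N).image fun i => invCompressor g c d (unitMid N i)),
    Finset.sum_image (hg.injOn_invCompressor_unitMid N)]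
  · refine Finset.sum_congr rfl fun i hi => ?_
    rw [hg.measure_compand_preimage hf hf0 hfz hfi (Finset.mem_range.1 hi)]
  · intro a ha
    rw [hg.measure_compand_preimage_eq_zero hf hfz hN, hF]
    rintro i hi rfl
    exact ha (Finset.mem_image.2 ⟨i, Finset.mem_range.2 hi, rfl⟩)

theorem distortion_compand (hg : IsPointDensity g c d) (hf : Measurable f)
    (hf0 : ∀ x, 0 ≤ f x) (hfz : ∀ x ∉ Icc c d, f x = 0) (hfi : Integrable f) {N : ℕ}
    (hN : 0 < N) {r : ℝ} (hr : 0 ≤ r) :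
    distortion r (volume.withDensity fun x => ENNReal.ofReal (f x)) (compand g N)
      = ENNReal.ofReal (∑ i ∈ Finset.range N, ∫ z in unitCell N i,
          |invCompressor g c d z - invCompressor g c d (unitMid N i)| ^ r
            * (f (invCompressor g c d z) / g (invCompressor g c d z))) := by
  set X := invCompressor g c d with hX
  have hXm : Measurable X := hg.monotone_invCompressor.measurable
  have hq : Measurable (compand g N) := hg.measurable_compand hN
  have hh := hg.integrableOn_div_invCompressor hf hfi
  have hh0 : ∀ y, 0 ≤ f (X y) / g (X y) := fun y => div_nonneg (hf0 _) (hg.nonneg _)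
  have hint : IntegrableOn (fun z => |X z - compand g N (X z)| ^ r * (f (X z) / g (X z)))
      (Ioc 0 1) := by
    refine Integrable.bdd_mul (c := (d - c) ^ r) hh
      (by fun_prop : Measurable fun z => |X z - compand g N (X z)| ^ r).aestronglyMeasurable ?_
    refine ae_of_all _ fun z => ?_
    rw [Real.norm_eq_abs, abs_of_nonneg (by positivity), hg.compand_eq hN]
    have h1 := hg.invCompressor_mem z
    have h2 := hg.invCompressor_mem (uniformQ N (compressor g (X z)))
    refine Real.rpow_le_rpow (abs_nonneg _) (abs_le.2 ⟨?_, ?_⟩) hr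
    · linarith [h1.1, h2.2]
    · linarith [h1.2, h2.1]
  rw [distortion, hg.lintegral_withDensity hf hfz (by fun_prop)]
  have h1 : ∀ y, ENNReal.ofReal (f (X y) / g (X y)) *
      ENNReal.ofReal (|X y - compand g N (X y)| ^ r)
      = ENNReal.ofReal (|X y - compand g N (X y)| ^ r * (f (X y) / g (X y))) := fun y => by
    rw [← ENNReal.ofReal_mul (hh0 y), mul_comm]
  rw [lintegral_congr h1, ← ofReal_integral_eq_lintegral_ofReal hint
    (ae_of_all _ fun y => mul_nonneg (by positivity) (hh0 y)), ← sum_setIntegral_unitCell hN hint]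
  congr 1
  refine Finset.sum_congr rfl fun i hi => ?_
  refine setIntegral_congr_fun (measurableSet_unitCell N i) fun z hz => ?_
  simp only [hX]
  rw [hg.compand_invCompressor (Finset.mem_range.1 hi) hz]

end IsPointDensity

theorem convexOn_rpow_of_nonpos {a : ℝ} (ha : a ≤ 0) :
    ConvexOn ℝ (Ioi (0 : ℝ)) fun t => t ^ a := by
  have h1 : ConvexOn ℝ (Ioi (0 : ℝ)) fun t => a * Real.log t := by
    have := (strictConcaveOn_log_Ioi.concaveOn.smul (neg_nonneg.2 ha)).neg
    refine this.congr fun t _ => ?_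
    simp
  have h2 := (convexOn_exp.subset (subset_univ ((fun t => a * Real.log t) '' Ioi 0))
    (isPreconnected_Ioi.image _ (ContinuousOn.mul continuousOn_const
      (Real.continuousOn_log.mono fun t ht => (ne_of_gt ht)))).ordConnected.convex).comp h1
    (Real.exp_monotone.monotoneOn _)
  refine h2.congr fun t ht => ?_
  rw [Function.comp, Real.rpow_def_of_pos ht, mul_comm]

/-- Riemann sums of `a`-th powers of cell averages converge. -/
theorem tendsto_sum_average_rpow {a : ℝ} (ha1 : a ≠ 1) {h : ℝ → ℝ} (h0 : ∀ y, 0 < h y)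
    (hh : IntegrableOn h (Ioc 0 1)) (hha : IntegrableOn (fun y => h y ^ a) (Ioc 0 1))
    (hneg : a < 0 → ∃ δ > 0, ∀ y, δ ≤ h y) :
    Tendsto (fun N : ℕ => ∑ i ∈ Finset.range N, (N * ∫ z in unitCell N i, h z) ^ a / N) atTop
      (𝓝 (∫ y in Ioc 0 1, h y ^ a)) := by
  rcases lt_trichotomy a 1 with ha | ha | ha
  · rcases lt_or_ge a 0 with ha0 | ha0
    · obtain ⟨δ, hδ, hδh⟩ := hneg ha0
      have hs : Ici δ ⊆ Ioi 0 := fun t ht => lt_of_lt_of_le hδ ht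
      exact tendsto_sum_convexOn_unitCell (φ := fun t => t ^ a) (s := Ici δ) isClosed_Ici
        ((convexOn_rpow_of_nonpos ha0.le).subset hs (convex_Ici δ))
        (fun t ht => (Real.continuousAt_rpow_const _ _ (Or.inl (ne_of_gt (hs ht)))).continuousWithinAt)
        (fun t ht => Real.rpow_nonneg (le_of_lt (hs ht)) _) hh hδh hha
    · have hc : IntegrableOn (fun _ : ℝ => (1 : ℝ)) (Ioc 0 1) := integrableOn_const (by simp)
      have hch : IntegrableOn (fun y => 1 + h y) (Ioc 0 1) := hc.add hh
      have hlim := tendsto_sum_convexOn_unitCell (h := h) (φ := fun t => (1 + t) - t ^ a)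
        (s := Ici 0) isClosed_Ici
        (((convexOn_const 1 (convex_Ici 0)).add (convexOn_id (convex_Ici 0))).sub
          (Real.concaveOn_rpow ha0 ha.le))
        ((Continuous.sub (by fun_prop) (Real.continuous_rpow_const ha0)).continuousOn)
        (fun t ht => ?_) hh (fun y => (h0 y).le) (hch.sub hha)
      · have hI : ∫ y in Ioc 0 1, ((1 + h y) - h y ^ a)
            = (1 + ∫ y in Ioc 0 1, h y) - ∫ y in Ioc 0 1, h y ^ a := by
          rw [integral_sub hch hha, integral_add hc hh]
          simp
        rw [hI] at hlim
        have h2 := (tendsto_const_nhds (x := 1 + ∫ y in Ioc 0 1, h y)).sub hlim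
        rw [sub_sub_cancel] at h2
        refine h2.congr' ?_
        filter_upwards [eventually_gt_atTop 0] with N hN
        have hN' : (N : ℝ) ≠ 0 := by exact_mod_cast hN.ne'
        have h3 : ∑ i ∈ Finset.range N, (1 + N * ∫ z in unitCell N i, h z) / (N : ℝ)
            = 1 + ∫ y in Ioc 0 1, h y := by
          rw [← sum_setIntegral_unitCell hN hh]
          simp_rw [add_div, mul_div_cancel_left₀ _ hN']
          rw [Finset.sum_add_distrib]
          simp [hN']
        simp_rw [sub_div]
        rw [Finset.sum_sub_distrib, h3, sub_sub_cancel]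
      · have ht : 0 ≤ t := ht
        have : t ^ a ≤ 1 + t := by
          rcases le_total t 1 with h1 | h1
          · exact (Real.rpow_le_one ht h1 ha0).trans (by linarith)
          · exact (Real.rpow_le_rpow_of_exponent_le h1 ha.le).trans (by rw [Real.rpow_one]; linarith)
        linarith
  · exact absurd ha ha1
  · exact tendsto_sum_convexOn_unitCell (φ := fun t => t ^ a) isClosed_Ici (convexOn_rpow ha.le)
      (Real.continuous_rpow_const (by linarith)).continuousOn
      (fun t ht => Real.rpow_nonneg ht _) hh (fun y => (h0 y).le) hha

/-- On a cell, averages of nonnegative powers are positively correlated. -/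
theorem average_rpow_mul_average_rpow_le {r κ : ℝ} (hr : 1 ≤ r) (hκ : 0 < κ) {w : ℝ → ℝ}
    (hw0 : ∀ y, 0 ≤ w y) (hw : IntegrableOn w (Ioc 0 1))
    (hwκ : IntegrableOn (fun y => w y ^ κ) (Ioc 0 1))
    (hwrκ : IntegrableOn (fun y => w y ^ (r + κ)) (Ioc 0 1)) {N i : ℕ} (hi : i < N) :
    (N * ∫ z in unitCell N i, w z) ^ r * (N * ∫ z in unitCell N i, w z ^ κ)
      ≤ N * ∫ z in unitCell N i, w z ^ (r + κ) := by
  have hN : (0 : ℝ) < N := by exact_mod_cast Nat.zero_lt_of_lt hi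
  have hrκ : 0 < r + κ := by linarith
  have key : ∀ q : ℝ, 0 ≤ q → q ≤ r + κ → IntegrableOn (fun y => w y ^ q) (Ioc 0 1) →
      N * ∫ z in unitCell N i, w z ^ q
        ≤ (N * ∫ z in unitCell N i, w z ^ (r + κ)) ^ (q / (r + κ)) := by
    intro q hq0 hq hint
    have hq1 : q / (r + κ) ≤ 1 := (div_le_one hrκ).2 hq
    have hq2 : 0 ≤ q / (r + κ) := div_nonneg hq0 hrκ.le
    have hcomp : ∀ z, (w z ^ (r + κ)) ^ (q / (r + κ)) = w z ^ q := fun z => by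
      rw [← Real.rpow_mul (hw0 z), mul_div_cancel₀ _ hrκ.ne']
    have h1 := (Real.concaveOn_rpow hq2 hq1).le_map_set_average
      (μ := volume) (t := unitCell N i) (f := fun z => w z ^ (r + κ))
      (Real.continuous_rpow_const hq2).continuousOn isClosed_Ici
      (by simp [unitCell, div_lt_div_iff_of_pos_right hN])
      (volume_unitCell_ne_top N i)
      (ae_of_all _ fun z => Real.rpow_nonneg (hw0 z) _) (integrableOn_unitCell hi hwrκ)
      (integrableOn_unitCell hi (hint.congr_fun (fun z _ => (hcomp z).symm) measurableSet_Ioc))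
    simp only [hcomp] at h1
    rwa [setAverage_unitCell, setAverage_unitCell] at h1
  set A := N * ∫ z in unitCell N i, w z ^ (r + κ) with hA
  have hA0 : 0 ≤ A := mul_nonneg hN.le
    (setIntegral_nonneg (measurableSet_unitCell N i) fun z _ => Real.rpow_nonneg (hw0 z) _)
  have h1 := key 1 zero_le_one (by linarith) (by simpa using hw)
  simp only [Real.rpow_one] at h1
  have h2 := key κ hκ.le (by linarith) hwκ
  have h0 : 0 ≤ N * ∫ z in unitCell N i, w z := mul_nonneg hN.le
    (setIntegral_nonneg (measurableSet_unitCell N i) fun z _ => hw0 z)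
  calc _ ≤ (A ^ (1 / (r + κ))) ^ r * A ^ (κ / (r + κ)) := by
        refine mul_le_mul (Real.rpow_le_rpow h0 h1 (by linarith)) h2
          (mul_nonneg hN.le (setIntegral_nonneg (measurableSet_unitCell N i)
            fun z _ => Real.rpow_nonneg (hw0 z) _)) (by positivity)
    _ = A := by
        rw [← Real.rpow_mul hA0, ← Real.rpow_add_of_nonneg hA0 (by positivity) (by positivity)]
        have : 1 / (r + κ) * r + κ / (r + κ) = 1 := by field_simp
        rw [this, Real.rpow_one]

namespace IsPointDensity

variable {f g : ℝ → ℝ} {c d : ℝ}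

theorem integrable_inv_invCompressor (hg : IsPointDensity g c d) :
    IntegrableOn (fun y => (g (invCompressor g c d y))⁻¹) (Ioc 0 1) := by
  have := (hg.integrableOn_Icc_iff (measurable_const (a := (1 : ℝ)))).1
    (integrableOn_const (by simp))
  simpa using this

theorem div_invCompressor_pos (hf : IsPointDensity f c d) (hg : IsPointDensity g c d) (y : ℝ) :
    0 < f (invCompressor g c d y) / g (invCompressor g c d y) :=
  div_pos (hf.pos _ (hg.invCompressor_mem y)) (hg.pos _ (hg.invCompressor_mem y))

theorem integral_div_invCompressor_pos (hf : IsPointDensity f c d) (hg : IsPointDensity g c d)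
    {N i : ℕ} (hi : i < N) : 0 < ∫ z in unitCell N i,
      f (invCompressor g c d z) / g (invCompressor g c d z) := by
  have hN : (0 : ℝ) < N := by exact_mod_cast Nat.zero_lt_of_lt hi
  rw [setIntegral_pos_iff_support_of_nonneg_ae
    (ae_of_all _ fun z => (hf.div_invCompressor_pos hg z).le)
    (integrableOn_unitCell hi (hg.integrableOn_div_invCompressor hf.measurable hf.integrable))]
  have : (Function.support fun z => f (invCompressor g c d z) / g (invCompressor g c d z))
      = univ := eq_univ_of_forall fun z => (hf.div_invCompressor_pos hg z).ne'
  rw [this, univ_inter]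
  simp [unitCell, div_lt_div_iff_of_pos_right hN]

/-- Scaled limit of the distortion of companding quantizers, under a domination condition. -/
theorem tendsto_distortion_compand_of_le (hf : IsPointDensity f c d) (hg : IsPointDensity g c d)
    {r : ℝ} (hr : 1 ≤ r) {k : ℝ → ℝ} (hk : IntegrableOn k (Ioc 0 1))
    (hle : ∀ N i : ℕ, i < N → (N * ∫ z in unitCell N i, (g (invCompressor g c d z))⁻¹) ^ r *
      (N * ∫ z in unitCell N i, f (invCompressor g c d z) / g (invCompressor g c d z))
        ≤ N * ∫ z in unitCell N i, k z)
    (hint : IntegrableOn (fun x => (g x)⁻¹ ^ r * f x) (Icc c d)) :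
    Tendsto (fun N : ℕ => ENNReal.ofReal ((N : ℝ) ^ r) *
      distortion r (volume.withDensity fun x => ENNReal.ofReal (f x)) (compand g N)) atTop
      (𝓝 (ENNReal.ofReal (Cr r * ∫ x in Icc c d, (g x)⁻¹ ^ r * f x))) := by
  have hm : Measurable fun x => (g x)⁻¹ ^ r * f x :=
    (hg.measurable.inv.pow_const r).mul hf.measurable
  have heq : ∀ y, (g (invCompressor g c d y))⁻¹ * ((g (invCompressor g c d y))⁻¹ ^ r *
      f (invCompressor g c d y)) = (g (invCompressor g c d y))⁻¹ ^ r *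
        (f (invCompressor g c d y) / g (invCompressor g c d y)) := fun y => by
    rw [div_eq_inv_mul]; ring
  have hwh := (hg.integrableOn_Icc_iff hm).1 hint
  simp only [heq] at hwh
  have hlim := tendsto_sum_rpow_unitCell hr (W := invCompressor g c d)
    hg.monotone_invCompressor.measurable (fun x hx y hy => hg.invCompressor_sub hx hy)
    hg.integrable_inv_invCompressor (fun y => inv_nonneg.2 (hg.nonneg _))
    (hg.integrableOn_div_invCompressor hf.measurable hf.integrable)
    (fun y => (hf.div_invCompressor_pos hg y).le) hk hle hwh
  rw [hg.integral_Icc hm]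
  simp only [heq]
  refine (ENNReal.tendsto_ofReal hlim).congr' ?_
  filter_upwards [eventually_gt_atTop 0] with N hN
  rw [hg.distortion_compand hf.measurable hf.nonneg hf.zero hf.integrable hN (by linarith),
    ENNReal.ofReal_mul (by positivity)]

theorem tendsto_distortion_compand_of_inv_le (hf : IsPointDensity f c d)
    (hg : IsPointDensity g c d) {r : ℝ} (hr : 1 ≤ r) {M : ℝ} (hM : ∀ x ∈ Icc c d, (g x)⁻¹ ≤ M) :
    Tendsto (fun N : ℕ => ENNReal.ofReal ((N : ℝ) ^ r) *
      distortion r (volume.withDensity fun x => ENNReal.ofReal (f x)) (compand g N)) atTop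
      (𝓝 (ENNReal.ofReal (Cr r * ∫ x in Icc c d, (g x)⁻¹ ^ r * f x))) := by
  have hh := hg.integrableOn_div_invCompressor hf.measurable hf.integrable
  have hginv : ∀ x, 0 ≤ (g x)⁻¹ := fun x => inv_nonneg.2 (hg.nonneg x)
  refine hf.tendsto_distortion_compand_of_le hg hr (hh.const_mul (M ^ r)) (fun N i hi => ?_) ?_
  · have hN : (0 : ℝ) < N := by exact_mod_cast Nat.zero_lt_of_lt hi
    have h1 : N * ∫ z in unitCell N i, (g (invCompressor g c d z))⁻¹ ≤ M := by
      have := setIntegral_mono_on (integrableOn_unitCell hi hg.integrable_inv_invCompressor)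
        (integrableOn_const (volume_unitCell_ne_top N i)) (measurableSet_unitCell N i)
        fun z _ => hM _ (hg.invCompressor_mem z)
      rw [setIntegral_const, volume_real_unitCell, smul_eq_mul] at this
      calc _ ≤ (N : ℝ) * (1 / N * M) := mul_le_mul_of_nonneg_left (by simpa using this) hN.le
        _ = M := by field_simp
    rw [integral_const_mul]
    calc _ ≤ M ^ r * (N * ∫ z in unitCell N i, f (invCompressor g c d z) /
          g (invCompressor g c d z)) := by
          refine mul_le_mul_of_nonneg_right (Real.rpow_le_rpow ?_ h1 (by linarith)) ?_
          · exact mul_nonneg hN.le (setIntegral_nonneg (measurableSet_unitCell N i)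
              fun z _ => hginv _)
          · exact mul_nonneg hN.le (setIntegral_nonneg (measurableSet_unitCell N i)
              fun z _ => (hf.div_invCompressor_pos hg z).le)
      _ = _ := by ring
  · refine Integrable.bdd_mul (c := M ^ r) hf.integrable.integrableOn
      (hg.measurable.inv.pow_const r).aestronglyMeasurable ?_
    refine (ae_restrict_iff' measurableSet_Icc).2 (ae_of_all _ fun x hx => ?_)
    rw [Real.norm_eq_abs, abs_of_nonneg (Real.rpow_nonneg (hginv x) _)]
    exact Real.rpow_le_rpow (hginv x) (hM x hx) (by linarith)

theorem tendsto_distortion_compand_of_eq_rpow (hf : IsPointDensity f c d)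
    (hg : IsPointDensity g c d) {r κ C : ℝ} (hr : 1 ≤ r) (hκ : 0 < κ) (hC : 0 < C)
    (hfg : ∀ x ∈ Icc c d, f x / g x = C * (g x)⁻¹ ^ κ)
    (hint : IntegrableOn (fun x => (g x)⁻¹ ^ r * f x) (Icc c d)) :
    Tendsto (fun N : ℕ => ENNReal.ofReal ((N : ℝ) ^ r) *
      distortion r (volume.withDensity fun x => ENNReal.ofReal (f x)) (compand g N)) atTop
      (𝓝 (ENNReal.ofReal (Cr r * ∫ x in Icc c d, (g x)⁻¹ ^ r * f x))) := by
  have hpos : ∀ y, 0 < (g (invCompressor g c d y))⁻¹ := fun y =>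
    inv_pos.2 (hg.pos _ (hg.invCompressor_mem y))
  have hfg' : ∀ y, f (invCompressor g c d y) / g (invCompressor g c d y)
      = C * (g (invCompressor g c d y))⁻¹ ^ κ := fun y => hfg _ (hg.invCompressor_mem y)
  have hh := hg.integrableOn_div_invCompressor hf.measurable hf.integrable
  simp only [hfg'] at hh
  have hwκ : IntegrableOn (fun y => (g (invCompressor g c d y))⁻¹ ^ κ) (Ioc 0 1) := by
    simpa [IntegrableOn, hC.ne'] using hh.const_mul C⁻¹
  have hwh := (hg.integrableOn_Icc_iff
    ((hg.measurable.inv.pow_const r).mul hf.measurable)).1 hint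
  have heq : ∀ y, (g (invCompressor g c d y))⁻¹ * ((g (invCompressor g c d y))⁻¹ ^ r *
      f (invCompressor g c d y)) = C * (g (invCompressor g c d y))⁻¹ ^ (r + κ) := fun y => by
    have := hfg' y
    rw [div_eq_inv_mul] at this
    rw [Real.rpow_add (hpos y)]
    linear_combination (g (invCompressor g c d y))⁻¹ ^ r * this
  simp only [Pi.mul_apply, Pi.inv_apply, heq] at hwh
  refine hf.tendsto_distortion_compand_of_le hg hr hwh (fun N i hi => ?_) hint
  have hwrκ : IntegrableOn (fun y => (g (invCompressor g c d y))⁻¹ ^ (r + κ)) (Ioc 0 1) := by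
    simpa [IntegrableOn, hC.ne'] using hwh.const_mul C⁻¹
  have := average_rpow_mul_average_rpow_le hr hκ (fun y => (hpos y).le)
    hg.integrable_inv_invCompressor hwκ hwrκ hi
  simp only [hfg']
  rw [integral_const_mul, integral_const_mul, mul_left_comm (N : ℝ) C, mul_left_comm (N : ℝ) C,
    mul_left_comm _ C]
  exact mul_le_mul_of_nonneg_left this hC.le

/-- The Rényi entropy of a companding quantizer, of real order different from one. -/
theorem renyiEntropy_compand (hf : IsPointDensity f c d) (hg : IsPointDensity g c d) {a : ℝ}
    (ha : a ≠ 1) {N : ℕ} (hN : 0 < N) :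
    renyiEntropy a (volume.withDensity fun x => ENNReal.ofReal (f x)) (compand g N)
      = (((1 - a)⁻¹ * Real.log (∑ i ∈ Finset.range N, (∫ z in unitCell N i,
          f (invCompressor g c d z) / g (invCompressor g c d z)) ^ a) : ℝ) : EReal) := by
  have hp : ∀ i ∈ Finset.range N, 0 < ∫ z in unitCell N i,
      f (invCompressor g c d z) / g (invCompressor g c d z) := fun i hi =>
    hf.integral_div_invCompressor_pos hg (Finset.mem_range.1 hi)
  have hS : 0 < ∑ i ∈ Finset.range N, (∫ z in unitCell N i,
      f (invCompressor g c d z) / g (invCompressor g c d z)) ^ a :=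
    Finset.sum_pos (fun i hi => Real.rpow_pos_of_pos (hp i hi) a)
      (Finset.nonempty_range_iff.2 hN.ne')
  rw [renyiEntropy, if_neg (EReal.coe_ne_top a), if_neg (EReal.coe_ne_bot a),
    if_neg (by exact_mod_cast ha), EReal.toReal_coe,
    hg.tsum_measure_compand_preimage hf.measurable hf.nonneg hf.zero hf.integrable hN
      (fun x => if 0 < x then x ^ a else 0) (by simp), EReal.coe_mul,
    ← ENNReal.log_ofReal_of_pos hS, ENNReal.ofReal_sum_of_nonneg
      fun i hi => (Real.rpow_pos_of_pos (hp i hi) a).le]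
  congr 2
  refine Finset.sum_congr rfl fun i hi => ?_
  rw [if_pos (ENNReal.ofReal_pos.2 (hp i hi)), ENNReal.ofReal_rpow_of_pos (hp i hi)]

end IsPointDensity

theorem tendsto_exp_mul_of_tendsto {r : ℝ} {H : ℕ → EReal} {D : ℕ → ℝ≥0∞} {E : ℕ → ℝ} {e L : ℝ}
    (he : 0 ≤ e)
    (hH : ∀ᶠ N : ℕ in atTop, EReal.exp (r * H N) = ENNReal.ofReal ((N : ℝ) ^ r * E N))
    (hE : Tendsto E atTop (𝓝 e))
    (hD : Tendsto (fun N : ℕ => ENNReal.ofReal ((N : ℝ) ^ r) * D N) atTop (𝓝 (ENNReal.ofReal L))) :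
    Tendsto (fun N => EReal.exp (r * H N) * D N) atTop (𝓝 (ENNReal.ofReal (e * L))) := by
  have h := ENNReal.Tendsto.mul (ENNReal.tendsto_ofReal hE) (Or.inr ENNReal.ofReal_ne_top) hD
    (Or.inr ENNReal.ofReal_ne_top)
  rw [← ENNReal.ofReal_mul he] at h
  refine h.congr' ?_
  filter_upwards [hH] with N hN
  rw [hN, ENNReal.ofReal_mul (by positivity)]
  ring

namespace IsPointDensity

variable {f g : ℝ → ℝ} {c d : ℝ}

/-- Asymptotic performance of companding at a real order different from one, given the asymptotics
of the distortion. -/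
theorem tendsto_exp_renyiEntropy_mul_distortion (hf : IsPointDensity f c d)
    (hg : IsPointDensity g c d) {r a L : ℝ} (ha : a ≠ 1)
    (hha : IntegrableOn (fun x => g x * (f x / g x) ^ a) (Icc c d))
    (hneg : a < 0 → ∃ δ > 0, ∀ x ∈ Icc c d, δ ≤ f x / g x)
    (hD : Tendsto (fun N : ℕ => ENNReal.ofReal ((N : ℝ) ^ r) *
      distortion r (volume.withDensity fun x => ENNReal.ofReal (f x)) (compand g N)) atTop
      (𝓝 (ENNReal.ofReal L))) :
    Tendsto (fun N : ℕ =>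
      EReal.exp (r * renyiEntropy a (volume.withDensity fun x => ENNReal.ofReal (f x))
        (compand g N)) *
      distortion r (volume.withDensity fun x => ENNReal.ofReal (f x)) (compand g N)) atTop
      (𝓝 (ENNReal.ofReal ((∫ x in Icc c d, g x * (f x / g x) ^ a) ^ (r / (1 - a)) * L))) := by
  have hm : Measurable fun x => g x * (f x / g x) ^ a :=
    hg.measurable.mul ((hf.measurable.div hg.measurable).pow_const a)
  have heq : ∀ y, (g (invCompressor g c d y))⁻¹ * (g (invCompressor g c d y) *
      (f (invCompressor g c d y) / g (invCompressor g c d y)) ^ a)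
      = (f (invCompressor g c d y) / g (invCompressor g c d y)) ^ a := fun y =>
    inv_mul_cancel_left₀ (hg.pos _ (hg.invCompressor_mem y)).ne' _
  have hha' := (hg.integrableOn_Icc_iff hm).1 hha
  simp only [heq] at hha'
  have h0 : ∀ y, 0 < f (invCompressor g c d y) / g (invCompressor g c d y) :=
    hf.div_invCompressor_pos hg
  have hlim := tendsto_sum_average_rpow ha h0
    (hg.integrableOn_div_invCompressor hf.measurable hf.integrable) hha' (fun h => by
      obtain ⟨δ, hδ, hδ'⟩ := hneg h
      exact ⟨δ, hδ, fun y => hδ' _ (hg.invCompressor_mem y)⟩)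
  rw [hg.integral_Icc hm]
  simp only [heq]
  have hpos : 0 < ∫ y in Ioc 0 1, (f (invCompressor g c d y) / g (invCompressor g c d y)) ^ a := by
    rw [setIntegral_pos_iff_support_of_nonneg_ae
      (ae_of_all _ fun z => (Real.rpow_pos_of_pos (h0 z) a).le) hha']
    have : (Function.support fun z =>
        (f (invCompressor g c d z) / g (invCompressor g c d z)) ^ a) = univ :=
      eq_univ_of_forall fun z => (Real.rpow_pos_of_pos (h0 z) a).ne'
    rw [this, univ_inter]
    simp
  refine tendsto_exp_mul_of_tendsto (Real.rpow_nonneg hpos.le _) ?_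
    (hlim.rpow_const (p := r / (1 - a)) (Or.inl hpos.ne')) hD
  filter_upwards [eventually_gt_atTop 0] with N hN
  have hN' : (0 : ℝ) < N := by exact_mod_cast hN
  have h1a : 1 - a ≠ 0 := sub_ne_zero.2 ha.symm
  have hp : ∀ i ∈ Finset.range N, 0 < ∫ z in unitCell N i,
      f (invCompressor g c d z) / g (invCompressor g c d z) := fun i hi =>
    hf.integral_div_invCompressor_pos hg (Finset.mem_range.1 hi)
  have hS : 0 < ∑ i ∈ Finset.range N, (∫ z in unitCell N i,
      f (invCompressor g c d z) / g (invCompressor g c d z)) ^ a :=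
    Finset.sum_pos (fun i hi => Real.rpow_pos_of_pos (hp i hi) a)
      (Finset.nonempty_range_iff.2 hN.ne')
  have hsum : ∑ i ∈ Finset.range N, (N * ∫ z in unitCell N i,
      f (invCompressor g c d z) / g (invCompressor g c d z)) ^ a / N
      = (N : ℝ) ^ (a - 1) * ∑ i ∈ Finset.range N, (∫ z in unitCell N i,
        f (invCompressor g c d z) / g (invCompressor g c d z)) ^ a := by
    rw [Finset.mul_sum]
    refine Finset.sum_congr rfl fun i hi => ?_
    rw [Real.mul_rpow hN'.le (hp i hi).le, Real.rpow_sub_one hN'.ne']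
    ring
  rw [hf.renyiEntropy_compand hg ha hN, ← EReal.coe_mul, EReal.exp_coe, hsum,
    Real.mul_rpow (by positivity) hS.le, ← Real.rpow_mul hN'.le,
    ← mul_assoc ((N : ℝ) ^ r), ← Real.rpow_add hN']
  have : r + (a - 1) * (r / (1 - a)) = 0 := by field_simp; ring
  rw [this, Real.rpow_zero, one_mul, Real.rpow_def_of_pos hS]
  congr 2
  ring

theorem integrableOn_rpow_of_le_one (hf : IsPointDensity f c d) {ε q : ℝ} (hε : 0 < ε)
    (hfε : ∀ x ∈ Icc c d, ε ≤ f x) (hq : q ≤ 1) : IntegrableOn (fun x => f x ^ q) (Icc c d) := by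
  refine Integrable.mono' (hf.integrable.integrableOn.const_mul (ε ^ (q - 1)))
    (hf.measurable.pow_const q).aestronglyMeasurable ?_
  refine (ae_restrict_iff' measurableSet_Icc).2 (ae_of_all _ fun x hx => ?_)
  have h0 := hf.pos x hx
  rw [Real.norm_eq_abs, abs_of_pos (Real.rpow_pos_of_pos h0 q)]
  calc f x ^ q = f x ^ (q - 1) * f x := by rw [Real.rpow_sub_one h0.ne']; field_simp
    _ ≤ _ := mul_le_mul_of_nonneg_right
      (Real.rpow_le_rpow_of_nonpos hε (hfε x hx) (by linarith)) h0.le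

theorem integral_rpow_pos (hf : IsPointDensity f c d) {q : ℝ}
    (hq : IntegrableOn (fun x => f x ^ q) (Icc c d)) : 0 < ∫ x in Icc c d, f x ^ q := by
  rw [setIntegral_pos_iff_support_of_nonneg_ae
    (ae_of_all _ fun x => Real.rpow_nonneg (hf.nonneg x) q) hq]
  have : Icc c d ⊆ Function.support fun x => f x ^ q := fun x hx =>
    (Real.rpow_pos_of_pos (hf.pos x hx) q).ne'
  rw [inter_eq_right.2 this]
  simpa using hf.lt

/-- The normalized power of a density is a point density. -/
theorem normalized_rpow (hf : IsPointDensity f c d) {p : ℝ} (hp0 : p ≠ 0)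
    (hp : IntegrableOn (fun x => f x ^ p) (Icc c d)) :
    IsPointDensity (fun x => (∫ y in Icc c d, f y ^ p)⁻¹ * f x ^ p) c d where
  lt := hf.lt
  measurable := (hf.measurable.pow_const p).const_mul _
  pos x hx := mul_pos (inv_pos.2 (hf.integral_rpow_pos hp)) (Real.rpow_pos_of_pos (hf.pos x hx) p)
  zero x hx := by simp [hf.zero x hx, Real.zero_rpow hp0]
  integral_eq_one := by
    have h : ∫ x in Icc c d, f x ^ p = ∫ x, f x ^ p :=
      setIntegral_eq_integral_of_forall_compl_eq_zero fun x hx => by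
        rw [hf.zero x hx, Real.zero_rpow hp0]
    rw [integral_const_mul, ← h, inv_mul_cancel₀ (hf.integral_rpow_pos hp).ne']

theorem tendsto_performance_of_ne_one (hf : IsPointDensity f c d) {ε r a : ℝ} (hε : 0 < ε)
    (hfε : ∀ x ∈ Icc c d, ε ≤ f x) (hr : 1 ≤ r) (ha : a ≠ 1) (har : a < 1 + r)
    (hint : 1 < a → IntegrableOn (fun x => f x ^ a1 a r) (Icc c d)) :
    Tendsto (fun N : ℕ =>
      EReal.exp (r * renyiEntropy a (volume.withDensity fun x => ENNReal.ofReal (f x))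
        (compand (fun x => (∫ y in Icc c d, f y ^ (1 / a2 a r))⁻¹ * f x ^ (1 / a2 a r)) N)) *
      distortion r (volume.withDensity fun x => ENNReal.ofReal (f x))
        (compand (fun x => (∫ y in Icc c d, f y ^ (1 / a2 a r))⁻¹ * f x ^ (1 / a2 a r)) N)) atTop
      (𝓝 (ENNReal.ofReal (Cr r * (∫ x in Icc c d, f x ^ a1 a r) ^ a2 a r))) := by
  have h1a : 1 - a ≠ 0 := sub_ne_zero.2 ha.symm
  have hden : 0 < 1 - a + r := by linarith
  set p := 1 / a2 a r with hp
  have hpe : p = (1 - a) / (1 - a + r) := by rw [hp, a2, one_div_div]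
  have hp0 : p ≠ 0 := by rw [hpe]; exact div_ne_zero h1a hden.ne'
  have hp1 : p < 1 := by rw [hpe, div_lt_one hden]; linarith
  have ha1 : 1 - p * r = a1 a r := by rw [hpe, a1]; field_simp; ring
  have ha1' : p * (1 - a) + a = a1 a r := by rw [hpe, a1]; field_simp; ring
  have hpos : a < 1 → 0 < p := fun h => by rw [hpe]; exact div_pos (by linarith) hden
  have hneg : 1 < a → p < 0 := fun h => by
    rw [hpe]; exact div_neg_of_neg_of_pos (by linarith) hden
  have hpint := hf.integrableOn_rpow_of_le_one hε hfε hp1.le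
  have hAint : IntegrableOn (fun x => f x ^ a1 a r) (Icc c d) := by
    rcases lt_or_gt_of_ne ha with h | h
    · refine hf.integrableOn_rpow_of_le_one hε hfε ?_
      have := mul_pos (hpos h) (by linarith : 0 < r)
      linarith
    · exact hint h
  have hK := hf.integral_rpow_pos hpint
  have hA := hf.integral_rpow_pos hAint
  have hg := hf.normalized_rpow hp0 hpint
  set K := ∫ y in Icc c d, f y ^ p with hKdef
  set A := ∫ y in Icc c d, f y ^ a1 a r with hAdef
  have hinv : ∀ x ∈ Icc c d, (K⁻¹ * f x ^ p)⁻¹ = K * f x ^ (-p) := fun x hx => by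
    rw [mul_inv, inv_inv, Real.rpow_neg (hf.nonneg x)]
  have hdiv : ∀ x ∈ Icc c d, f x / (K⁻¹ * f x ^ p) = K * f x ^ (1 - p) := fun x hx => by
    rw [div_eq_mul_inv, hinv x hx, sub_eq_add_neg, Real.rpow_add (hf.pos x hx), Real.rpow_one]
    ring
  have hdist : ∀ x ∈ Icc c d, (K⁻¹ * f x ^ p)⁻¹ ^ r * f x = K ^ r * f x ^ a1 a r := fun x hx => by
    have h0 := hf.pos x hx
    rw [hinv x hx, Real.mul_rpow hK.le (by positivity), ← Real.rpow_mul h0.le, ← ha1,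
      sub_eq_neg_add, Real.rpow_add h0, Real.rpow_one, neg_mul, mul_assoc]
  have hent : ∀ x ∈ Icc c d, (K⁻¹ * f x ^ p) * (f x / (K⁻¹ * f x ^ p)) ^ a
      = K ^ (a - 1) * f x ^ a1 a r := fun x hx => by
    have h0 := hf.pos x hx
    rw [hdiv x hx, Real.mul_rpow hK.le (by positivity), ← Real.rpow_mul h0.le,
      Real.rpow_sub_one hK.ne']
    have : a1 a r = p + (1 - p) * a := by rw [← ha1']; ring
    rw [this, Real.rpow_add h0]
    ring
  have hdistint : IntegrableOn (fun x => (K⁻¹ * f x ^ p)⁻¹ ^ r * f x) (Icc c d) :=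
    IntegrableOn.congr_fun (hAint.const_mul (K ^ r)) (fun x hx => (hdist x hx).symm)
      measurableSet_Icc
  have hentint : IntegrableOn (fun x => (K⁻¹ * f x ^ p) * (f x / (K⁻¹ * f x ^ p)) ^ a)
      (Icc c d) :=
    IntegrableOn.congr_fun (hAint.const_mul (K ^ (a - 1))) (fun x hx => (hent x hx).symm)
      measurableSet_Icc
  have hD : Tendsto (fun N : ℕ => ENNReal.ofReal ((N : ℝ) ^ r) *
      distortion r (volume.withDensity fun x => ENNReal.ofReal (f x))
        (compand (fun x => K⁻¹ * f x ^ p) N)) atTop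
      (𝓝 (ENNReal.ofReal (Cr r * ∫ x in Icc c d, (K⁻¹ * f x ^ p)⁻¹ ^ r * f x))) := by
    rcases lt_or_gt_of_ne ha with h | h
    · refine hf.tendsto_distortion_compand_of_inv_le hg hr (M := K * ε ^ (-p)) fun x hx => ?_
      rw [hinv x hx]
      exact mul_le_mul_of_nonneg_left (Real.rpow_le_rpow_of_nonpos hε (hfε x hx)
        (by linarith [hpos h])) hK.le
    · have hp' := hneg h
      refine hf.tendsto_distortion_compand_of_eq_rpow hg hr (κ := (1 - p) / (-p))
        (C := K ^ (1 - (1 - p) / (-p))) (div_pos (by linarith) (by linarith)) (by positivity)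
        (fun x hx => ?_) hdistint
      have h0 := hf.pos x hx
      rw [hdiv x hx, hinv x hx, Real.mul_rpow hK.le (by positivity), ← Real.rpow_mul h0.le,
        ← mul_assoc, ← Real.rpow_add hK, sub_add_cancel, Real.rpow_one,
        mul_div_cancel₀ _ (neg_ne_zero.2 hp0)]
  have hfinal := hf.tendsto_exp_renyiEntropy_mul_distortion hg ha hentint (fun h => by
    refine ⟨K * ε ^ (1 - p), by positivity, fun x hx => ?_⟩
    rw [hdiv x hx]
    exact mul_le_mul_of_nonneg_left (Real.rpow_le_rpow hε.le (hfε x hx) (by linarith)) hK.le) hD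
  rw [setIntegral_congr_fun measurableSet_Icc hent, setIntegral_congr_fun measurableSet_Icc hdist,
    integral_const_mul, integral_const_mul, ← hAdef] at hfinal
  convert hfinal using 3
  rw [Real.mul_rpow (by positivity) hA.le, ← Real.rpow_mul hK.le]
  have e1 : (a - 1) * (r / (1 - a)) = -r := by field_simp; ring
  have e2 : a2 a r = r / (1 - a) + 1 := by rw [a2]; field_simp; ring
  rw [e1, e2, Real.rpow_add hA, Real.rpow_one, Real.rpow_neg hK.le]
  field_simp

end IsPointDensity

/-- Riemann sums of `t log t` of cell averages converge. -/
theorem tendsto_sum_average_mul_log {h : ℝ → ℝ} (h0 : ∀ y, 0 ≤ h y)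
    (hh : IntegrableOn h (Ioc 0 1)) (hhl : IntegrableOn (fun y => h y * Real.log (h y)) (Ioc 0 1)) :
    Tendsto (fun N : ℕ => ∑ i ∈ Finset.range N, (N * ∫ z in unitCell N i, h z) *
      Real.log (N * ∫ z in unitCell N i, h z) / N) atTop
      (𝓝 (∫ y in Ioc 0 1, h y * Real.log (h y))) := by
  have hc : IntegrableOn (fun _ : ℝ => (1 : ℝ)) (Ioc 0 1) := integrableOn_const (by simp)
  have hlim := tendsto_sum_convexOn_unitCell (h := h) (φ := fun t => t * Real.log t + 1)
    (s := Ici 0) isClosed_Ici (Real.convexOn_mul_log.add (convexOn_const 1 (convex_Ici 0)))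
    (Real.continuous_mul_log.add continuous_const).continuousOn (fun t ht => ?_) hh h0 (hhl.add hc)
  · have hI : ∫ y in Ioc 0 1, (h y * Real.log (h y) + 1)
        = (∫ y in Ioc 0 1, h y * Real.log (h y)) + 1 := by
      rw [integral_add hhl hc]
      simp
    rw [hI] at hlim
    have h2 := hlim.sub_const 1
    rw [add_sub_cancel_right] at h2
    refine h2.congr' ?_
    filter_upwards [eventually_gt_atTop 0] with N hN
    have hN' : (N : ℝ) ≠ 0 := by exact_mod_cast hN.ne'
    simp_rw [add_div]
    rw [Finset.sum_add_distrib]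
    simp [hN']
  · rcases (mem_Ici.1 ht).eq_or_lt with h | h
    · simp [← h]
    · have h1 := Real.one_sub_inv_le_log_of_pos h
      have h2 := mul_le_mul_of_nonneg_left h1 h.le
      rw [mul_sub, mul_inv_cancel₀ h.ne'] at h2
      linarith

namespace IsPointDensity

variable {f g : ℝ → ℝ} {c d : ℝ}

/-- The uniform density is a point density. -/
theorem uniform (hcd : c < d) :
    IsPointDensity ((Icc c d).indicator fun _ => (d - c)⁻¹) c d where
  lt := hcd
  measurable := measurable_const.indicator measurableSet_Icc
  pos x hx := by
    rw [indicator_of_mem hx]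
    exact inv_pos.2 (sub_pos.2 hcd)
  zero x hx := indicator_of_notMem hx _
  integral_eq_one := by
    rw [integral_indicator measurableSet_Icc, setIntegral_const, Real.volume_real_Icc_of_le hcd.le,
      smul_eq_mul, mul_inv_cancel₀ (sub_pos.2 hcd).ne']

theorem setIntegral_Icc_eq_one (hf : IsPointDensity f c d) : ∫ x in Icc c d, f x = 1 := by
  rw [setIntegral_eq_integral_of_forall_compl_eq_zero hf.zero, hf.integral_eq_one]

theorem integral_div_invCompressor_eq_one (hf : IsPointDensity f c d) (hg : IsPointDensity g c d) :
    ∫ y in Ioc 0 1, f (invCompressor g c d y) / g (invCompressor g c d y) = 1 := by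
  have h := hg.integral_Icc hf.measurable
  rw [hf.setIntegral_Icc_eq_one] at h
  simp only [div_eq_inv_mul, ← h]

/-- The Shannon entropy of a companding quantizer. -/
theorem renyiEntropy_one_compand (hf : IsPointDensity f c d) (hg : IsPointDensity g c d) {N : ℕ}
    (hN : 0 < N) :
    renyiEntropy 1 (volume.withDensity fun x => ENNReal.ofReal (f x)) (compand g N)
      = ((-∑ i ∈ Finset.range N, (∫ z in unitCell N i,
          f (invCompressor g c d z) / g (invCompressor g c d z)) *
        Real.log (∫ z in unitCell N i,
          f (invCompressor g c d z) / g (invCompressor g c d z)) : ℝ) : EReal) := by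
  have hp : ∀ i ∈ Finset.range N, 0 < ∫ z in unitCell N i,
      f (invCompressor g c d z) / g (invCompressor g c d z) := fun i hi =>
    hf.integral_div_invCompressor_pos hg (Finset.mem_range.1 hi)
  have hh := hg.integrableOn_div_invCompressor hf.measurable hf.integrable
  have hsum : ∑ i ∈ Finset.range N, ∫ z in unitCell N i,
      f (invCompressor g c d z) / g (invCompressor g c d z) = 1 := by
    rw [sum_setIntegral_unitCell hN hh, hf.integral_div_invCompressor_eq_one hg]
  have hle : ∀ i ∈ Finset.range N, ∫ z in unitCell N i,
      f (invCompressor g c d z) / g (invCompressor g c d z) ≤ 1 := fun i hi => by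
    rw [← hsum]
    exact Finset.single_le_sum (f := fun i => ∫ z in unitCell N i,
      f (invCompressor g c d z) / g (invCompressor g c d z)) (fun j hj => (hp j hj).le) hi
  have hnn : ∀ i ∈ Finset.range N, 0 ≤ -((∫ z in unitCell N i,
      f (invCompressor g c d z) / g (invCompressor g c d z)) * Real.log (∫ z in unitCell N i,
      f (invCompressor g c d z) / g (invCompressor g c d z))) := fun i hi =>
    neg_nonneg.2 (mul_nonpos_of_nonneg_of_nonpos (hp i hi).le
      (Real.log_nonpos (hp i hi).le (hle i hi)))
  have h1t : (1 : EReal) ≠ ⊤ := EReal.coe_ne_top 1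
  have h1b : (1 : EReal) ≠ ⊥ := EReal.coe_ne_bot 1
  rw [renyiEntropy, if_neg h1t, if_neg h1b, if_pos rfl,
    hg.tsum_measure_compand_preimage hf.measurable hf.nonneg hf.zero hf.integrable hN
      (fun x => ENNReal.ofReal (-(x.toReal * Real.log x.toReal))) (by simp),
    ← Finset.sum_neg_distrib, ← max_eq_left (Finset.sum_nonneg hnn), ← EReal.coe_ennreal_ofReal,
    ENNReal.ofReal_sum_of_nonneg hnn]
  congr 1
  refine Finset.sum_congr rfl fun i hi => ?_
  rw [ENNReal.toReal_ofReal (hp i hi).le]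

theorem tendsto_performance_one (hf : IsPointDensity f c d) {r : ℝ} (hr : 1 ≤ r)
    (hint : Integrable fun x => f x * Real.log (f x)) :
    Tendsto (fun N : ℕ =>
      EReal.exp (r * renyiEntropy 1 (volume.withDensity fun x => ENNReal.ofReal (f x))
        (compand ((Icc c d).indicator fun _ => (d - c)⁻¹) N)) *
      distortion r (volume.withDensity fun x => ENNReal.ofReal (f x))
        (compand ((Icc c d).indicator fun _ => (d - c)⁻¹) N)) atTop
      (𝓝 (ENNReal.ofReal (Cr r * Real.exp (-r * ∫ x, f x * Real.log (f x))))) := by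
  have hdc : 0 < d - c := sub_pos.2 hf.lt
  have hg := uniform hf.lt
  set g := (Icc c d).indicator fun _ => (d - c)⁻¹ with hgdef
  have hgx : ∀ x ∈ Icc c d, g x = (d - c)⁻¹ := fun x hx => indicator_of_mem hx _
  have hgX : ∀ y, g (invCompressor g c d y) = (d - c)⁻¹ := fun y => hgx _ (hg.invCompressor_mem y)
  have hh := hg.integrableOn_div_invCompressor hf.measurable hf.integrable
  have h0 := hf.div_invCompressor_pos hg
  have hm : Measurable fun x => f x * Real.log (f x) :=
    hf.measurable.mul hf.measurable.log
  have heq : ∀ y, f (invCompressor g c d y) / g (invCompressor g c d y) *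
      Real.log (f (invCompressor g c d y) / g (invCompressor g c d y))
      = (g (invCompressor g c d y))⁻¹ * (f (invCompressor g c d y) *
          Real.log (f (invCompressor g c d y)))
        + Real.log (d - c) * (f (invCompressor g c d y) / g (invCompressor g c d y)) := fun y => by
    rw [hgX, div_inv_eq_mul, inv_inv, Real.log_mul (hf.pos _ (hg.invCompressor_mem y)).ne' hdc.ne']
    ring
  have hI1 := (hg.integrableOn_Icc_iff hm).1 hint.integrableOn
  have hhint := hf.integral_div_invCompressor_eq_one hg
  have hlogint : IntegrableOn (fun y => f (invCompressor g c d y) / g (invCompressor g c d y) *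
      Real.log (f (invCompressor g c d y) / g (invCompressor g c d y))) (Ioc 0 1) := by
    simp only [heq]
    exact Integrable.add hI1 (hh.const_mul _)
  have hval : ∫ y in Ioc 0 1, f (invCompressor g c d y) / g (invCompressor g c d y) *
      Real.log (f (invCompressor g c d y) / g (invCompressor g c d y))
      = (∫ x, f x * Real.log (f x)) + Real.log (d - c) := by
    simp only [heq]
    rw [integral_add hI1 (hh.const_mul _), ← hg.integral_Icc hm, integral_const_mul, hhint, mul_one,
      setIntegral_eq_integral_of_forall_compl_eq_zero]
    intro x hx
    rw [hf.zero x hx, zero_mul]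
  have hlim := tendsto_sum_average_mul_log (fun y => (h0 y).le) hh hlogint
  rw [hval] at hlim
  have hD := hf.tendsto_distortion_compand_of_inv_le hg hr (M := d - c)
    fun x hx => by rw [hgx x hx, inv_inv]
  have hDval : ∫ x in Icc c d, (g x)⁻¹ ^ r * f x = (d - c) ^ r := by
    rw [setIntegral_congr_fun (g := fun x => (d - c) ^ r * f x) measurableSet_Icc
      fun x hx => by simp only [hgx x hx, inv_inv], integral_const_mul, hf.setIntegral_Icc_eq_one,
      mul_one]
  rw [hDval] at hD
  have hfinal := tendsto_exp_mul_of_tendsto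
    (H := fun N => renyiEntropy 1 (volume.withDensity fun x => ENNReal.ofReal (f x)) (compand g N))
    (Real.exp_nonneg _) ?_ ((Real.continuous_exp.tendsto _).comp (hlim.const_mul (-r))) hD
  · convert hfinal using 3
    rw [mul_add, Real.exp_add, Real.rpow_def_of_pos hdc, mul_left_comm, mul_assoc, ← Real.exp_add]
    have : -r * Real.log (d - c) + Real.log (d - c) * r = 0 := by ring
    rw [this, Real.exp_zero, mul_one]
  · filter_upwards [eventually_gt_atTop 0] with N hN
    have hN' : (0 : ℝ) < N := by exact_mod_cast hN
    have hp : ∀ i ∈ Finset.range N, 0 < ∫ z in unitCell N i,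
        f (invCompressor g c d z) / g (invCompressor g c d z) := fun i hi =>
      hf.integral_div_invCompressor_pos hg (Finset.mem_range.1 hi)
    have hsum : ∑ i ∈ Finset.range N, (N * ∫ z in unitCell N i,
        f (invCompressor g c d z) / g (invCompressor g c d z)) * Real.log (N * ∫ z in unitCell N i,
        f (invCompressor g c d z) / g (invCompressor g c d z)) / N
        = Real.log N + ∑ i ∈ Finset.range N, (∫ z in unitCell N i,
          f (invCompressor g c d z) / g (invCompressor g c d z)) * Real.log (∫ z in unitCell N i,
          f (invCompressor g c d z) / g (invCompressor g c d z)) := by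
      rw [← mul_one (Real.log N), ← hhint, ← sum_setIntegral_unitCell hN hh, Finset.mul_sum,
        ← Finset.sum_add_distrib]
      refine Finset.sum_congr rfl fun i hi => ?_
      rw [Real.log_mul hN'.ne' (hp i hi).ne']
      field_simp
    rw [hf.renyiEntropy_one_compand hg hN, ← EReal.coe_mul, EReal.exp_coe, Function.comp, hsum,
      Real.rpow_def_of_pos hN', ← Real.exp_add]
    congr 2
    ring

theorem renyiEntropy_bot_compand_self (hf : IsPointDensity f c d) {N : ℕ} (hN : 0 < N) :
    renyiEntropy ⊥ (volume.withDensity fun x => ENNReal.ofReal (f x)) (compand f N)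
      = (Real.log N : EReal) := by
  have hN' : (0 : ℝ) < N := by exact_mod_cast hN
  have hp : ∀ i < N, (volume.withDensity fun x => ENNReal.ofReal (f x))
      (compand f N ⁻¹' {invCompressor f c d (unitMid N i)}) = ENNReal.ofReal (N : ℝ)⁻¹ :=
    fun i hi => by
      rw [hf.measure_compand_preimage hf.measurable hf.nonneg hf.zero hf.integrable hi]
      have : ∀ y, f (invCompressor f c d y) / f (invCompressor f c d y) = 1 := fun y =>
        div_self (hf.pos _ (hf.invCompressor_mem y)).ne'
      simp only [this]
      rw [setIntegral_const, volume_real_unitCell]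
      simp
  rw [renyiEntropy, if_neg bot_ne_top, if_pos rfl]
  have : (⨅ a ∈ {a : ℝ | 0 < (volume.withDensity fun x => ENNReal.ofReal (f x))
      (compand f N ⁻¹' {a})}, (volume.withDensity fun x => ENNReal.ofReal (f x))
        (compand f N ⁻¹' {a})) = ENNReal.ofReal (N : ℝ)⁻¹ := by
    refine le_antisymm ?_ (le_iInf₂ fun a ha => ?_)
    · refine (iInf₂_le (invCompressor f c d (unitMid N 0)) ?_).trans (hp 0 hN).le
      rw [mem_ofPred_eq, hp 0 hN]
      exact ENNReal.ofReal_pos.2 (inv_pos.2 hN')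
    · by_cases h : ∀ i < N, a ≠ invCompressor f c d (unitMid N i)
      · exact absurd (hf.measure_compand_preimage_eq_zero hf.measurable hf.zero hN h)
          (ne_of_gt ha)
      · push Not at h
        obtain ⟨i, hi, rfl⟩ := h
        exact (hp i hi).ge
  rw [this, ENNReal.log_ofReal_of_pos (inv_pos.2 hN'), Real.log_inv, EReal.coe_neg, neg_neg]

theorem tendsto_performance_bot (hf : IsPointDensity f c d) {ε r : ℝ} (hε : 0 < ε)
    (hfε : ∀ x ∈ Icc c d, ε ≤ f x) (hr : 1 ≤ r) :
    Tendsto (fun N : ℕ =>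
      EReal.exp (r * renyiEntropy ⊥ (volume.withDensity fun x => ENNReal.ofReal (f x))
        (compand f N)) *
      distortion r (volume.withDensity fun x => ENNReal.ofReal (f x)) (compand f N)) atTop
      (𝓝 (ENNReal.ofReal (Cr r * ∫ x in Icc c d, f x ^ (1 - r)))) := by
  have hD := hf.tendsto_distortion_compand_of_inv_le hf hr (M := ε⁻¹)
    fun x hx => inv_anti₀ hε (hfε x hx)
  have hval : ∫ x in Icc c d, (f x)⁻¹ ^ r * f x = ∫ x in Icc c d, f x ^ (1 - r) := by
    refine setIntegral_congr_fun measurableSet_Icc fun x hx => ?_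
    have h0 := hf.pos x hx
    rw [Real.inv_rpow h0.le, ← Real.rpow_neg h0.le, sub_eq_neg_add, Real.rpow_add h0, Real.rpow_one]
  rw [hval] at hD
  have := tendsto_exp_mul_of_tendsto (E := fun _ => 1)
    (H := fun N => renyiEntropy ⊥ (volume.withDensity fun x => ENNReal.ofReal (f x)) (compand f N))
    zero_le_one ?_ tendsto_const_nhds hD
  · rwa [one_mul] at this
  · filter_upwards [eventually_gt_atTop 0] with N hN
    have hN' : (0 : ℝ) < N := by exact_mod_cast hN
    rw [hf.renyiEntropy_bot_compand_self hN, ← EReal.coe_mul, EReal.exp_coe, mul_one,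
      Real.rpow_def_of_pos hN', mul_comm]

end IsPointDensity

theorem compand_congr_ae {g g' : ℝ → ℝ} (h : g =ᵐ[volume] g') : compand g = compand g' := by
  have h1 : compressor g = compressor g' := funext fun x =>
    integral_congr_ae (ae_restrict_of_ae h)
  have h2 : (volume.withDensity fun x => ENNReal.ofReal (g x))
      = volume.withDensity fun x => ENNReal.ofReal (g' x) :=
    withDensity_congr_ae (h.fun_comp ENNReal.ofReal)
  have h3 : geninv g = geninv g' := by
    funext y
    rw [geninv, geninv, h1, h2]
  funext N x
  rw [compand, compand, h1, h3]

/-- A density bounded below on the interval carrying it agrees almost everywhere with a point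
density. -/
theorem exists_isPointDensity_ae_eq {c d ε : ℝ} {f : ℝ → ℝ} (hf : Measurable f) (hf0 : 0 ≤ f)
    [IsProbabilityMeasure (volume.withDensity fun x => ENNReal.ofReal (f x))]
    (hsupp : msupport (volume.withDensity fun x => ENNReal.ofReal (f x)) ⊆ Icc c d)
    (hε : 0 < ε) (hinf : ∀ᵐ x ∂(volume.restrict (Icc c d)), ε ≤ f x) :
    ∃ f', IsPointDensity f' c d ∧ (∀ x ∈ Icc c d, ε ≤ f' x) ∧ f =ᵐ[volume] f' := by
  have hcompl := measure_compl_eq_zero_of_msupport_subset hsupp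
  have hone : ∫⁻ x, ENNReal.ofReal (f x) = 1 := by
    rw [← setLIntegral_univ, ← withDensity_apply _ MeasurableSet.univ]
    exact measure_univ
  have hcd : c < d := by
    by_contra h
    have h1 : (volume.withDensity fun x => ENNReal.ofReal (f x)) (Icc c d) = 0 :=
      withDensity_absolutelyContinuous _ _ (by simpa using h)
    have h2 := prob_compl_eq_zero_iff (μ := volume.withDensity fun x => ENNReal.ofReal (f x))
      (measurableSet_Icc (a := c) (b := d))
    rw [h2.1 hcompl] at h1
    exact one_ne_zero h1
  have hae : f =ᵐ[volume] (Icc c d).indicator fun x => max (f x) ε := by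
    rw [withDensity_apply _ measurableSet_Icc.compl,
      lintegral_eq_zero_iff hf.ennreal_ofReal] at hcompl
    have h1 := (ae_restrict_iff' measurableSet_Icc.compl).1 hcompl
    have h2 := (ae_restrict_iff' measurableSet_Icc).1 hinf
    filter_upwards [h1, h2] with x hx1 hx2
    by_cases hx : x ∈ Icc c d
    · rw [indicator_of_mem hx, max_eq_left (hx2 hx)]
    · rw [indicator_of_notMem hx]
      exact le_antisymm (ENNReal.ofReal_eq_zero.1 (hx1 hx)) (hf0 x)
  refine ⟨_, ⟨hcd, (hf.max measurable_const).indicator measurableSet_Icc, fun x hx => ?_,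
    fun x hx => indicator_of_notMem hx _, ?_⟩, fun x hx => ?_, hae⟩
  · rw [indicator_of_mem hx]
    exact lt_max_of_lt_right hε
  · rw [← integral_congr_ae hae, integral_eq_lintegral_of_nonneg_ae (ae_of_all _ hf0)
      hf.aestronglyMeasurable, hone, ENNReal.toReal_one]
  · rw [indicator_of_mem hx]
    exact le_max_right _ _

/-- asymptotic performance of the optimal companding quantizer. -/
theorem statement8
    (r : ℝ) (hr : 1 ≤ r) (α : EReal) (hα : α < ((1 + r : ℝ) : EReal))
    (μ : Measure ℝ) [IsProbabilityMeasure μ]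
    (c d : ℝ) (hcd : c ≤ d)
    (f : ℝ → ℝ) (hf_meas : Measurable f) (hf_nonneg : 0 ≤ f)
    (hμ : μ = volume.withDensity fun x => ENNReal.ofReal (f x))
    (hsupp : msupport μ ⊆ Set.Icc c d)
    (hinf : ∃ ε > 0, ∀ᵐ x ∂(volume.restrict (Set.Icc c d)), ε ≤ f x)
    (hint1 : ∀ a : ℝ, α = (a : EReal) → 1 < a →
      IntegrableOn (fun x => f x ^ a1 a r) (Set.Icc c d) volume)
    (hint2 : α = 1 → Integrable (fun x => f x * Real.log (f x)) volume) :
    (∀ a : ℝ, α = (a : EReal) → a ≠ 1 →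
      Tendsto (fun N : ℕ =>
          EReal.exp ((r : EReal) *
              renyiEntropy α μ (compand
                (fun x => (∫ y in Set.Icc c d, f y ^ (1 / a2 a r))⁻¹ * f x ^ (1 / a2 a r)) N)) *
            distortion r μ (compand
              (fun x => (∫ y in Set.Icc c d, f y ^ (1 / a2 a r))⁻¹ * f x ^ (1 / a2 a r)) N))
        atTop
        (𝓝 (ENNReal.ofReal (Cr r * (∫ x in Set.Icc c d, f x ^ a1 a r) ^ a2 a r)))) ∧
    (α = 1 →
      Tendsto (fun N : ℕ =>
          EReal.exp ((r : EReal) *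
              renyiEntropy α μ (compand (Set.indicator (Set.Icc c d) fun _ => (d - c)⁻¹) N)) *
            distortion r μ (compand (Set.indicator (Set.Icc c d) fun _ => (d - c)⁻¹) N))
        atTop
        (𝓝 (ENNReal.ofReal (Cr r * Real.exp (-r * ∫ x, f x * Real.log (f x)))))) ∧
    (α = ⊥ →
      Tendsto (fun N : ℕ =>
          EReal.exp ((r : EReal) * renyiEntropy α μ (compand f N)) *
            distortion r μ (compand f N))
        atTop
        (𝓝 (ENNReal.ofReal (Cr r * ∫ x in Set.Icc c d, f x ^ (1 - r))))) := by
  subst hμ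
  obtain ⟨ε, hε, hinf⟩ := hinf
  obtain ⟨f', hf', hfε, hae⟩ := exists_isPointDensity_ae_eq hf_meas hf_nonneg hsupp hε hinf
  have hμ : (volume.withDensity fun x => ENNReal.ofReal (f x))
      = volume.withDensity fun x => ENNReal.ofReal (f' x) :=
    withDensity_congr_ae (hae.fun_comp ENNReal.ofReal)
  have hpow : ∀ q : ℝ, (fun x => f x ^ q) =ᵐ[volume] fun x => f' x ^ q := fun q =>
    hae.fun_comp fun t => t ^ q
  have hpowI : ∀ q : ℝ, ∫ x in Icc c d, f x ^ q = ∫ x in Icc c d, f' x ^ q := fun q =>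
    integral_congr_ae (ae_restrict_of_ae (hpow q))
  have hlog : (fun x => f x * Real.log (f x)) =ᵐ[volume] fun x => f' x * Real.log (f' x) :=
    hae.fun_comp fun t => t * Real.log t
  rw [hμ, integral_congr_ae hlog, compand_congr_ae hae]
  simp only [hpowI]
  refine ⟨?_, ?_, ?_⟩
  · rintro a rfl ha
    have hg : (fun x => (∫ y in Icc c d, f' y ^ (1 / a2 a r))⁻¹ * f x ^ (1 / a2 a r)) =ᵐ[volume]
        fun x => (∫ y in Icc c d, f' y ^ (1 / a2 a r))⁻¹ * f' x ^ (1 / a2 a r) :=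
      hae.fun_comp fun t => (∫ y in Icc c d, f' y ^ (1 / a2 a r))⁻¹ * t ^ (1 / a2 a r)
    rw [compand_congr_ae hg]
    exact hf'.tendsto_performance_of_ne_one hε hfε hr ha (EReal.coe_lt_coe_iff.1 hα) fun h =>
      (integrable_congr (ae_restrict_of_ae (hpow _))).1 (hint1 a rfl h)
  · rintro rfl
    exact hf'.tendsto_performance_one hr ((integrable_congr hlog).1 (hint2 rfl))
  · rintro rfl
    exact hf'.tendsto_performance_bot hε hfε hr

end
end

section
/- Let r ≥ 1 and β > 0, and let μ be a Borel probability measure on ℝ with ∫|x|^{r+β} dμ(x) < ∞. Then there exists a constant C₀ > 0, depending only on r and β, such that for every R ≥ 1 and every α ∈ [0, ∞], e^{rR}·D^α_μ(R) ≤ C₀·(∫|x|^{r+β} dμ(x))^{r/(r+β)}. -/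
open MeasureTheory Filter Set
open scoped ENNReal Topology Classical

noncomputable section

theorem inv_mul_log_sum_rpow_le {ι : Type*} {G : Finset ι} {p : ι → ℝ}
    (hp : ∀ i ∈ G, 0 < p i) (hsum : ∑ i ∈ G, p i = 1) {a : ℝ} (ha : 0 ≤ a) (ha1 : a ≠ 1) :
    (1 - a)⁻¹ * Real.log (∑ i ∈ G, p i ^ a) ≤ Real.log G.card := by
  have hG : G.Nonempty := by
    rw [Finset.nonempty_iff_ne_empty]
    rintro rfl
    simp at hsum
  have hm : (0 : ℝ) < G.card := by exact_mod_cast hG.card_pos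
  have hT : 0 < ∑ i ∈ G, p i ^ a :=
    Finset.sum_pos (fun i hi => Real.rpow_pos_of_pos (hp i hi) a) hG
  have hscale : ∑ i ∈ G, (1 + (G.card * p i - 1)) ^ a
      = (G.card : ℝ) ^ a * ∑ i ∈ G, p i ^ a := by
    rw [Finset.mul_sum]
    refine Finset.sum_congr rfl fun i hi => ?_
    rw [add_sub_cancel, Real.mul_rpow hm.le (hp i hi).le]
  have hlin : ∑ i ∈ G, (1 + a * (G.card * p i - 1)) = G.card := by
    simp only [Finset.sum_add_distrib, ← Finset.mul_sum, Finset.sum_sub_distrib, hsum,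
      Finset.sum_const, nsmul_eq_mul]
    ring
  have hlog : Real.log ((G.card : ℝ) ^ a * ∑ i ∈ G, p i ^ a)
      = a * Real.log G.card + Real.log (∑ i ∈ G, p i ^ a) := by
    rw [Real.log_mul (by positivity) hT.ne', Real.log_rpow hm]
  have hbase : ∀ i ∈ G, -1 ≤ G.card * p i - 1 := fun i hi => by
    have := mul_pos hm (hp i hi)
    linarith
  rcases lt_or_gt_of_ne ha1 with h | h
  · have key := Finset.sum_le_sum fun i hi => rpow_one_add_le_one_add_mul_self (hbase i hi) ha h.le
    rw [hscale, hlin] at key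
    have := Real.log_le_log (by positivity) key
    rw [inv_mul_le_iff₀ (by linarith)]
    linarith
  · have key := Finset.sum_le_sum fun i hi => one_add_mul_self_le_rpow_one_add (hbase i hi) h.le
    rw [hscale, hlin] at key
    have := Real.log_le_log hm key
    rw [inv_mul_eq_div, div_le_iff_of_neg (by linarith)]
    linarith

theorem sum_negMulLog_le_log_card {ι : Type*} {F : Finset ι} {p : ι → ℝ}
    (hp : ∀ i ∈ F, 0 ≤ p i) (hsum : ∑ i ∈ F, p i = 1) :
    ∑ i ∈ F, -(p i * Real.log (p i)) ≤ Real.log F.card := by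
  have hF : F.Nonempty := by
    rw [Finset.nonempty_iff_ne_empty]
    rintro rfl
    simp at hsum
  have hm : (0 : ℝ) < F.card := by exact_mod_cast hF.card_pos
  have hterm : ∀ i ∈ F, -(p i * Real.log (p i)) ≤
      p i * Real.log F.card + ((F.card : ℝ)⁻¹ - p i) := by
    intro i hi
    rcases (hp i hi).eq_or_lt with h | h
    · simp [← h]
    · have h1 := Real.log_le_sub_one_of_pos (inv_pos.2 (mul_pos hm h))
      rw [Real.log_inv, Real.log_mul hm.ne' h.ne', mul_inv] at h1
      have h2 := mul_le_mul_of_nonneg_left h1 h.le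
      have h3 : p i * ((F.card : ℝ)⁻¹ * (p i)⁻¹ - 1) = (F.card : ℝ)⁻¹ - p i := by
        field_simp
      rw [h3] at h2
      linarith
  refine (Finset.sum_le_sum hterm).trans_eq ?_
  rw [Finset.sum_add_distrib, ← Finset.sum_mul, hsum, Finset.sum_sub_distrib, hsum,
    Finset.sum_const, nsmul_eq_mul, mul_inv_cancel₀ hm.ne']
  ring

theorem renyiEntropy_le_log_card {μ : Measure ℝ} [IsProbabilityMeasure μ] {q : ℝ → ℝ}
    (hq : Measurable q) {F : Finset ℝ} (hF : ∀ x, q x ∈ F) {α : EReal} (hα : 0 ≤ α) :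
    renyiEntropy α μ q ≤ (Real.log F.card : ℝ) := by
  have hempty : ∀ a ∉ F, q ⁻¹' {a} = ∅ := by
    intro a ha
    ext x
    simp only [mem_preimage, mem_singleton_iff, mem_empty_iff_false, iff_false]
    rintro rfl
    exact ha (hF x)
  have hpre : q ⁻¹' (F : Set ℝ) = univ := eq_univ_of_forall hF
  have hsum : ∑ a ∈ F, (μ (q ⁻¹' {a})).toReal = 1 := by
    have := sum_measureReal_preimage_singleton (μ := μ) F
      (fun a _ => hq (measurableSet_singleton a))
    simpa [hpre, measureReal_def] using this
  have hFne : F.Nonempty := ⟨q 0, hF 0⟩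
  have hm : (0 : ℝ) < F.card := by exact_mod_cast hFne.card_pos
  by_cases htop : α = ⊤
  · have hsumE : ∑ a ∈ F, μ (q ⁻¹' {a}) = 1 := by
      rw [sum_measure_preimage_singleton F (fun a _ => hq (measurableSet_singleton a)), hpre,
        measure_univ]
    have h1 : (1 : ℝ≥0∞) ≤ F.card * ⨆ a : ℝ, μ (q ⁻¹' {a}) := by
      rw [← hsumE, ← nsmul_eq_mul]
      exact Finset.sum_le_card_nsmul _ _ _ fun a _ => le_iSup (fun a => μ (q ⁻¹' {a})) a
    have h2 : ENNReal.ofReal (F.card : ℝ)⁻¹ ≤ ⨆ a : ℝ, μ (q ⁻¹' {a}) := by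
      rw [ENNReal.ofReal_inv_of_pos hm, ENNReal.ofReal_natCast, ← one_div]
      exact ENNReal.div_le_of_le_mul' h1
    have h3 := ENNReal.log_le_log h2
    rw [ENNReal.log_ofReal_of_pos (inv_pos.2 hm), Real.log_inv, EReal.coe_neg] at h3
    rw [renyiEntropy, if_pos htop]
    exact EReal.neg_le_of_neg_le h3
  have hbot : α ≠ ⊥ := by
    rintro rfl
    simp at hα
  by_cases hone : α = 1
  · rw [renyiEntropy, if_neg htop, if_neg hbot, if_pos hone,
      tsum_eq_sum (s := F) fun a ha => by simp [hempty a ha],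
      ← ENNReal.ofReal_sum_of_nonneg, EReal.coe_ennreal_ofReal]
    · refine EReal.coe_le_coe_iff.2 (max_le ?_ (Real.log_natCast_nonneg _))
      exact sum_negMulLog_le_log_card (fun _ _ => ENNReal.toReal_nonneg) hsum
    · intro a _
      rw [neg_nonneg]
      exact mul_nonpos_of_nonneg_of_nonpos ENNReal.toReal_nonneg
        (Real.log_nonpos ENNReal.toReal_nonneg measureReal_le_one)
  · have ha : 0 ≤ α.toReal := EReal.toReal_nonneg hα
    have ha1 : α.toReal ≠ 1 := fun h => hone (by rw [← EReal.coe_toReal htop hbot, h]; rfl)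
    set G : Finset ℝ := F.filter fun a => 0 < μ (q ⁻¹' {a}) with hGdef
    have hGpos : ∀ a ∈ G, 0 < (μ (q ⁻¹' {a})).toReal := fun a h =>
      ENNReal.toReal_pos (Finset.mem_filter.1 h).2.ne' (measure_ne_top _ _)
    have hGsum : ∑ a ∈ G, (μ (q ⁻¹' {a})).toReal = 1 := by
      rw [← hsum]
      refine Finset.sum_subset (Finset.filter_subset _ _) fun a haF haG => ?_
      have : ¬ 0 < μ (q ⁻¹' {a}) := fun h => haG (Finset.mem_filter.2 ⟨haF, h⟩)
      simp [nonpos_iff_eq_zero.1 (not_lt.1 this)]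
    have hGne : G.Nonempty := by
      rw [Finset.nonempty_iff_ne_empty]
      intro h
      simp [h] at hGsum
    have hT : 0 < ∑ a ∈ G, (μ (q ⁻¹' {a})).toReal ^ α.toReal :=
      Finset.sum_pos (fun a h => Real.rpow_pos_of_pos (hGpos a h) _) hGne
    have hS : (∑' a : ℝ, if 0 < μ (q ⁻¹' {a}) then μ (q ⁻¹' {a}) ^ α.toReal else 0)
        = ENNReal.ofReal (∑ a ∈ G, (μ (q ⁻¹' {a})).toReal ^ α.toReal) := by
      rw [tsum_eq_sum (s := F) fun a ha => by simp [hempty a ha], ← Finset.sum_filter,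
        ENNReal.ofReal_sum_of_nonneg fun a _ => Real.rpow_nonneg ENNReal.toReal_nonneg _]
      refine Finset.sum_congr rfl fun a h => ?_
      rw [← ENNReal.ofReal_rpow_of_pos (hGpos a h), ENNReal.ofReal_toReal (measure_ne_top _ _)]
    rw [renyiEntropy, if_neg htop, if_neg hbot, if_neg hone, hS, ENNReal.log_ofReal_of_pos hT,
      ← EReal.coe_mul, EReal.coe_le_coe_iff]
    refine (inv_mul_log_sum_rpow_le hGpos hGsum ha ha1).trans ?_
    refine Real.log_le_log (by exact_mod_cast hGne.card_pos) ?_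
    exact_mod_cast Finset.card_le_card (Finset.filter_subset _ _)

theorem optErr_le_distortion {r : ℝ} {μ : Measure ℝ} [IsProbabilityMeasure μ] {q : ℝ → ℝ}
    (hq : Measurable q) {F : Finset ℝ} (hF : ∀ x, q x ∈ F) {R : ℝ}
    (hR : (F.card : ℝ) ≤ Real.exp R) {α : EReal} (hα : 0 ≤ α) :
    optErr r α μ R ≤ distortion r μ q := by
  have hm : (0 : ℝ) < F.card := by exact_mod_cast Finset.card_pos.2 ⟨q 0, hF 0⟩
  refine iInf₂_le q ⟨⟨hq, F.countable_toSet.mono (range_subset_iff.2 hF)⟩, ?_⟩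
  refine (renyiEntropy_le_log_card hq hF hα).trans (EReal.coe_le_coe_iff.2 ?_)
  rwa [Real.log_le_iff_le_exp hm]

theorem rpow_neg_sub_rpow_neg_le {u v p : ℝ} (hu : 0 < u) (hv : 0 < v) (hp : 0 ≤ p) :
    u ^ (-p) - v ^ (-p) ≤ p * (v - u) * u ^ (-p - 1) := by
  have hup := Real.rpow_pos_of_pos hu (-p)
  have h1 : 1 - p * (v / u - 1) ≤ (v / u) ^ (-p) := by
    rw [Real.rpow_def_of_pos (div_pos hv hu)]
    have h2 := mul_le_mul_of_nonneg_left (Real.log_le_sub_one_of_pos (div_pos hv hu)) hp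
    have h3 := Real.add_one_le_exp (Real.log (v / u) * -p)
    linarith
  rw [Real.div_rpow hv.le hu.le, le_div_iff₀ hup] at h1
  have h4 : p * (v / u - 1) * u ^ (-p) = p * (v - u) * u ^ (-p - 1) := by
    rw [Real.rpow_sub_one hu.ne']
    field_simp
  linarith

/-- The quantizer with step `1 / n` composed with the compressor `x ↦ 1 - (1 + |x| / s) ^ (-d)`
on each half-line. -/
def powerCompander (d s : ℝ) (n : ℕ) (x : ℝ) : ℝ :=
  (if 0 ≤ x then 1 else -1) *
    (s * (((⌈n * (1 + |x| / s) ^ (-d)⌉₊ : ℝ) / n) ^ (-d⁻¹) - 1))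

theorem measurable_powerCompander (d s : ℝ) (n : ℕ) : Measurable (powerCompander d s n) := by
  have hc : Measurable fun y : ℝ => (⌈y⌉₊ : ℝ) :=
    (measurable_from_top (f := fun k : ℕ => (k : ℝ))).comp Nat.measurable_ceil
  have h : Measurable fun x : ℝ => (⌈n * (1 + |x| / s) ^ (-d)⌉₊ : ℝ) := by
    refine hc.comp ?_
    fun_prop
  have hs : Measurable fun x : ℝ => if 0 ≤ x then (1 : ℝ) else -1 :=
    Measurable.ite measurableSet_Ici measurable_const measurable_const
  unfold powerCompander
  fun_prop

theorem exists_finset_powerCompander {d s : ℝ} (hd : 0 ≤ d) (hs : 0 < s) {n : ℕ} (hn : 0 < n) :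
    ∃ F : Finset ℝ, F.card ≤ 2 * n ∧ ∀ x, powerCompander d s n x ∈ F := by
  refine ⟨(({1, -1} : Finset ℝ) ×ˢ Finset.Icc 1 n).image fun z =>
    z.1 * (s * (((z.2 : ℝ) / n) ^ (-d⁻¹) - 1)), ?_, fun x => ?_⟩
  · refine Finset.card_image_le.trans ?_
    rw [Finset.card_product, Nat.card_Icc, Nat.add_sub_cancel]
    exact Nat.mul_le_mul_right _ Finset.card_le_two
  · have hn' : (0 : ℝ) < n := by exact_mod_cast hn
    have hb : 1 ≤ 1 + |x| / s := by
      have : 0 ≤ |x| / s := by positivity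
      linarith
    refine Finset.mem_image.2 ⟨(if 0 ≤ x then 1 else -1, ⌈n * (1 + |x| / s) ^ (-d)⌉₊), ?_, rfl⟩
    refine Finset.mem_product.2 ⟨by dsimp only; split_ifs <;> simp, Finset.mem_Icc.2 ⟨?_, ?_⟩⟩
    · exact Nat.ceil_pos.2 (by positivity)
    · refine Nat.ceil_le.2 (mul_le_of_le_one_right hn'.le ?_)
      exact Real.rpow_le_one_of_one_le_of_nonpos hb (by linarith)

theorem abs_sub_powerCompander_le {d s : ℝ} (hd : 0 < d) (hs : 0 < s) {n : ℕ} (hn : 0 < n)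
    (x : ℝ) : |x - powerCompander d s n x| ≤ s * (d⁻¹ / n) * (1 + |x| / s) ^ (1 + d) := by
  have hn' : (0 : ℝ) < n := by exact_mod_cast hn
  have hb1 : 1 ≤ 1 + |x| / s := by
    have : 0 ≤ |x| / s := by positivity
    linarith
  have hxs : |x| = s * (1 + |x| / s - 1) := by field_simp; ring
  unfold powerCompander
  set b := 1 + |x| / s
  have hb : 0 < b := by linarith
  set u := b ^ (-d) with hu_def
  have hu : 0 < u := by positivity
  set k : ℝ := (⌈n * u⌉₊ : ℝ)
  have hk1 : n * u ≤ k := Nat.le_ceil _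
  have hk2 : k < n * u + 1 := Nat.ceil_lt_add_one (by positivity)
  have huv : u ≤ k / n := by rw [le_div_iff₀ hn']; linarith
  have hvu : k / n - u ≤ 1 / n := by
    rw [sub_le_iff_le_add, div_add' _ _ _ hn'.ne', div_le_div_iff_of_pos_right hn']
    linarith
  have hv : 0 < k / n := hu.trans_le huv
  have hub : u ^ (-d⁻¹) = b := by
    rw [hu_def, ← Real.rpow_mul hb.le]
    simp [hd.ne']
  have hub' : u ^ (-d⁻¹ - 1) = b ^ (1 + d) := by
    rw [hu_def, ← Real.rpow_mul hb.le]
    congr 1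
    field_simp
    ring
  have hle : (k / n) ^ (-d⁻¹) ≤ b := by
    rw [← hub]
    exact Real.rpow_le_rpow_of_nonpos hu huv (by simp [hd.le])
  have hsub : b - (k / n) ^ (-d⁻¹) ≤ d⁻¹ / n * b ^ (1 + d) := by
    have h := rpow_neg_sub_rpow_neg_le hu hv (inv_nonneg.2 hd.le)
    rw [hub, hub'] at h
    refine h.trans (mul_le_mul_of_nonneg_right ?_ (by positivity))
    calc d⁻¹ * (k / n - u) ≤ d⁻¹ * (1 / n) := mul_le_mul_of_nonneg_left hvu (by positivity)
      _ = d⁻¹ / n := by ring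
  have habs : |x - (if 0 ≤ x then 1 else -1) * (s * ((k / n) ^ (-d⁻¹) - 1))|
      = s * (b - (k / n) ^ (-d⁻¹)) := by
    have h0 : 0 ≤ s * (b - (k / n) ^ (-d⁻¹)) := mul_nonneg hs.le (by linarith)
    split_ifs with hx
    · rw [abs_of_nonneg hx] at hxs
      rw [← abs_of_nonneg h0]
      congr 1
      linarith
    · rw [abs_of_neg (not_le.1 hx)] at hxs
      rw [← abs_of_nonneg h0, ← abs_neg]
      congr 1
      linarith
  rw [habs, mul_assoc]
  exact mul_le_mul_of_nonneg_left hsub hs.le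

theorem one_add_rpow_le {t q : ℝ} (ht : 0 ≤ t) (hq : 0 ≤ q) :
    (1 + t) ^ q ≤ 2 ^ q * (1 + t ^ q) := by
  have h0 : 0 ≤ t ^ q := Real.rpow_nonneg ht q
  have h2 : (0 : ℝ) ≤ 2 ^ q := by positivity
  rcases le_total t 1 with h | h
  · calc (1 + t) ^ q ≤ 2 ^ q := Real.rpow_le_rpow (by linarith) (by linarith) hq
      _ ≤ 2 ^ q * (1 + t ^ q) := le_mul_of_one_le_right h2 (by linarith)
  · calc (1 + t) ^ q ≤ (2 * t) ^ q := Real.rpow_le_rpow (by linarith) (by linarith) hq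
      _ = 2 ^ q * t ^ q := Real.mul_rpow (by norm_num) ht
      _ ≤ 2 ^ q * (1 + t ^ q) := mul_le_mul_of_nonneg_left (by linarith) h2

theorem distortion_powerCompander_le {r β : ℝ} (hr : 1 ≤ r) (hβ : 0 < β) {μ : Measure ℝ}
    [IsProbabilityMeasure μ] (hμ : Integrable (fun x => |x| ^ (r + β)) μ) {s : ℝ} (hs : 0 < s)
    (hsM : ∫ x, |x| ^ (r + β) ∂μ = s ^ (r + β)) {n : ℕ} (hn : 0 < n) :
    distortion r μ (powerCompander (β / r) s n) ≤
      ENNReal.ofReal ((s * (r / β / n)) ^ r * 2 ^ (r + β + 1)) := by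
  have hr0 : 0 < r := by linarith
  have hsq : 0 < s ^ (r + β) := by positivity
  have hpt : ∀ x, |x - powerCompander (β / r) s n x| ^ r ≤
      (s * (r / β / n)) ^ r * (2 ^ (r + β) * (1 + |x| ^ (r + β) / s ^ (r + β))) := by
    intro x
    have h := Real.rpow_le_rpow (abs_nonneg _)
      (abs_sub_powerCompander_le (div_pos hβ hr0) hs hn x) hr0.le
    refine h.trans ?_
    have hb : 0 ≤ |x| / s := by positivity
    rw [inv_div, Real.mul_rpow (by positivity) (by positivity), ← Real.rpow_mul (by positivity),
      ← Real.div_rpow (abs_nonneg x) hs.le]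
    have he : (1 + β / r) * r = r + β := by field_simp
    rw [he]
    exact mul_le_mul_of_nonneg_left (one_add_rpow_le hb (by positivity)) (by positivity)
  have hint : Integrable (fun x => (s * (r / β / n)) ^ r *
      (2 ^ (r + β) * (1 + |x| ^ (r + β) / s ^ (r + β)))) μ :=
    (((integrable_const 1).add (hμ.div_const _)).const_mul _).const_mul _
  calc distortion r μ (powerCompander (β / r) s n)
      ≤ ∫⁻ x, ENNReal.ofReal ((s * (r / β / n)) ^ r *
          (2 ^ (r + β) * (1 + |x| ^ (r + β) / s ^ (r + β)))) ∂μ :=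
        lintegral_mono fun x => ENNReal.ofReal_le_ofReal (hpt x)
    _ = ENNReal.ofReal (∫ x, (s * (r / β / n)) ^ r *
          (2 ^ (r + β) * (1 + |x| ^ (r + β) / s ^ (r + β))) ∂μ) :=
        (ofReal_integral_eq_lintegral_ofReal hint (ae_of_all _ fun x => by
          simp only [Pi.zero_apply]; positivity)).symm
    _ = ENNReal.ofReal ((s * (r / β / n)) ^ r * 2 ^ (r + β + 1)) := by
        rw [integral_const_mul, integral_const_mul,
          integral_add (integrable_const 1) (hμ.div_const _), integral_div, hsM,
          div_self hsq.ne', Real.rpow_add_one (by norm_num)]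
        norm_num

/-- Pierce-type upper bound, uniform over `α ∈ [0,∞]`. -/
theorem statement9
    (r β : ℝ) (hr : 1 ≤ r) (hβ : 0 < β) :
    ∃ C₀ > (0 : ℝ), ∀ (μ : Measure ℝ), IsProbabilityMeasure μ →
      Integrable (fun x => |x| ^ (r + β)) μ →
      ∀ R : ℝ, 1 ≤ R → ∀ α : EReal, 0 ≤ α →
        ENNReal.ofReal (Real.exp (r * R)) * optErr r α μ R ≤
          ENNReal.ofReal (C₀ * (∫ x, |x| ^ (r + β) ∂μ) ^ (r / (r + β))) := by
  have hr0 : 0 < r := by linarith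
  refine ⟨(4 * (r / β)) ^ r * 2 ^ (r + β + 1), by positivity, fun μ _ hμ R hR α hα => ?_⟩
  have hexp : 2 ≤ Real.exp R := by
    have := Real.add_one_le_exp R
    linarith
  have hM : 0 ≤ ∫ x, |x| ^ (r + β) ∂μ := integral_nonneg fun x => by positivity
  rcases hM.eq_or_lt with h0 | hpos
  · have hae : ∀ᵐ x ∂μ, |x| ^ (r + β) = 0 :=
      (integral_eq_zero_iff_of_nonneg (fun x => by positivity) hμ).1 h0.symm
    have hdist : distortion r μ (fun _ => 0) = 0 := by
      rw [distortion, ← lintegral_zero (μ := μ)]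
      refine lintegral_congr_ae (hae.mono fun x hx => ?_)
      rw [Real.rpow_eq_zero (abs_nonneg x) (by positivity)] at hx
      simp [hx, hr0.ne']
    have hopt : optErr r α μ R ≤ distortion r μ (fun _ => 0) :=
      optErr_le_distortion (F := {0}) measurable_const (by simp)
        (by rw [Finset.card_singleton, Nat.cast_one]; linarith) hα
    rw [hdist, nonpos_iff_eq_zero] at hopt
    simp [hopt]
  · set M := ∫ x, |x| ^ (r + β) ∂μ with hMdef
    set s := M ^ (r + β)⁻¹ with hsdef
    have hs : 0 < s := by positivity
    have hsM : M = s ^ (r + β) := by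
      rw [hsdef, Real.rpow_inv_rpow hM (by positivity)]
    have hsr : s ^ r = M ^ (r / (r + β)) := by
      rw [hsdef, ← Real.rpow_mul hM, inv_mul_eq_div]
    have hn : 0 < ⌊Real.exp R / 2⌋₊ := Nat.floor_pos.2 (by linarith)
    have hle : (⌊Real.exp R / 2⌋₊ : ℝ) ≤ Real.exp R / 2 := Nat.floor_le (by positivity)
    have hlt := Nat.lt_floor_add_one (Real.exp R / 2)
    set n := ⌊Real.exp R / 2⌋₊
    have hn1 : (1 : ℝ) ≤ n := by exact_mod_cast hn
    obtain ⟨F, hFcard, hF⟩ := exists_finset_powerCompander (div_nonneg hβ.le hr0.le) hs hn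
    have hFR : (F.card : ℝ) ≤ Real.exp R := by
      have : (F.card : ℝ) ≤ 2 * n := by exact_mod_cast hFcard
      linarith
    calc ENNReal.ofReal (Real.exp (r * R)) * optErr r α μ R
        ≤ ENNReal.ofReal (Real.exp (r * R)) *
            ENNReal.ofReal ((s * (r / β / n)) ^ r * 2 ^ (r + β + 1)) := by
          gcongr
          exact (optErr_le_distortion (measurable_powerCompander _ _ _) hF hFR hα).trans
            (distortion_powerCompander_le hr hβ hμ hs hsM hn)
      _ = ENNReal.ofReal ((Real.exp R * (s * (r / β / n))) ^ r * 2 ^ (r + β + 1)) := by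
          rw [← ENNReal.ofReal_mul (by positivity), mul_comm r R, Real.exp_mul, ← mul_assoc,
            ← Real.mul_rpow (by positivity) (by positivity)]
      _ ≤ ENNReal.ofReal ((4 * (r / β) * s) ^ r * 2 ^ (r + β + 1)) := by
          refine ENNReal.ofReal_le_ofReal (mul_le_mul_of_nonneg_right ?_ (by positivity))
          refine Real.rpow_le_rpow (by positivity) ?_ hr0.le
          have h4 : Real.exp R / n ≤ 4 := by
            rw [div_le_iff₀ (by linarith)]
            linarith
          calc Real.exp R * (s * (r / β / n)) = Real.exp R / n * (r / β * s) := by ring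
            _ ≤ 4 * (r / β * s) := mul_le_mul_of_nonneg_right h4 (by positivity)
            _ = 4 * (r / β) * s := by ring
      _ = ENNReal.ofReal ((4 * (r / β)) ^ r * 2 ^ (r + β + 1) * M ^ (r / (r + β))) := by
          rw [Real.mul_rpow (by positivity) hs.le, hsr, mul_right_comm]

end
end
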